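/- arXiv:1303.0364 — 2 statements merged into one kernel-verified Lean document; each statement's English description precedes it below -/
import Mathlib

section
/- There exists an absolute constant c > 0 such that for every f ∈ L¹(𝕋) and every λ > 0, |{x ∈ 𝕋 : bmo[U_n(x,f)] > λ}| ≤ (c/λ)·∫_𝕋 |f|, where U_n(x,f) = p.v. (1/π)∫_𝕋 (cos(nt)/(2 tan(t/2))) f(x+t) dt. -/
open MeasureTheory Filter Set

noncomputable section

/-- `[-π, π)`, a fundamental domain for the circle `𝕋 = ℝ/2πℤ`. -/
def T1 : Set ℝ := Set.Ico (-Real.pi) Real.pi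

/-- `[-π, π)²`, a fundamental domain for the torus `𝕋²`. -/
def T2 : Set (ℝ × ℝ) := T1 ×ˢ T1

/-- `log⁺ u = log u` for `u > 1`, and `0` otherwise. -/
def logPlus (u : ℝ) : ℝ := if 1 < u then Real.log u else 0

/-- `f` is `2π`-periodic in each variable. -/
def Biperiodic (f : ℝ × ℝ → ℝ) : Prop :=
  ∀ x y : ℝ, f (x + 2 * Real.pi, y) = f (x, y) ∧ f (x, y + 2 * Real.pi) = f (x, y)

/-- Fourier coefficients `f̂(m,n)` of a function on `𝕋²`. -/
def fourierCoef2 (f : ℝ × ℝ → ℝ) (m n : ℤ) : ℂ :=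
  (1 / (4 * (Real.pi : ℂ) ^ 2)) *
    ∫ p in T2, (f p : ℂ) * Complex.exp (-Complex.I * ((m : ℂ) * (p.1 : ℂ) + (n : ℂ) * (p.2 : ℂ)))

/-- Quadratic partial sums `S_{nn}(x, y, f)` of the double Fourier series.
(For real `f` the symmetric sum is real, so we take the real part.) -/
def Snn (f : ℝ × ℝ → ℝ) (n : ℕ) (x y : ℝ) : ℝ :=
  (∑ m ∈ Finset.Icc (-(n : ℤ)) (n : ℤ), ∑ k ∈ Finset.Icc (-(n : ℤ)) (n : ℤ),
    fourierCoef2 f m k * Complex.exp (Complex.I * ((m : ℂ) * (x : ℂ) + (k : ℂ) * (y : ℂ)))).re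

/-- The `BMO[0,1]` norm:
`‖g‖_BMO = sup_{I ⊂ [0,1]} (1/|I|) ∫_I |g - g_I| + |∫_0^1 g|`. -/
def bmoNorm (g : ℝ → ℝ) : ℝ :=
  (⨆ I : {p : ℝ × ℝ // 0 ≤ p.1 ∧ p.1 < p.2 ∧ p.2 ≤ 1},
      (I.1.2 - I.1.1)⁻¹ *
        ∫ t in Set.Icc I.1.1 I.1.2,
          |g t - (I.1.2 - I.1.1)⁻¹ * ∫ s in Set.Icc I.1.1 I.1.2, g s|) +
    |∫ t in Set.Icc (0 : ℝ) 1, g t|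

/-- The step function `Σ_{k=0}^n ξ_k 𝟙_{δ_k^n}` with `δ_k^n = [k/(n+1), (k+1)/(n+1)]`. -/
def stepFun (ξ : ℕ → ℝ) (n : ℕ) (t : ℝ) : ℝ :=
  ∑ k ∈ Finset.range (n + 1),
    Set.indicator (Set.Icc ((k : ℝ) / ((n : ℝ) + 1)) (((k : ℝ) + 1) / ((n : ℝ) + 1)))
      (fun _ => ξ k) t

/-- `bmo[ξ_n] = sup_{n ≥ 0} ‖Σ_{k=0}^n ξ_k 𝟙_{δ_k^n}‖_BMO`. -/
def bmoSeq (ξ : ℕ → ℝ) : ℝ := ⨆ n : ℕ, bmoNorm (stepFun ξ n)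

/-- `L` is the principal value `p.v. ∫_𝕋 g`, i.e. the limit as `ε → 0⁺` of the
integrals over `{ε < |t| < π}`. -/
def pvT1 (g : ℝ → ℝ) (L : ℝ) : Prop :=
  Filter.Tendsto (fun ε : ℝ => ∫ t in {t : ℝ | ε < |t| ∧ |t| < Real.pi}, g t)
    (nhdsWithin 0 (Set.Ioi 0)) (nhds L)

/-- `L` is the two-dimensional principal value `p.v. ∬_{𝕋²} g`, the limit as `ε → 0⁺`
of the integrals over `{ε < |t| < π, ε < |s| < π}`. -/
def pvT2 (g : ℝ × ℝ → ℝ) (L : ℝ) : Prop :=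
  Filter.Tendsto
    (fun ε : ℝ =>
      ∫ q in {q : ℝ × ℝ | (ε < |q.1| ∧ |q.1| < Real.pi) ∧ ε < |q.2| ∧ |q.2| < Real.pi}, g q)
    (nhdsWithin 0 (Set.Ioi 0)) (nhds L)

/-- Luxemburg norm with respect to a Young function `M`. -/
def luxNorm {α : Type*} [MeasurableSpace α] (μ : Measure α) (M : ℝ → ℝ) (g : α → ℝ) : ℝ :=
  sInf {lam : ℝ | 0 < lam ∧ ∫⁻ x, ENNReal.ofReal (M (|g x| / lam)) ∂μ ≤ 1}

/-- The Young function `Φ(t) = t log⁺ t`. -/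
def PhiY (t : ℝ) : ℝ := t * logPlus t

/-- The Young function `Ψ(t) = eᵗ - 1`. -/
def PsiY (t : ℝ) : ℝ := Real.exp t - 1

open scoped ENNReal Topology

lemma aux_HL (w : ℝ → ℝ≥0∞) (hw : ∫⁻ y, w y ≠ ∞) (Λ : ℝ) (hΛ : 0 < Λ) :
    volume {x : ℝ | ∃ r : ℝ, 0 < r ∧ ENNReal.ofReal (Λ * r) < ∫⁻ y in Metric.closedBall x r, w y}
      ≤ ENNReal.ofReal (10 / Λ) * ∫⁻ y, w y := by
  set S := {x : ℝ | ∃ r : ℝ, 0 < r ∧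
    ENNReal.ofReal (Λ * r) < ∫⁻ y in Metric.closedBall x r, w y} with hS
  have hex : ∀ x : ℝ, ∃ r : ℝ, x ∈ S → (0 < r ∧
      ENNReal.ofReal (Λ * r) < ∫⁻ y in Metric.closedBall x r, w y) := by
    intro x
    by_cases hx : x ∈ S
    · obtain ⟨r, hr⟩ := hx
      exact ⟨r, fun _ => hr⟩
    · exact ⟨0, fun h => absurd h hx⟩
  choose r hr using hex
  have hR : ∀ x ∈ S, r x ≤ (∫⁻ y, w y).toReal / Λ := by
    intro x hx
    have h1 := (hr x hx).2.le.trans (setLIntegral_le_lintegral _ _)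
    rw [ENNReal.ofReal_le_iff_le_toReal hw] at h1
    rw [le_div_iff₀ hΛ]; linarith
  obtain ⟨u, huS, hdis, hcov⟩ := Vitali.exists_disjoint_subfamily_covering_enlargement_closedBall
    S (fun x => x) r _ hR 5 (by norm_num)
  have hcount : u.Countable := by
    apply hdis.countable_of_nonempty_interior
    intro x hx
    have := (hr x (huS hx)).1
    exact ⟨x, Metric.ball_subset_interior_closedBall (Metric.mem_ball_self this)⟩
  have hsub : S ⊆ ⋃ x ∈ u, Metric.closedBall x (5 * r x) := by
    intro x hx
    obtain ⟨b, hb, hbs⟩ := hcov x hx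
    exact mem_biUnion hb (hbs (Metric.mem_closedBall_self (hr x hx).1.le))
  calc volume S ≤ volume (⋃ x ∈ u, Metric.closedBall x (5 * r x)) := measure_mono hsub
    _ ≤ ∑' x : u, volume (Metric.closedBall (x : ℝ) (5 * r x)) := measure_biUnion_le _ hcount _
    _ ≤ ∑' x : u, ENNReal.ofReal (10 / Λ) * ∫⁻ y in Metric.closedBall (x : ℝ) (r x), w y := by
        refine ENNReal.tsum_le_tsum fun x => ?_
        have h := hr x (huS x.2)
        rw [Real.volume_closedBall]
        calc ENNReal.ofReal (2 * (5 * r x)) = ENNReal.ofReal (10 / Λ) * ENNReal.ofReal (Λ * r x) := by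
              rw [← ENNReal.ofReal_mul (by positivity)]
              congr 1; field_simp; ring
          _ ≤ _ := by gcongr; exact h.2.le
    _ = ENNReal.ofReal (10 / Λ) * ∑' x : u, ∫⁻ y in Metric.closedBall (x : ℝ) (r x), w y :=
        ENNReal.tsum_mul_left
    _ = ENNReal.ofReal (10 / Λ) * ∫⁻ y in ⋃ x ∈ u, Metric.closedBall (x : ℝ) (r x), w y := by
        rw [lintegral_biUnion hcount (fun x _ => Metric.isClosed_closedBall.measurableSet) hdis]
    _ ≤ _ := by gcongr; exact Measure.restrict_le_self

/-- the basic decaying kernel -/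
def kmin (ρ u : ℝ) : ℝ := 1 / (max ρ |u|) ^ 2

lemma kmin_meas (ρ : ℝ) : Measurable (kmin ρ) := by
  unfold kmin; fun_prop

lemma kmin_nonneg (ρ u : ℝ) : 0 ≤ kmin ρ u := by unfold kmin; positivity

lemma aux_tail (w : ℝ → ℝ≥0∞) (hwm : Measurable w) (y Λ d ρ : ℝ) (hΛ : 0 ≤ Λ) (hd : 0 ≤ d)
    (hρ : 0 < ρ)
    (h : ∀ r : ℝ, 0 < r → ∫⁻ s in Metric.closedBall y r, w s ≤ ENNReal.ofReal (Λ * (r + d))) :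
    ∫⁻ s, w s * ENNReal.ofReal (kmin ρ (s - y)) ≤ ENNReal.ofReal (8 * Λ * (ρ + d) / ρ ^ 2) := by
  have hpt : ∀ s, ENNReal.ofReal (kmin ρ (s - y)) ≤
      ∑' j : ℕ, indicator (Metric.closedBall y (2 ^ j * ρ))
        (fun _ => ENNReal.ofReal (4 / (2 ^ j * ρ) ^ 2)) s := by
    intro s
    have hex : ∃ j : ℕ, |s - y| ≤ 2 ^ j * ρ := by
      obtain ⟨j, hj⟩ := pow_unbounded_of_one_lt (|s - y| / ρ) (one_lt_two)
      exact ⟨j, by rw [div_lt_iff₀ hρ] at hj; exact hj.le⟩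
    classical
    have hj := Nat.find_spec hex
    refine le_trans ?_ (ENNReal.le_tsum (Nat.find hex))
    rw [indicator_of_mem (by rw [Metric.mem_closedBall, Real.dist_eq]; exact hj)]
    apply ENNReal.ofReal_le_ofReal
    unfold kmin
    have key : 2 ^ (Nat.find hex) * ρ ≤ 2 * max ρ |s - y| := by
      rcases Nat.eq_zero_or_pos (Nat.find hex) with h0 | h0
      · rw [h0]; have := le_max_left ρ |s - y|; simp; linarith
      · have h1 := Nat.find_min hex (Nat.sub_lt h0 one_pos)
        push Not at h1
        have h2 := le_max_right ρ |s - y|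
        obtain ⟨k, hk⟩ : ∃ k, Nat.find hex = k + 1 := ⟨Nat.find hex - 1, by omega⟩
        rw [hk] at h1 ⊢
        simp only [Nat.add_sub_cancel] at h1
        rw [pow_succ]; linarith
    have hm : 0 < max ρ |s - y| := lt_max_of_lt_left hρ
    rw [div_le_div_iff₀ (by positivity) (by positivity)]
    have : (2 ^ (Nat.find hex) * ρ) ^ 2 ≤ (2 * max ρ |s - y|) ^ 2 := by gcongr
    nlinarith
  calc ∫⁻ s, w s * ENNReal.ofReal (kmin ρ (s - y))
      ≤ ∫⁻ s, ∑' j : ℕ, w s * indicator (Metric.closedBall y (2 ^ j * ρ))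
        (fun _ => ENNReal.ofReal (4 / (2 ^ j * ρ) ^ 2)) s := by
        refine lintegral_mono fun s => ?_
        simp only
        rw [ENNReal.tsum_mul_left]
        gcongr; exact hpt s
    _ = ∑' j : ℕ, ∫⁻ s, w s * indicator (Metric.closedBall y (2 ^ j * ρ))
        (fun _ => ENNReal.ofReal (4 / (2 ^ j * ρ) ^ 2)) s := by
        rw [lintegral_tsum]
        intro j
        exact (hwm.mul (measurable_const.indicator
          Metric.isClosed_closedBall.measurableSet)).aemeasurable
    _ ≤ ∑' j : ℕ, ENNReal.ofReal (4 * Λ * (ρ + d) / ρ ^ 2 * (1 / 2) ^ j) := by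
        refine ENNReal.tsum_le_tsum fun j => ?_
        have e : ∀ s, w s * indicator (Metric.closedBall y (2 ^ j * ρ))
            (fun _ => ENNReal.ofReal (4 / (2 ^ j * ρ) ^ 2)) s =
            indicator (Metric.closedBall y (2 ^ j * ρ))
            (fun s => w s * ENNReal.ofReal (4 / (2 ^ j * ρ) ^ 2)) s := by
          intro s; by_cases hs : s ∈ Metric.closedBall y (2 ^ j * ρ) <;> simp [hs]
        simp_rw [e]
        rw [lintegral_indicator Metric.isClosed_closedBall.measurableSet,
          lintegral_mul_const _ hwm]
        have hp : (0:ℝ) < 2 ^ j * ρ := by positivity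
        calc _ ≤ ENNReal.ofReal (Λ * (2 ^ j * ρ + d)) * ENNReal.ofReal (4 / (2 ^ j * ρ) ^ 2) := by
              gcongr; exact h _ hp
          _ = ENNReal.ofReal (Λ * (2 ^ j * ρ + d) * (4 / (2 ^ j * ρ) ^ 2)) := by
              rw [← ENNReal.ofReal_mul (by positivity)]
          _ ≤ _ := by
              apply ENNReal.ofReal_le_ofReal
              have h1 : (1:ℝ) ≤ 2 ^ j := one_le_pow₀ (by norm_num)
              have h2 : 2 ^ j * ρ + d ≤ 2 ^ j * (ρ + d) := by nlinarith
              calc Λ * (2 ^ j * ρ + d) * (4 / (2 ^ j * ρ) ^ 2)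
                  ≤ Λ * (2 ^ j * (ρ + d)) * (4 / (2 ^ j * ρ) ^ 2) := by gcongr
                _ = _ := by rw [one_div, inv_pow]; field_simp
    _ = ENNReal.ofReal (8 * Λ * (ρ + d) / ρ ^ 2) := by
        rw [← ENNReal.ofReal_tsum_of_nonneg (fun j => by positivity)
          (summable_geometric_two.mul_left _), tsum_mul_left, tsum_geometric_two]
        congr 1; ring


lemma aux_J (w : ℝ → ℝ≥0∞) (hwm : Measurable w) (d : ℝ → ℝ) (hdm : Measurable d)
    (hd : ∀ y, 0 ≤ d y) :
    ∫⁻ x, ∫⁻ y, w y * ENNReal.ofReal (d y * kmin (d y) (y - x)) ≤ 16 * ∫⁻ y, w y := by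
  have hm : Measurable (fun p : ℝ × ℝ => w p.2 * ENNReal.ofReal (d p.2 * kmin (d p.2) (p.2 - p.1))) := by
    unfold kmin
    fun_prop
  rw [lintegral_lintegral_swap hm.aemeasurable, ← lintegral_const_mul _ hwm]
  refine lintegral_mono fun y => ?_
  simp only
  have hm2 : Measurable (fun x => ENNReal.ofReal (d y * kmin (d y) (y - x))) := by
    unfold kmin
    fun_prop
  rw [lintegral_const_mul _ hm2, mul_comm]
  gcongr
  rcases (hd y).eq_or_lt with h0 | h0
  · simp [← h0]
  · have h1 := aux_tail (fun _ => 1) measurable_const y 2 0 (d y) (by norm_num) le_rfl h0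
      (fun r hr => by
        rw [setLIntegral_const, Real.volume_closedBall]; simp)
    have e : ∀ x, ENNReal.ofReal (d y * kmin (d y) (y - x)) =
        ENNReal.ofReal (d y) * (1 * ENNReal.ofReal (kmin (d y) (x - y))) := by
      intro x
      rw [ENNReal.ofReal_mul h0.le, one_mul]
      unfold kmin; rw [abs_sub_comm]
    simp_rw [e]
    rw [lintegral_const_mul]
    · calc _ ≤ ENNReal.ofReal (d y) * ENNReal.ofReal (8 * 2 * (d y + 0) / d y ^ 2) := by gcongr
        _ = 16 := by
          rw [← ENNReal.ofReal_mul h0.le]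
          have : d y * (8 * 2 * (d y + 0) / d y ^ 2) = 16 := by field_simp; ring
          rw [this]; simp
    · unfold kmin; fun_prop

/-- truncated `1/|t|` -/
def btr (ρ t : ℝ) : ℝ := if ρ < |t| then 1 / |t| else 0

lemma btr_meas (ρ : ℝ) : Measurable (btr ρ) := by
  unfold btr
  exact Measurable.ite (measurableSet_lt measurable_const (by fun_prop)) (by fun_prop) (by fun_prop)

lemma btr_nonneg (ρ t : ℝ) : 0 ≤ btr ρ t := by unfold btr; split_ifs <;> positivity

lemma btr_sq_le (ρ t : ℝ) : btr ρ t ^ 2 ≤ kmin ρ t := by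
  unfold btr kmin
  split_ifs with h
  · rw [max_eq_right h.le]; simp
  · simp

lemma aux_B (w : ℝ → ℝ≥0∞) (hwm : Measurable w) (d : ℝ → ℝ) (hdm : Measurable d)
    (Λ ρ : ℝ) (hΛ : 0 ≤ Λ) (hρ : 0 < ρ) (hd : ∀ y, 0 ≤ d y) (hd2 : ∀ y, d y ≤ |y|)
    (h1 : ∀ r : ℝ, 0 < r → ∫⁻ s in Metric.closedBall 0 r, w s ≤ ENNReal.ofReal (Λ * r))
    (h2 : ∀ y r : ℝ, 0 < r →
      ∫⁻ s in Metric.closedBall y r, w s ≤ ENNReal.ofReal (Λ * (r + d y)))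
    (h3 : ∫⁻ y, w y * ENNReal.ofReal (d y * kmin (d y) y) ≤ ENNReal.ofReal Λ) :
    ∫⁻ y, ∫⁻ z, (w y * ENNReal.ofReal (btr ρ y)) * (w z * ENNReal.ofReal (btr ρ z)) *
      ENNReal.ofReal (kmin ρ (y - z)) ≤ ENNReal.ofReal (72 * Λ ^ 2 / ρ ^ 2) := by
  have bm := btr_meas ρ
  have km := kmin_meas ρ
  have bn := btr_nonneg ρ
  have kn := kmin_nonneg ρ
  set A : ℝ → ℝ → ℝ≥0∞ := fun y z => w y * w z * ENNReal.ofReal (btr ρ y ^ 2 / 2) *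
    ENNReal.ofReal (kmin ρ (y - z)) with hA
  have hAm : Measurable (Function.uncurry A) := by
    simp only [hA, Function.uncurry_def]; fun_prop
  have hpt : ∀ y z, (w y * ENNReal.ofReal (btr ρ y)) * (w z * ENNReal.ofReal (btr ρ z)) *
      ENNReal.ofReal (kmin ρ (y - z)) ≤ A y z + A z y := by
    intro y z
    have e : kmin ρ (z - y) = kmin ρ (y - z) := by unfold kmin; rw [abs_sub_comm]
    simp only [hA, e]
    rw [mul_comm (w z) (w y), ← add_mul, ← mul_add, ← ENNReal.ofReal_add (by positivity) (by positivity)]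
    rw [mul_mul_mul_comm (w y), ← ENNReal.ofReal_mul (bn y)]
    gcongr
    nlinarith [sq_nonneg (btr ρ y - btr ρ z)]
  have hAint : ∫⁻ y, ∫⁻ z, A y z ≤ ENNReal.ofReal (36 * Λ ^ 2 / ρ ^ 2) := by
    have hin : ∀ y, ∫⁻ z, A y z ≤ w y * ENNReal.ofReal (kmin ρ (y - 0)) * ENNReal.ofReal (4 * Λ / ρ) +
        w y * ENNReal.ofReal (d y * kmin (d y) y) * ENNReal.ofReal (4 * Λ / ρ ^ 2) := by
      intro y
      have ht := aux_tail w hwm y Λ (d y) ρ hΛ (hd y) hρ (h2 y)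
      have e : ∀ z, A y z = w y * ENNReal.ofReal (btr ρ y ^ 2 / 2) *
          (w z * ENNReal.ofReal (kmin ρ (z - y))) := by
        intro z
        have e : kmin ρ (z - y) = kmin ρ (y - z) := by unfold kmin; rw [abs_sub_comm]
        simp only [hA, e]; ring
      simp_rw [e]
      rw [lintegral_const_mul _ (by fun_prop)]
      calc _ ≤ w y * ENNReal.ofReal (btr ρ y ^ 2 / 2) * ENNReal.ofReal (8 * Λ * (ρ + d y) / ρ ^ 2) := by
            gcongr
        _ = w y * ENNReal.ofReal (btr ρ y ^ 2 * (4 * Λ / ρ) + (d y * btr ρ y ^ 2) * (4 * Λ / ρ ^ 2)) := by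
            rw [mul_assoc, ← ENNReal.ofReal_mul (by positivity)]
            congr 2; field_simp; ring
        _ ≤ w y * ENNReal.ofReal (kmin ρ (y - 0) * (4 * Λ / ρ) + (d y * kmin (d y) y) * (4 * Λ / ρ ^ 2)) := by
            have := btr_sq_le ρ y
            have h3 : btr ρ y ^ 2 ≤ kmin (d y) y := by
              unfold btr kmin
              rw [max_eq_right (hd2 y)]
              split_ifs
              · simp
              · simp; positivity
            rw [sub_zero]
            have := hd y
            gcongr
        _ = _ := by
            have := kmin_nonneg (d y) y
            have := hd y
            have := kn (y - 0)
            rw [ENNReal.ofReal_add (by positivity) (by positivity), ENNReal.ofReal_mul (by positivity),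
              ENNReal.ofReal_mul (p := d y * _) (by positivity)]
            ring
    have hkm2 : Measurable fun y => kmin (d y) y := by unfold kmin; fun_prop
    calc _ ≤ _ := lintegral_mono hin
      _ = (∫⁻ y, w y * ENNReal.ofReal (kmin ρ (y - 0))) * ENNReal.ofReal (4 * Λ / ρ) +
        (∫⁻ y, w y * ENNReal.ofReal (d y * kmin (d y) y)) * ENNReal.ofReal (4 * Λ / ρ ^ 2) := by
          rw [lintegral_add_left (by fun_prop), lintegral_mul_const _ (by fun_prop),
            lintegral_mul_const _ (by fun_prop)]
      _ ≤ ENNReal.ofReal (8 * Λ * (ρ + 0) / ρ ^ 2) * ENNReal.ofReal (4 * Λ / ρ) +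
          ENNReal.ofReal Λ * ENNReal.ofReal (4 * Λ / ρ ^ 2) := by
          gcongr
          exact aux_tail w hwm 0 Λ 0 ρ hΛ le_rfl hρ (by simpa using h1)
      _ = _ := by
          rw [← ENNReal.ofReal_mul (by positivity), ← ENNReal.ofReal_mul (by positivity),
            ← ENNReal.ofReal_add (by positivity) (by positivity)]
          congr 1; field_simp; ring
  calc _ ≤ ∫⁻ y, ∫⁻ z, (A y z + A z y) := lintegral_mono fun y => lintegral_mono fun z => hpt y z
    _ = (∫⁻ y, ∫⁻ z, A y z) + ∫⁻ y, ∫⁻ z, A z y := by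
        have hAm1 : Measurable fun y => ∫⁻ z, A y z := hAm.lintegral_prod_right'
        rw [← lintegral_add_left hAm1]
        congr 1; ext y
        rw [lintegral_add_left]
        exact hAm.comp (measurable_prodMk_left)
    _ = (∫⁻ y, ∫⁻ z, A y z) + ∫⁻ y, ∫⁻ z, A y z := by
        congr 1
        exact lintegral_lintegral_swap (hAm.comp measurable_swap).aemeasurable
    _ ≤ ENNReal.ofReal (36 * Λ ^ 2 / ρ ^ 2) + ENNReal.ofReal (36 * Λ ^ 2 / ρ ^ 2) := by gcongr
    _ = _ := by
        rw [← ENNReal.ofReal_add (by positivity) (by positivity)]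
        congr 1; ring


/-- exponential sum -/
def Dsum (M : ℕ) (u : ℝ) : ℂ := ∑ j ∈ Finset.range M, Complex.exp (Complex.I * u) ^ j

lemma Dsum_bound (N : ℕ) (hN : 1 ≤ N) (u : ℝ) (hu : |u| ≤ 2) :
    ‖Dsum (2 * N) u‖ ^ 2 ≤ Real.pi ^ 2 * kmin (1 / N) u := by
  have hpi := Real.pi_gt_three
  have hN' : (0:ℝ) < N := by exact_mod_cast hN
  have hm : 0 < max (1 / (N:ℝ)) |u| := lt_max_of_lt_left (by positivity)
  have hz : ‖Complex.exp (Complex.I * u)‖ = 1 := by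
    rw [mul_comm]; exact Complex.norm_exp_ofReal_mul_I u
  have key : ‖Dsum (2 * N) u‖ * max (1 / (N:ℝ)) |u| ≤ Real.pi := by
    rcases max_choice (1 / (N:ℝ)) |u| with h | h <;> rw [h]
    · have : ‖Dsum (2 * N) u‖ ≤ 2 * N := by
        unfold Dsum
        refine (norm_sum_le _ _).trans ?_
        simp [norm_pow, hz]
      rw [mul_one_div, div_le_iff₀ hN']
      nlinarith
    · have h1 : ‖Dsum (2 * N) u‖ * ‖Complex.exp (Complex.I * u) - 1‖ ≤ 2 := by
        rw [← norm_mul]; unfold Dsum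
        rw [geom_sum_mul]
        refine (norm_sub_le _ _).trans ?_
        simp [norm_pow, hz]; norm_num
      rw [Complex.norm_exp_I_mul_ofReal_sub_one, norm_mul, Real.norm_eq_abs, Real.norm_eq_abs] at h1
      have h2 := Real.mul_abs_le_abs_sin (x := u / 2) (by rw [abs_div, abs_of_pos (by norm_num : (0:ℝ) < 2)]; linarith)
      have h3 : |u| / Real.pi ≤ |Real.sin (u / 2)| := by
        refine le_trans (le_of_eq ?_) h2
        rw [abs_div, abs_of_pos (by norm_num : (0:ℝ) < 2)]; field_simp
      have h4 : ‖Dsum (2 * N) u‖ * (|u| / Real.pi) ≤ 1 := by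
        have := mul_le_mul_of_nonneg_left h3 (norm_nonneg (Dsum (2 * N) u))
        rw [abs_of_pos (by norm_num : (0:ℝ) < 2)] at h1
        linarith
      rw [← mul_div_assoc, div_le_one (by linarith)] at h4
      exact h4
  unfold kmin
  rw [mul_one_div, le_div_iff₀ (by positivity), ← mul_pow]
  gcongr

lemma cos_sum_bound (a : ℝ) (M : ℕ) (u : ℝ) :
    |∑ j ∈ Finset.range M, ∑ l ∈ Finset.range M, Real.cos ((a + j - l) * u)| ≤ ‖Dsum M u‖ ^ 2 := by
  have : ∑ j ∈ Finset.range M, ∑ l ∈ Finset.range M, Real.cos ((a + j - l) * u) =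
      (Complex.exp (Complex.I * (a * u)) * (Dsum M u * (starRingEnd ℂ) (Dsum M u))).re := by
    unfold Dsum
    rw [map_sum, Finset.sum_mul_sum, Finset.mul_sum, Complex.re_sum]
    refine Finset.sum_congr rfl fun j _ => ?_
    rw [Finset.mul_sum, Complex.re_sum]
    refine Finset.sum_congr rfl fun l _ => ?_
    rw [map_pow, ← Complex.exp_conj, map_mul, Complex.conj_I, Complex.conj_ofReal,
      ← Complex.exp_nat_mul, ← Complex.exp_nat_mul, ← Complex.exp_add, ← Complex.exp_add,
      ← Complex.exp_ofReal_mul_I_re]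
    congr 2; push_cast; ring
  rw [this]
  refine (Complex.abs_re_le_norm _).trans ?_
  rw [norm_mul, norm_mul, RCLike.norm_conj]
  have : ‖Complex.exp (Complex.I * (a * u))‖ = 1 := by
    rw [mul_comm, ← Complex.ofReal_mul]; exact Complex.norm_exp_ofReal_mul_I _
  rw [this]; apply le_of_eq; ring

lemma Dsum_cont (M : ℕ) : Continuous (Dsum M) := by unfold Dsum; fun_prop

lemma cos_energy (g : ℝ → ℝ) (hg : Integrable g) (a N : ℕ) :
    (N : ℝ) * ∑ m ∈ Finset.range N, (∫ t, g t * Real.cos ((a + m : ℝ) * t)) ^ 2 ≤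
      ∫ p : ℝ × ℝ, |g p.1| * |g p.2| * ‖Dsum (2 * N) (p.1 - p.2)‖ ^ 2 := by
  set Q : ℝ → ℝ := fun k => (∫ t, g t * Real.cos (k * t)) ^ 2 + (∫ t, g t * Real.sin (k * t)) ^ 2
    with hQ
  have hQn : ∀ k, 0 ≤ Q k := fun k => by positivity
  have hgc : ∀ k : ℝ, Integrable fun t => g t * Real.cos (k * t) := fun k =>
    hg.mul_bdd (c := 1) (by fun_prop) (Eventually.of_forall fun t => by
      simpa using Real.abs_cos_le_one _)
  have hgs : ∀ k : ℝ, Integrable fun t => g t * Real.sin (k * t) := fun k =>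
    hg.mul_bdd (c := 1) (by fun_prop) (Eventually.of_forall fun t => by
      simpa using Real.abs_sin_le_one _)
  have hG : Integrable (fun p : ℝ × ℝ => g p.1 * g p.2) := hg.mul_prod hg
  have hInt0 : ∀ k : ℝ, Integrable fun p : ℝ × ℝ => g p.1 * g p.2 * Real.cos (k * (p.1 - p.2)) :=
    fun k => hG.mul_bdd (c := 1) (by fun_prop) (Eventually.of_forall fun t => by
      simpa using Real.abs_cos_le_one _)
  have hQe : ∀ k, Q k = ∫ p : ℝ × ℝ, g p.1 * g p.2 * Real.cos (k * (p.1 - p.2)) := by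
    intro k
    simp only [hQ, sq]
    rw [← integral_prod_mul, ← integral_prod_mul, ← integral_add ((hgc k).mul_prod (hgc k))
      ((hgs k).mul_prod (hgs k))]
    congr 1; ext p
    rw [mul_sub, Real.cos_sub]; ring
  have h1 : (N : ℝ) * ∑ m ∈ Finset.range N, Q (a + m) ≤
      ∑ j ∈ Finset.range (2 * N), ∑ l ∈ Finset.range (2 * N), Q (a + j - l) := by
    rw [Finset.sum_comm]
    calc (N : ℝ) * ∑ m ∈ Finset.range N, Q (a + m)
        = ∑ l ∈ Finset.range N, ∑ m ∈ Finset.range N, Q (a + m) := by simp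
      _ ≤ ∑ l ∈ Finset.range N, ∑ j ∈ Finset.range (2 * N), Q (a + j - l) := by
          refine Finset.sum_le_sum fun l hl => ?_
          have hl := Finset.mem_range.1 hl
          calc ∑ m ∈ Finset.range N, Q (a + m) = ∑ j ∈ Finset.Ico l (l + N), Q (a + j - l) := by
                rw [Finset.sum_Ico_eq_sum_range, Nat.add_sub_cancel_left]
                refine Finset.sum_congr rfl fun m _ => ?_
                congr 1; push_cast; ring
            _ ≤ _ := Finset.sum_le_sum_of_subset_of_nonneg (fun j hj => by
                  rw [Finset.mem_Ico] at hj; rw [Finset.mem_range]; omega) (fun _ _ _ => hQn _)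
      _ ≤ _ := Finset.sum_le_sum_of_subset_of_nonneg (fun j hj => by
                  rw [Finset.mem_range] at *; omega)
                  (fun _ _ _ => Finset.sum_nonneg fun _ _ => hQn _)
  have h2 : ∑ j ∈ Finset.range (2 * N), ∑ l ∈ Finset.range (2 * N), Q (a + j - l) =
      ∫ p : ℝ × ℝ, g p.1 * g p.2 * ∑ j ∈ Finset.range (2 * N), ∑ l ∈ Finset.range (2 * N),
        Real.cos ((a + j - l) * (p.1 - p.2)) := by
    simp_rw [hQe, Finset.mul_sum]
    rw [integral_finsetSum _ fun j _ => integrable_finsetSum _ fun l _ => hInt0 _]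
    refine Finset.sum_congr rfl fun j _ => ?_
    rw [integral_finsetSum _ fun l _ => hInt0 _]
  calc _ ≤ (N : ℝ) * ∑ m ∈ Finset.range N, Q (a + m) := by
        gcongr with m _
        simp only [hQ]
        have := sq_nonneg (∫ t, g t * Real.sin ((a + m : ℝ) * t))
        linarith
    _ ≤ _ := h1
    _ = _ := h2
    _ ≤ _ := by
        have hDb : ∀ u, ‖Dsum (2 * N) u‖ ≤ 2 * N := by
          intro u
          unfold Dsum
          refine (norm_sum_le _ _).trans ?_
          have hz : ‖Complex.exp (Complex.I * u)‖ = 1 := by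
            rw [mul_comm]; exact Complex.norm_exp_ofReal_mul_I u
          simp [norm_pow, hz]
        have hc := Dsum_cont (2 * N)
        apply integral_mono
        · simp_rw [Finset.mul_sum]
          exact integrable_finsetSum _ fun j _ => integrable_finsetSum _ fun l _ => hInt0 _
        · refine (hg.abs.mul_prod hg.abs).mul_bdd (c := (2 * N) ^ 2)
            (Continuous.aestronglyMeasurable (by fun_prop)) (Eventually.of_forall fun p => ?_)
          rw [norm_pow, norm_norm]
          gcongr; exact hDb _
        · intro p
          simp only
          refine (le_abs_self _).trans ?_
          rw [abs_mul, abs_mul]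
          gcongr
          exact cos_sum_bound a _ _


/-- cotangent kernel -/
def kap (t : ℝ) : ℝ := 1 / (2 * Real.tan (t / 2))

lemma kap_meas : Measurable kap := by
  unfold kap
  simp_rw [Real.tan_eq_sin_div_cos]
  fun_prop

lemma kap_odd (t : ℝ) : kap (-t) = - kap t := by
  unfold kap
  rw [neg_div, Real.tan_neg, mul_neg, one_div, one_div, inv_neg]

lemma kap_bound_pos (t : ℝ) (h0 : 0 < t) (h1 : t < Real.pi) :
    0 ≤ kap t ∧ kap t ≤ 1 / t ∧ 1 / t - kap t ≤ 1 / 2 := by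
  set s := t / 2 with hs
  have hs0 : 0 < s := by rw [hs]; linarith
  have hs1 : s < Real.pi / 2 := by rw [hs]; linarith
  have ht : t = 2 * s := by rw [hs]; ring
  have htan := Real.lt_tan hs0 hs1
  have hsin : 0 < Real.sin s := Real.sin_pos_of_pos_of_lt_pi hs0 (by linarith)
  have hcos : 0 < Real.cos s := Real.cos_pos_of_mem_Ioo ⟨by linarith, hs1⟩
  have hk : kap t = 1 / (2 * Real.tan s) := rfl
  refine ⟨?_, ?_, ?_⟩
  · rw [hk]; have : 0 < Real.tan s := by linarith
    positivity
  · rw [hk, ht]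
    apply one_div_le_one_div_of_le (by linarith) (by linarith)
  · rw [hk, ht, Real.tan_eq_sin_div_cos]
    have h2 : Real.sin s < s := Real.sin_lt hs0
    have h3 := Real.cos_le_one s
    have h4 := Real.sin_sq_add_cos_sq s
    have h5 := Real.sin_le_one s
    have e : 1 / (2 * s) - 1 / (2 * (Real.sin s / Real.cos s)) =
        (Real.sin s - s * Real.cos s) / (2 * s * Real.sin s) := by
      field_simp
    rw [e, div_le_iff₀ (by positivity)]
    have h6 : 1 - Real.cos s ≤ Real.sin s := by nlinarith
    nlinarith

lemma kap_abs (t : ℝ) (h0 : 0 < |t|) (h1 : |t| < Real.pi) : |kap t| ≤ 1 / |t| := by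
  rcases abs_cases t with ⟨h, h'⟩ | ⟨h, h'⟩
  · have := kap_bound_pos t (by linarith) (by linarith)
    rw [abs_of_nonneg this.1, h]; exact this.2.1
  · have := kap_bound_pos (-t) (by linarith) (by linarith)
    rw [kap_odd] at this
    rw [abs_of_nonpos (by linarith), h]; exact this.2.1

lemma kap_sub (t : ℝ) (h0 : 0 < |t|) (h1 : |t| < Real.pi) : |kap t - 1 / t| ≤ 1 / 2 := by
  rcases abs_cases t with ⟨h, h'⟩ | ⟨h, h'⟩
  · have := kap_bound_pos t (by linarith) (by linarith)
    rw [abs_le]; constructor <;> linarith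
  · have := kap_bound_pos (-t) (by linarith) (by linarith)
    rw [kap_odd, one_div, inv_neg, ← one_div] at this
    rw [abs_le]; constructor <;> linarith

lemma abs_integral_le_of {S : Set ℝ} {h : ℝ → ℝ} {b : ℝ} (hb : 0 ≤ b)
    (H : ∫⁻ t in S, ‖h t‖ₑ ≤ ENNReal.ofReal b) : |∫ t in S, h t| ≤ b := by
  have h1 := (enorm_integral_le_lintegral_enorm (μ := volume.restrict S) h).trans H
  rw [Real.enorm_eq_ofReal_abs] at h1
  exact (ENNReal.ofReal_le_ofReal_iff hb).1 h1

/-- the collection of pointwise hypotheses at a good point -/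
structure Good (ψ d : ℝ → ℝ) (Λ : ℝ) : Prop where
  ψm : Measurable ψ
  ψi : Integrable ψ
  dm : Measurable d
  Λ0 : 0 < Λ
  hd : ∀ y, 0 ≤ d y
  hd2 : ∀ y, d y ≤ |y|
  h1 : ∀ r : ℝ, 0 < r → ∫⁻ s in Metric.closedBall 0 r, ‖ψ s‖ₑ ≤ ENNReal.ofReal (Λ * r)
  h2 : ∀ y r : ℝ, 0 < r → ∫⁻ s in Metric.closedBall y r, ‖ψ s‖ₑ ≤ ENNReal.ofReal (Λ * (r + d y))
  h3 : ∫⁻ y, ‖ψ y‖ₑ * ENNReal.ofReal (d y * kmin (d y) y) ≤ ENNReal.ofReal Λ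
  h5 : ∀ η : ℝ, 0 < η → |∫ t, ψ t * (t / (t ^ 2 + η ^ 2))| ≤ 2 * Λ
  tot : ∫⁻ s, ‖ψ s‖ₑ ≤ ENNReal.ofReal (4 * Real.pi * Λ)

/-- truncated piece of the function times the kernel -/
def gtr (ψ : ℝ → ℝ) (ρ t : ℝ) : ℝ := if ρ < |t| ∧ |t| < 1 then kap t * ψ t else 0

lemma gtr_meas {ψ : ℝ → ℝ} (h : Measurable ψ) (ρ : ℝ) : Measurable (gtr ψ ρ) := by
  unfold gtr
  have := kap_meas
  refine Measurable.ite ?_ (by fun_prop) (by fun_prop)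
  exact (measurableSet_lt measurable_const continuous_abs.measurable).inter
    (measurableSet_lt continuous_abs.measurable measurable_const)

lemma gtr_abs {ψ : ℝ → ℝ} {ρ : ℝ} (hρ : 0 < ρ) (t : ℝ) : |gtr ψ ρ t| ≤ |ψ t| * btr ρ t := by
  unfold gtr btr
  have := Real.pi_gt_three
  split_ifs with h h' h'
  · rw [abs_mul, mul_comm]
    gcongr
    exact kap_abs t (by linarith [h.1]) (by linarith [h.2])
  · exact absurd h.1 h'
  · simp; positivity
  · simp

lemma btr_le {ρ : ℝ} (hρ : 0 < ρ) (t : ℝ) : btr ρ t ≤ 1 / ρ := by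
  unfold btr
  split_ifs with h
  · gcongr
  · positivity

lemma gtr_int {ψ d : ℝ → ℝ} {Λ : ℝ} (H : Good ψ d Λ) {ρ : ℝ} (hρ : 0 < ρ) :
    Integrable (gtr ψ ρ) := by
  refine (H.ψi.abs.mul_const (1 / ρ)).mono' (gtr_meas H.ψm ρ).aestronglyMeasurable
    (Eventually.of_forall fun t => ?_)
  refine (gtr_abs hρ t).trans ?_
  gcongr
  exact btr_le hρ t

lemma far_bound {ψ d : ℝ → ℝ} {Λ : ℝ} (H : Good ψ d Λ) (a N : ℕ) (hN : 1 ≤ N) :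
    ∑ m ∈ Finset.range N, |∫ t, gtr ψ (1 / N) t * Real.cos ((a + m : ℝ) * t)| ≤
      N * (9 * Real.pi * Λ) := by
  have hN' : (0:ℝ) < N := by exact_mod_cast hN
  have hρ : (0:ℝ) < 1 / N := by positivity
  have hΛ := H.Λ0
  have hpi := Real.pi_pos
  have hg := gtr_int H hρ
  have gm := gtr_meas H.ψm (1 / (N:ℝ))
  have hE := cos_energy _ hg a N
  have hB := aux_B (fun s => ‖ψ s‖ₑ) H.ψm.enorm d H.dm Λ (1 / N) hΛ.le hρ H.hd H.hd2 H.h1 H.h2 H.h3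
  have hup : ∫ p : ℝ × ℝ, |gtr ψ (1 / N) p.1| * |gtr ψ (1 / N) p.2| *
      ‖Dsum (2 * N) (p.1 - p.2)‖ ^ 2 ≤ Real.pi ^ 2 * (72 * Λ ^ 2 * N ^ 2) := by
    have hDm : Measurable (Dsum (2 * N)) := (Dsum_cont _).measurable
    rw [integral_eq_lintegral_of_nonneg_ae (Eventually.of_forall fun p => by positivity)
      (Measurable.aestronglyMeasurable (by fun_prop))]
    apply ENNReal.toReal_le_of_le_ofReal (by positivity)
    rw [Measure.volume_eq_prod, lintegral_prod _ (by fun_prop)]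
    calc _ ≤ ∫⁻ y, ∫⁻ z, ENNReal.ofReal (Real.pi ^ 2) * ((‖ψ y‖ₑ * ENNReal.ofReal (btr (1 / N) y)) *
          (‖ψ z‖ₑ * ENNReal.ofReal (btr (1 / N) z)) *
            ENNReal.ofReal (kmin (1 / N) (y - z))) := by
          refine lintegral_mono fun y => lintegral_mono fun z => ?_
          simp only
          have b1 := btr_nonneg (1 / (N:ℝ)) y
          have b2 := btr_nonneg (1 / (N:ℝ)) z
          have b3 := kmin_nonneg (1 / (N:ℝ)) (y - z)
          rw [Real.enorm_eq_ofReal_abs, Real.enorm_eq_ofReal_abs, ← ENNReal.ofReal_mul (by positivity),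
            ← ENNReal.ofReal_mul (by positivity), ← ENNReal.ofReal_mul (by positivity),
            ← ENNReal.ofReal_mul (by positivity), ← ENNReal.ofReal_mul (by positivity)]
          apply ENNReal.ofReal_le_ofReal
          have k1 := gtr_abs (ψ := ψ) hρ y
          have k2 := gtr_abs (ψ := ψ) hρ z
          by_cases hyz : |y| < 1 ∧ |z| < 1
          · have k3 := Dsum_bound N hN (y - z) (by
              have := abs_sub y z; linarith [hyz.1, hyz.2])
            calc _ ≤ (|ψ y| * btr (1 / N) y) * (|ψ z| * btr (1 / N) z) *
                  (Real.pi ^ 2 * kmin (1 / N) (y - z)) := by gcongr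
              _ = _ := by ring
          · have : |gtr ψ (1 / N) y| * |gtr ψ (1 / N) z| = 0 := by
              unfold gtr
              rcases not_and_or.1 hyz with h | h
              · rw [if_neg (fun h' => h h'.2)]; simp
              · rw [if_neg (c := 1 / (N:ℝ) < |z| ∧ |z| < 1) (fun h' => h h'.2)]; simp
            rw [this, zero_mul]
            positivity
      _ = ENNReal.ofReal (Real.pi ^ 2) * ∫⁻ y, ∫⁻ z, (‖ψ y‖ₑ * ENNReal.ofReal (btr (1 / N) y)) *
          (‖ψ z‖ₑ * ENNReal.ofReal (btr (1 / N) z)) *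
            ENNReal.ofReal (kmin (1 / N) (y - z)) := by
          rw [← lintegral_const_mul' _ _ ENNReal.ofReal_ne_top]
          congr 1; ext y
          rw [← lintegral_const_mul' _ _ ENNReal.ofReal_ne_top]
      _ ≤ ENNReal.ofReal (Real.pi ^ 2) * ENNReal.ofReal (72 * Λ ^ 2 / (1 / N) ^ 2) := by
          gcongr
      _ = _ := by
          rw [← ENNReal.ofReal_mul (by positivity)]
          congr 1; field_simp
  set c : ℕ → ℝ := fun m => ∫ t, gtr ψ (1 / N) t * Real.cos ((a + m : ℝ) * t) with hc
  have hCS : (∑ m ∈ Finset.range N, |c m|) ^ 2 ≤ N * ∑ m ∈ Finset.range N, c m ^ 2 := by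
    have := sq_sum_le_card_mul_sum_sq (s := Finset.range N) (f := fun m => |c m|)
    simpa using this
  have : (∑ m ∈ Finset.range N, |c m|) ^ 2 ≤ (N * (9 * Real.pi * Λ)) ^ 2 := by
    refine hCS.trans (hE.trans (hup.trans ?_))
    have : (N * (9 * Real.pi * Λ)) ^ 2 = 81 * (Real.pi ^ 2 * Λ ^ 2 * N ^ 2) := by ring
    rw [this]
    have : 0 ≤ Real.pi ^ 2 * Λ ^ 2 * N ^ 2 := by positivity
    linarith
  exact (sq_le_sq₀ (Finset.sum_nonneg fun _ _ => abs_nonneg _) (by positivity)).1 this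


/-- annulus -/
def ann (ε : ℝ) : Set ℝ := {t : ℝ | ε < |t| ∧ |t| < Real.pi}

lemma ann_meas (ε : ℝ) : MeasurableSet (ann ε) :=
  (measurableSet_lt measurable_const continuous_abs.measurable).inter
    (measurableSet_lt continuous_abs.measurable measurable_const)

/-- integrand -/
def Gk (ψ : ℝ → ℝ) (k t : ℝ) : ℝ := (1 / Real.pi) * (Real.cos (k * t) / (2 * Real.tan (t / 2))) * ψ t

lemma Gk_eq (ψ : ℝ → ℝ) (k t : ℝ) : Gk ψ k t = (1 / Real.pi) * (Real.cos (k * t) * kap t * ψ t) := by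
  unfold Gk kap; ring

lemma Gk_meas {ψ : ℝ → ℝ} (h : Measurable ψ) (k : ℝ) : Measurable (Gk ψ k) := by
  have := kap_meas
  have e : Gk ψ k = fun t => (1 / Real.pi) * (Real.cos (k * t) * kap t * ψ t) := by
    ext t; exact Gk_eq ψ k t
  rw [e]; fun_prop

lemma Gk_abs (ψ : ℝ → ℝ) (k t : ℝ) : |Gk ψ k t| ≤ (1 / Real.pi) * (|kap t| * |ψ t|) := by
  rw [Gk_eq, abs_mul, abs_mul, abs_mul, abs_of_pos (by have := Real.pi_pos; positivity : 0 < 1 / Real.pi)]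
  have := Real.pi_pos
  gcongr
  have := Real.abs_cos_le_one (k * t)
  have h2 := abs_nonneg (kap t)
  nlinarith

lemma Gk_int {ψ d : ℝ → ℝ} {Λ : ℝ} (H : Good ψ d Λ) (k : ℝ) {ε : ℝ} (hε : 0 < ε) :
    IntegrableOn (Gk ψ k) (ann ε) := by
  have := Real.pi_pos
  refine Integrable.mono' (((H.ψi.abs.const_mul (1 / ε)).const_mul (1 / Real.pi)).integrableOn)
    (Gk_meas H.ψm k).aestronglyMeasurable ?_
  refine (ae_restrict_iff' (ann_meas ε)).2 (Eventually.of_forall fun t ht => ?_)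
  refine (Gk_abs ψ k t).trans ?_
  have h1 := kap_abs t (hε.trans ht.1) ht.2
  have h2 : 1 / |t| ≤ 1 / ε := one_div_le_one_div_of_le hε ht.1.le
  gcongr
  exact h1.trans h2

lemma near_bound {ψ d : ℝ → ℝ} {Λ : ℝ} (H : Good ψ d Λ) (a N m : ℕ) (hm : m < N)
    (u v : ℝ) (hu : pvT1 (Gk ψ (a + m : ℝ)) u) (hv : pvT1 (Gk ψ (a : ℝ)) v) :
    |(u - ∫ t in ann (1 / N), Gk ψ (a + m : ℝ) t) - (v - ∫ t in ann (1 / N), Gk ψ (a : ℝ) t)| ≤ Λ := by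
  have hN' : (0:ℝ) < N := by exact_mod_cast (by omega : 0 < N)
  have hρ : (0:ℝ) < 1 / N := by positivity
  have hpi := Real.pi_gt_three
  have hlim := ((hu.sub_const (∫ t in ann (1 / N), Gk ψ (a + m : ℝ) t)).sub
    (hv.sub_const (∫ t in ann (1 / N), Gk ψ (a : ℝ) t))).abs
  refine le_of_tendsto hlim ?_
  have hev : ∀ᶠ ε : ℝ in nhdsWithin 0 (Ioi 0), ε ∈ Ioo (0:ℝ) (1 / N) := Ioo_mem_nhdsGT hρ
  filter_upwards [hev] with ε hε
  have hsub : ann (1 / N) ⊆ ann ε := fun t ht => ⟨hε.2.trans ht.1, ht.2⟩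
  change |((∫ t in ann ε, Gk ψ (a + m : ℝ) t) - _) - ((∫ t in ann ε, Gk ψ (a : ℝ) t) - _)| ≤ Λ
  rw [← setIntegral_sdiff (ann_meas _) (Gk_int H _ hε.1) hsub,
    ← setIntegral_sdiff (ann_meas _) (Gk_int H _ hε.1) hsub,
    ← integral_sub ((Gk_int H _ hε.1).mono_set sdiff_subset) ((Gk_int H _ hε.1).mono_set sdiff_subset)]
  apply abs_integral_le_of H.Λ0.le
  have hpt : ∀ t ∈ ann ε \ ann (1 / N), ‖Gk ψ (a + m : ℝ) t - Gk ψ (a : ℝ) t‖ₑ ≤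
      ENNReal.ofReal N * ‖ψ t‖ₑ := by
    intro t ht
    rw [Real.enorm_eq_ofReal_abs, Real.enorm_eq_ofReal_abs, ← ENNReal.ofReal_mul (by positivity)]
    apply ENNReal.ofReal_le_ofReal
    have e : Gk ψ (a + m : ℝ) t - Gk ψ (a : ℝ) t =
        (1 / Real.pi) * ((Real.cos ((a + m : ℝ) * t) - Real.cos ((a : ℝ) * t)) * kap t * ψ t) := by
      rw [Gk_eq, Gk_eq]; ring
    have t0 : 0 < |t| := hε.1.trans ht.1.1
    have h1 := kap_abs t t0 ht.1.2
    have h2 : |Real.cos ((a + m : ℝ) * t) - Real.cos ((a : ℝ) * t)| ≤ N * |t| := by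
      refine (Real.abs_cos_sub_cos_le _ _).trans ?_
      rw [← sub_mul, abs_mul, add_sub_cancel_left, abs_of_nonneg (by positivity : (0:ℝ) ≤ m)]
      gcongr
    rw [e, abs_mul, abs_mul, abs_mul, abs_of_pos (by positivity : 0 < 1 / Real.pi)]
    calc 1 / Real.pi * (|Real.cos ((a + m : ℝ) * t) - Real.cos ((a : ℝ) * t)| * |kap t| * |ψ t|)
        ≤ 1 * ((N * |t|) * (1 / |t|) * |ψ t|) := by
          gcongr
          rw [div_le_one (by positivity)]; linarith
      _ = N * |ψ t| := by field_simp
  calc _ ≤ ∫⁻ t in ann ε \ ann (1 / N), ENNReal.ofReal N * ‖ψ t‖ₑ :=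
        setLIntegral_mono (by have := H.ψm; fun_prop) hpt
    _ ≤ ∫⁻ t in Metric.closedBall 0 (1 / N), ENNReal.ofReal N * ‖ψ t‖ₑ := by
        apply lintegral_mono_set
        intro t ht
        rw [Metric.mem_closedBall, Real.dist_eq, sub_zero]
        by_contra hc
        exact ht.2 ⟨not_le.1 hc, ht.1.2⟩
    _ = ENNReal.ofReal N * ∫⁻ t in Metric.closedBall 0 (1 / N), ‖ψ t‖ₑ :=
        lintegral_const_mul _ H.ψm.enorm
    _ ≤ ENNReal.ofReal N * ENNReal.ofReal (Λ * (1 / N)) := by gcongr; exact H.h1 _ hρ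
    _ = _ := by rw [← ENNReal.ofReal_mul (by positivity)]; congr 1; field_simp

lemma far2_bound {ψ d : ℝ → ℝ} {Λ : ℝ} (H : Good ψ d Λ) (k : ℝ) {ρ : ℝ} (hρ : 0 < ρ) :
    |(∫ t in ann ρ, Gk ψ k t) - (1 / Real.pi) * ∫ t, gtr ψ ρ t * Real.cos (k * t)| ≤ 4 * Λ := by
  have hpi := Real.pi_gt_three
  have hΛ := H.Λ0
  have hgi : Integrable fun t => (1 / Real.pi) * (gtr ψ ρ t * Real.cos (k * t)) :=
    ((gtr_int H hρ).mul_bdd (c := 1) (by fun_prop) (Eventually.of_forall fun t => by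
      simpa using Real.abs_cos_le_one _)).const_mul _
  have e : (1 / Real.pi) * ∫ t, gtr ψ ρ t * Real.cos (k * t) =
      ∫ t in ann ρ, (1 / Real.pi) * (gtr ψ ρ t * Real.cos (k * t)) := by
    rw [← integral_const_mul]
    symm
    apply setIntegral_eq_integral_of_forall_compl_eq_zero
    intro t ht
    have : gtr ψ ρ t = 0 := by
      unfold gtr
      rw [if_neg]
      exact fun h => ht ⟨h.1, by linarith [h.2]⟩
    simp [this]
  rw [e, ← integral_sub (Gk_int H k hρ) hgi.integrableOn]
  apply abs_integral_le_of (by positivity)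
  calc _ ≤ ∫⁻ t in ann ρ, ENNReal.ofReal (1 / Real.pi) * ‖ψ t‖ₑ := by
        refine setLIntegral_mono (by have := H.ψm; fun_prop) fun t ht => ?_
        rw [Real.enorm_eq_ofReal_abs, Real.enorm_eq_ofReal_abs, ← ENNReal.ofReal_mul (by positivity)]
        apply ENNReal.ofReal_le_ofReal
        unfold gtr
        split_ifs with h
        · rw [Gk_eq]
          have : 1 / Real.pi * (Real.cos (k * t) * kap t * ψ t) -
            1 / Real.pi * (kap t * ψ t * Real.cos (k * t)) = 0 := by ring
          rw [this, abs_zero]; positivity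
        · have h1 : 1 ≤ |t| := by
            by_contra hc
            exact h ⟨ht.1, not_le.1 hc⟩
          rw [zero_mul, mul_zero, sub_zero]
          refine (Gk_abs ψ k t).trans ?_
          have h2 := kap_abs t (by linarith) ht.2
          have h3 : 1 / |t| ≤ 1 := by rw [div_le_one (by linarith)]; exact h1
          have h4 := abs_nonneg (ψ t)
          have : |kap t| * |ψ t| ≤ |ψ t| := by nlinarith
          gcongr
    _ ≤ ∫⁻ t, ENNReal.ofReal (1 / Real.pi) * ‖ψ t‖ₑ := setLIntegral_le_lintegral _ _
    _ = ENNReal.ofReal (1 / Real.pi) * ∫⁻ t, ‖ψ t‖ₑ := lintegral_const_mul _ H.ψm.enorm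
    _ ≤ ENNReal.ofReal (1 / Real.pi) * ENNReal.ofReal (4 * Real.pi * Λ) := by gcongr; exact H.tot
    _ = _ := by rw [← ENNReal.ofReal_mul (by positivity)]; congr 1; field_simp

lemma hil_bound {ψ d : ℝ → ℝ} {Λ : ℝ} (H : Good ψ d Λ) {ε : ℝ} (hε : 0 < ε) :
    |∫ t in ann ε, Gk ψ 0 t| ≤ 15 / 2 * Λ := by
  have hpi := Real.pi_gt_three
  have hΛ := H.Λ0
  have km := kmin_meas ε
  have hGi : Integrable ((ann ε).indicator (Gk ψ 0)) :=
    (integrable_indicator_iff (ann_meas ε)).2 (Gk_int H 0 hε)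
  have hden : ∀ t : ℝ, |t / (t ^ 2 + ε ^ 2)| ≤ 1 / ε := by
    intro t
    rw [abs_div, abs_of_pos (by positivity : 0 < t ^ 2 + ε ^ 2), div_le_div_iff₀ (by positivity) hε,
      ← sq_abs t]
    nlinarith [sq_nonneg (|t| - ε), sq_nonneg (|t|)]
  have hHi : Integrable fun t => ψ t * (t / (t ^ 2 + ε ^ 2)) :=
    H.ψi.mul_bdd (c := 1 / ε) (Measurable.aestronglyMeasurable (by fun_prop)) (Eventually.of_forall fun t => hden t)
  have h5 := H.h5 ε hε
  have hdiff : |∫ t in univ, ((ann ε).indicator (Gk ψ 0) t -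
      (1 / Real.pi) * (ψ t * (t / (t ^ 2 + ε ^ 2))))| ≤ 1 / Real.pi * ((4 * Real.pi + 8) * Λ) := by
    apply abs_integral_le_of (by positivity)
    rw [Measure.restrict_univ]
    calc _ ≤ ∫⁻ t, ENNReal.ofReal (1 / Real.pi) * (‖ψ t‖ₑ + ENNReal.ofReal ε *
          (‖ψ t‖ₑ * ENNReal.ofReal (kmin ε (t - 0)))) := by
          refine lintegral_mono fun t => ?_
          have hk := kmin_nonneg ε t
          rw [sub_zero, Real.enorm_eq_ofReal_abs, Real.enorm_eq_ofReal_abs,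
            ← ENNReal.ofReal_mul (by positivity), ← ENNReal.ofReal_mul (by positivity),
            ← ENNReal.ofReal_add (by positivity) (by positivity), ← ENNReal.ofReal_mul (by positivity)]
          apply ENNReal.ofReal_le_ofReal
          have e : (ann ε).indicator (Gk ψ 0) t - (1 / Real.pi) * (ψ t * (t / (t ^ 2 + ε ^ 2))) =
              (1 / Real.pi) * (ψ t * ((ann ε).indicator kap t - t / (t ^ 2 + ε ^ 2))) := by
            by_cases ht : t ∈ ann ε
            · rw [indicator_of_mem ht, indicator_of_mem ht, Gk_eq]; simp; ring
            · rw [indicator_of_notMem ht, indicator_of_notMem ht]; ring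
          have hK : |(ann ε).indicator kap t - t / (t ^ 2 + ε ^ 2)| ≤ 1 + ε * kmin ε t := by
            by_cases ht : t ∈ ann ε
            · rw [indicator_of_mem ht]
              have t0 : 0 < |t| := hε.trans ht.1
              have tn : t ≠ 0 := abs_pos.1 t0
              have h1 := kap_sub t t0 ht.2
              have h2 : |1 / t - t / (t ^ 2 + ε ^ 2)| ≤ ε * kmin ε t := by
                have e2 : 1 / t - t / (t ^ 2 + ε ^ 2) = ε ^ 2 / (t * (t ^ 2 + ε ^ 2)) := by
                  field_simp; ring
                unfold kmin
                rw [e2, max_eq_right ht.1.le, abs_div, abs_mul, abs_of_pos (by positivity : 0 < ε ^ 2),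
                  abs_of_pos (by positivity : 0 < t ^ 2 + ε ^ 2), mul_one_div,
                  div_le_div_iff₀ (by positivity) (by positivity), ← sq_abs t]
                have := ht.1
                have h6 : ε ^ 2 * |t| ^ 2 ≤ ε * (|t| * |t| ^ 2) := by
                  have : 0 ≤ ε * |t| ^ 2 := by positivity
                  nlinarith
                have h7 : 0 ≤ ε * (|t| * ε ^ 2) := by positivity
                nlinarith
              calc |kap t - t / (t ^ 2 + ε ^ 2)| = |(kap t - 1 / t) + (1 / t - t / (t ^ 2 + ε ^ 2))| := by
                    congr 1; ring
                _ ≤ _ := abs_add_le _ _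
                _ ≤ _ := by linarith
            · rw [indicator_of_notMem ht, zero_sub, abs_neg]
              rcases le_or_gt |t| ε with h | h
              · have : ε * kmin ε t = 1 / ε := by
                  unfold kmin; rw [max_eq_left h]; field_simp
                rw [this]; linarith [hden t]
              · have h3 : Real.pi ≤ |t| := by
                  by_contra hc; exact ht ⟨h, not_le.1 hc⟩
                have : |t / (t ^ 2 + ε ^ 2)| ≤ 1 := by
                  rw [abs_div, abs_of_pos (by positivity : 0 < t ^ 2 + ε ^ 2),
                    div_le_one (by positivity), ← sq_abs t]
                  nlinarith [sq_nonneg ε]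
                have : 0 ≤ ε * kmin ε t := by positivity
                linarith
          rw [e, abs_mul, abs_mul, abs_of_pos (by positivity : 0 < 1 / Real.pi)]
          calc _ ≤ 1 / Real.pi * (|ψ t| * (1 + ε * kmin ε t)) := by gcongr
            _ = _ := by ring
      _ = ENNReal.ofReal (1 / Real.pi) * ((∫⁻ t, ‖ψ t‖ₑ) + ENNReal.ofReal ε *
          ∫⁻ t, (‖ψ t‖ₑ * ENNReal.ofReal (kmin ε (t - 0)))) := by
          have := H.ψm
          rw [lintegral_const_mul _ (by fun_prop), lintegral_add_left (by fun_prop),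
            lintegral_const_mul _ (by fun_prop)]
      _ ≤ ENNReal.ofReal (1 / Real.pi) * (ENNReal.ofReal (4 * Real.pi * Λ) + ENNReal.ofReal ε *
          ENNReal.ofReal (8 * Λ * (ε + 0) / ε ^ 2)) := by
          gcongr
          · exact H.tot
          · exact aux_tail _ H.ψm.enorm 0 Λ 0 ε hΛ.le le_rfl hε (by simpa using H.h1)
      _ = _ := by
          rw [← ENNReal.ofReal_mul (by positivity), ← ENNReal.ofReal_add (by positivity) (by positivity),
            ← ENNReal.ofReal_mul (by positivity)]
          congr 1; field_simp; ring
  rw [Measure.restrict_univ, integral_sub hGi (hHi.const_mul _), integral_indicator (ann_meas ε),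
    integral_const_mul] at hdiff
  set X := ∫ t in ann ε, Gk ψ 0 t
  set Y := ∫ t, ψ t * (t / (t ^ 2 + ε ^ 2))
  have h6 : |1 / Real.pi * Y| ≤ 1 / Real.pi * (2 * Λ) := by
    rw [abs_mul, abs_of_pos (by positivity : 0 < 1 / Real.pi)]; gcongr
  have h7 : |X| ≤ |X - 1 / Real.pi * Y| + |1 / Real.pi * Y| := by
    have := abs_add_le (X - 1 / Real.pi * Y) (1 / Real.pi * Y)
    simpa using this
  refine (h7.trans (add_le_add hdiff h6)).trans ?_
  have h8 : 1 / Real.pi ≤ 1 / 3 := one_div_le_one_div_of_le (by norm_num) hpi.le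
  have e : 1 / Real.pi * ((4 * Real.pi + 8) * Λ) + 1 / Real.pi * (2 * Λ) =
      4 * Λ + (1 / Real.pi) * (10 * Λ) := by field_simp; ring
  rw [e]
  nlinarith

lemma pointwise {ψ d : ℝ → ℝ} {Λ : ℝ} (H : Good ψ d Λ) (U : ℕ → ℝ)
    (hU : ∀ n : ℕ, pvT1 (Gk ψ (n : ℝ)) (U n)) (a N : ℕ) (hN : 1 ≤ N) :
    ∃ c, ∑ m ∈ Finset.range N, |U (a + m) - c| ≤ N * (15 * Λ) ∧ (a = 0 → |c| ≤ 15 * Λ) := by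
  have hN' : (0:ℝ) < N := by exact_mod_cast hN
  have hρ : (0:ℝ) < 1 / N := by positivity
  have hpi := Real.pi_gt_three
  have hΛ := H.Λ0
  refine ⟨U a - ∫ t in ann (1 / N), Gk ψ (a : ℝ) t, ?_, ?_⟩
  · have key : ∀ m ∈ Finset.range N, |U (a + m) - (U a - ∫ t in ann (1 / N), Gk ψ (a : ℝ) t)| ≤
        5 * Λ + (1 / Real.pi) * |∫ t, gtr ψ (1 / N) t * Real.cos ((a + m : ℝ) * t)| := by
      intro m hm
      have h1 := near_bound H a N m (Finset.mem_range.1 hm) (U (a + m)) (U a)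
        (by have := hU (a + m); push_cast at this; exact this) (hU a)
      have h2 := far2_bound H (a + m : ℝ) hρ
      set X := ∫ t in ann (1 / N), Gk ψ (a + m : ℝ) t
      set Z := ∫ t, gtr ψ (1 / N) t * Real.cos ((a + m : ℝ) * t)
      set W := ∫ t in ann (1 / N), Gk ψ (a : ℝ) t
      have h3 : |1 / Real.pi * Z| = 1 / Real.pi * |Z| := by
        rw [abs_mul, abs_of_pos (by positivity : 0 < 1 / Real.pi)]
      have e : U (a + m) - (U a - W) = ((U (a + m) - X) - (U a - W)) + ((X - 1 / Real.pi * Z) +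
        1 / Real.pi * Z) := by ring
      rw [e]
      have h4 := abs_add_le ((U (a + m) - X) - (U a - W)) ((X - 1 / Real.pi * Z) + 1 / Real.pi * Z)
      have h5 := abs_add_le (X - 1 / Real.pi * Z) (1 / Real.pi * Z)
      linarith
    refine (Finset.sum_le_sum key).trans ?_
    rw [Finset.sum_add_distrib]
    have h1 := far_bound H a N hN
    simp only [Finset.sum_const, Finset.card_range, nsmul_eq_mul]
    have h2 : 1 / Real.pi * ∑ m ∈ Finset.range N, |∫ t, gtr ψ (1 / N) t * Real.cos ((a + m : ℝ) * t)| ≤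
        1 / Real.pi * (N * (9 * Real.pi * Λ)) := by gcongr
    have h3 : 1 / Real.pi * (N * (9 * Real.pi * Λ)) = N * (9 * Λ) := by field_simp
    rw [h3, Finset.mul_sum] at h2
    have : 0 ≤ N * Λ := by positivity
    linarith
  · rintro rfl
    have h1 := hil_bound H hρ
    have h2 : |U 0| ≤ 15 / 2 * Λ := by
      have h0 := hU 0
      simp only [Nat.cast_zero] at h0
      refine le_of_tendsto h0.abs ?_
      filter_upwards [self_mem_nhdsWithin] with ε hε
      exact hil_bound H hε
    simp only [Nat.cast_zero]
    have := abs_sub (U 0) (∫ t in ann (1 / N), Gk ψ 0 t)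
    linarith


lemma step_int (ξ : ℕ → ℝ) (n : ℕ) (S : Set ℝ) : IntegrableOn (stepFun ξ n) S := by
  unfold stepFun
  refine integrable_finsetSum _ fun k _ => Integrable.integrableOn ?_
  rw [integrable_indicator_iff measurableSet_Icc]
  exact integrableOn_const (by simp)

lemma step_val (ξ : ℕ → ℝ) (n : ℕ) (t : ℝ) (h0 : 0 ≤ t) (h1 : t ≤ 1)
    (ht : t ∉ range fun k : ℕ => (k : ℝ) / ((n : ℝ) + 1)) :
    stepFun ξ n t = ξ ⌊t * (n + 1)⌋₊ ∧ (⌊t * (n + 1)⌋₊ : ℝ) < t * (n + 1) ∧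
      t * (n + 1) < ⌊t * (n + 1)⌋₊ + 1 := by
  have hn : (0:ℝ) < n + 1 := by positivity
  set k := ⌊t * (n + 1)⌋₊ with hk
  have hk1 : (k : ℝ) ≤ t * (n + 1) := Nat.floor_le (by positivity)
  have hk2 : t * (n + 1) < k + 1 := Nat.lt_floor_add_one _
  have hne : ∀ j : ℕ, (j : ℝ) ≠ t * (n + 1) := by
    intro j hj
    exact ht ⟨j, by simp only; rw [hj]; field_simp⟩
  have hk3 : (k : ℝ) < t * (n + 1) := lt_of_le_of_ne hk1 (hne k)
  refine ⟨?_, hk3, hk2⟩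
  have hkn : k < n + 1 := by
    have : (k : ℝ) < n + 1 := by nlinarith
    exact_mod_cast this
  unfold stepFun
  rw [Finset.sum_eq_single k]
  · rw [indicator_of_mem]
    rw [mem_Icc, div_le_iff₀ hn, le_div_iff₀ hn]
    exact ⟨hk1, hk2.le⟩
  · intro j _ hj
    rw [indicator_of_notMem]
    rw [mem_Icc, div_le_iff₀ hn, le_div_iff₀ hn]
    rintro ⟨h2, h3⟩
    have h3' : t * (n + 1) < j + 1 := lt_of_le_of_ne h3 (by
      have := hne (j + 1); push_cast at this; exact this.symm)
    have e1 : (j : ℝ) < k + 1 := by linarith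
    have e2 : (k : ℝ) < j + 1 := by linarith
    have e1' : j < k + 1 := by exact_mod_cast e1
    have e2' : k < j + 1 := by exact_mod_cast e2
    omega
  · intro h; exact absurd (Finset.mem_range.2 hkn) h

lemma step_osc (ξ : ℕ → ℝ) (C : ℝ) (hC : 0 ≤ C)
    (h : ∀ a N : ℕ, 1 ≤ N → ∃ c, ∑ m ∈ Finset.range N, |ξ (a + m) - c| ≤ N * C ∧ (a = 0 → |c| ≤ C))
    (n : ℕ) (p q : ℝ) (hp : 0 ≤ p) (hpq : p < q) (hq : q ≤ 1) :
    ∃ c, ∫ t in Icc p q, |stepFun ξ n t - c| ≤ (q - p) * (3 * C) ∧ (p = 0 → |c| ≤ C) := by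
  have hn : (0:ℝ) < n + 1 := by positivity
  set a := ⌊p * (n + 1)⌋₊ with ha
  set b := ⌈q * (n + 1)⌉₊ with hb
  have ha1 : (a : ℝ) ≤ p * (n + 1) := Nat.floor_le (by positivity)
  have ha2 : p * (n + 1) < a + 1 := Nat.lt_floor_add_one _
  have hb1 : q * (n + 1) ≤ b := Nat.le_ceil _
  have hb2 : (b : ℝ) < q * (n + 1) + 1 := Nat.ceil_lt_add_one (by nlinarith)
  have hab : a < b := by
    have : (a : ℝ) < b := by nlinarith
    exact_mod_cast this
  obtain ⟨N, hN⟩ : ∃ N, b = a + N := ⟨b - a, by omega⟩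
  obtain ⟨c, hc1, hc2⟩ := h a N (by omega)
  refine ⟨c, ?_, fun h0 => hc2 (by rw [ha, h0]; simp)⟩
  have hNr : (b : ℝ) = a + N := by exact_mod_cast hN
  set D : ℕ → Set ℝ := fun k => Icc ((k : ℝ) / (n + 1)) ((k + 1 : ℝ) / (n + 1)) with hD
  set μ := min (q - p) (1 / ((n : ℝ) + 1)) with hμ
  have hμ0 : 0 ≤ μ := le_min (by linarith) (by positivity)
  have hInt0 : ∀ m, IntegrableOn (fun t => (D (a + m)).indicator (fun _ => |ξ (a + m) - c|) t) (Icc p q) := by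
    intro m
    apply Integrable.integrableOn
    rw [integrable_indicator_iff measurableSet_Icc]
    exact integrableOn_const (by simp [hD])
  have hle : ∫ t in Icc p q, |stepFun ξ n t - c| ≤
      ∫ t in Icc p q, ∑ m ∈ Finset.range N, (D (a + m)).indicator (fun _ => |ξ (a + m) - c|) t := by
    apply integral_mono_ae
    · exact ((step_int ξ n _).sub (integrableOn_const (by simp))).abs
    · exact integrable_finsetSum _ fun m _ => hInt0 m
    · have hae : ∀ᵐ t : ℝ, t ∉ range fun k : ℕ => (k : ℝ) / ((n : ℝ) + 1) :=
        (countable_range _).ae_notMem volume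
      refine (ae_restrict_iff' measurableSet_Icc).2 ?_
      filter_upwards [hae] with t ht htI
      obtain ⟨hv, hk1, hk2⟩ := step_val ξ n t (hp.trans htI.1) (htI.2.trans hq) ht
      set k := ⌊t * (n + 1)⌋₊ with hk
      have hak : a ≤ k := Nat.floor_le_floor (by nlinarith [htI.1])
      have hkb : k < b := by
        have : (k : ℝ) < b := by nlinarith [htI.2]
        exact_mod_cast this
      obtain ⟨m, hm⟩ : ∃ m, k = a + m := ⟨k - a, by omega⟩
      rw [hv]
      have hmem : t ∈ D (a + m) := by
        change t ∈ Icc (((a + m : ℕ) : ℝ) / ((n : ℝ) + 1)) ((((a + m : ℕ) : ℝ) + 1) / ((n : ℝ) + 1))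
        rw [← hm, mem_Icc, div_le_iff₀ hn, le_div_iff₀ hn]
        exact ⟨hk1.le, hk2.le⟩
      calc |ξ k - c| = (D (a + m)).indicator (fun _ => |ξ (a + m) - c|) t := by
            rw [indicator_of_mem hmem, hm]
        _ ≤ _ := Finset.single_le_sum
            (f := fun m => (D (a + m)).indicator (fun _ => |ξ (a + m) - c|) t)
            (fun m _ => indicator_nonneg (fun _ _ => abs_nonneg _) _)
            (Finset.mem_range.2 (by omega))
  refine hle.trans ?_
  rw [integral_finsetSum _ fun m _ => hInt0 m]
  have hone : ∀ m, ∫ t in Icc p q, (D (a + m)).indicator (fun _ => |ξ (a + m) - c|) t ≤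
      μ * |ξ (a + m) - c| := by
    intro m
    rw [integral_indicator measurableSet_Icc, setIntegral_const, smul_eq_mul]
    gcongr
    rw [Measure.real, Measure.restrict_apply measurableSet_Icc]
    apply ENNReal.toReal_le_of_le_ofReal hμ0
    rw [hμ, ENNReal.ofReal_min]
    refine le_min ?_ ?_
    · refine (measure_mono inter_subset_right).trans ?_
      rw [Real.volume_Icc]
    · refine (measure_mono inter_subset_left).trans ?_
      rw [Real.volume_Icc]
      apply ENNReal.ofReal_le_ofReal
      apply le_of_eq; ring
  refine (Finset.sum_le_sum fun m _ => hone m).trans ?_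
  rw [← Finset.mul_sum]
  have hμN : μ * N ≤ (q - p) * 3 := by
    have hN2 : (N : ℝ) ≤ (q - p) * (n + 1) + 2 := by nlinarith
    have m1 : μ ≤ q - p := min_le_left _ _
    have m2 : μ * (n + 1) ≤ 1 := by
      have : μ ≤ 1 / ((n : ℝ) + 1) := min_le_right _ _
      rwa [le_div_iff₀ hn] at this
    calc μ * N ≤ μ * ((q - p) * (n + 1) + 2) := by gcongr
      _ = (q - p) * (μ * (n + 1)) + 2 * μ := by ring
      _ ≤ (q - p) * 1 + 2 * (q - p) := by
          have : 0 ≤ q - p := by linarith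
          gcongr
      _ = _ := by ring
  calc _ ≤ μ * (N * C) := by gcongr
    _ = (μ * N) * C := by ring
    _ ≤ ((q - p) * 3) * C := mul_le_mul_of_nonneg_right hμN hC
    _ = _ := by ring

lemma bmo_bound (ξ : ℕ → ℝ) (C : ℝ) (hC : 0 ≤ C)
    (h : ∀ a N : ℕ, 1 ≤ N → ∃ c, ∑ m ∈ Finset.range N, |ξ (a + m) - c| ≤ N * C ∧ (a = 0 → |c| ≤ C)) :
    bmoSeq ξ ≤ 10 * C := by
  unfold bmoSeq
  refine ciSup_le fun n => ?_
  unfold bmoNorm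
  have hgi := step_int ξ n
  have hosc : (⨆ I : {p : ℝ × ℝ // 0 ≤ p.1 ∧ p.1 < p.2 ∧ p.2 ≤ 1},
      (I.1.2 - I.1.1)⁻¹ *
        ∫ t in Set.Icc I.1.1 I.1.2,
          |stepFun ξ n t - (I.1.2 - I.1.1)⁻¹ * ∫ s in Set.Icc I.1.1 I.1.2, stepFun ξ n s|) ≤ 6 * C := by
    have : Nonempty {p : ℝ × ℝ // 0 ≤ p.1 ∧ p.1 < p.2 ∧ p.2 ≤ 1} := ⟨⟨(0, 1), by norm_num⟩⟩
    refine ciSup_le fun I => ?_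
    obtain ⟨⟨p, q⟩, hp, hpq, hq⟩ := I
    simp only at hp hpq hq ⊢
    obtain ⟨c, hc, -⟩ := step_osc ξ C hC h n p q hp hpq hq
    have hl : 0 < q - p := by linarith
    set L := q - p with hL
    set avg := L⁻¹ * ∫ s in Icc p q, stepFun ξ n s with havg
    have hci : ∀ c : ℝ, IntegrableOn (fun _ : ℝ => c) (Icc p q) := fun c => integrableOn_const (by simp)
    have hvol : volume.real (Icc p q) = L := by
      rw [Measure.real, Real.volume_Icc, ENNReal.toReal_ofReal hl.le]
    have h1 : |avg - c| ≤ 3 * C := by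
      have e : avg - c = L⁻¹ * ∫ s in Icc p q, (stepFun ξ n s - c) := by
        rw [integral_sub (hgi _) (hci c), setIntegral_const, hvol, havg, smul_eq_mul]
        field_simp
      rw [e, abs_mul, abs_of_pos (inv_pos.2 hl)]
      calc _ ≤ L⁻¹ * (L * (3 * C)) := by
            gcongr
            exact (abs_integral_le_integral_abs).trans hc
        _ = _ := by field_simp
    have h2 : ∫ t in Icc p q, |stepFun ξ n t - avg| ≤ ∫ t in Icc p q, (|stepFun ξ n t - c| + 3 * C) := by
      apply integral_mono
      · exact ((hgi _).sub (hci _)).abs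
      · exact ((hgi _).sub (hci _)).abs.add (hci _)
      · intro t
        simp only
        have := abs_sub_le (stepFun ξ n t) c avg
        rw [abs_sub_comm c avg] at this
        linarith
    have hab : Integrable (fun t => |stepFun ξ n t - c|) (volume.restrict (Icc p q)) :=
      ((hgi _).sub (hci _)).abs
    rw [integral_add hab (hci _), setIntegral_const, hvol, smul_eq_mul] at h2
    calc _ ≤ L⁻¹ * (L * (3 * C) + L * (3 * C)) := by
          gcongr
          exact h2.trans (by simpa using hc)
      _ = _ := by field_simp; ring
  have hmean : |∫ t in Icc (0:ℝ) 1, stepFun ξ n t| ≤ 4 * C := by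
    obtain ⟨c, hc, hc0⟩ := step_osc ξ C hC h n 0 1 le_rfl one_pos le_rfl
    have hc0 := hc0 rfl
    have hci : IntegrableOn (fun _ : ℝ => c) (Icc (0:ℝ) 1) := integrableOn_const (by simp)
    have e : ∫ t in Icc (0:ℝ) 1, stepFun ξ n t = (∫ t in Icc (0:ℝ) 1, (stepFun ξ n t - c)) + c := by
      rw [integral_sub (hgi _) hci, setIntegral_const]; simp
    rw [e]
    have h1 := abs_add_le (∫ t in Icc (0:ℝ) 1, (stepFun ξ n t - c)) c
    have h2 := (abs_integral_le_integral_abs (f := fun t => stepFun ξ n t - c)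
      (μ := volume.restrict (Icc (0:ℝ) 1))).trans hc
    linarith
  linarith


/-- conformal map from the disc to a half plane -/
def cay (x δ η : ℝ) (v : ℂ) : ℂ := (x : ℂ) + Complex.I * δ + Complex.I * η * ((1 + v) / (1 - v))

lemma cay_im (x δ η : ℝ) (hη : 0 < η) (v : ℂ) (hv : ‖v‖ ≤ 1) (hv1 : v ≠ 1) :
    δ ≤ (cay x δ η v).im := by
  have h1 : (1 : ℂ) - v ≠ 0 := sub_ne_zero.2 (Ne.symm hv1)
  have h2 : 0 ≤ ((1 + v) / (1 - v)).re := by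
    rw [Complex.div_re, ← add_div]
    apply div_nonneg _ (Complex.normSq_nonneg _)
    have : v.re * v.re + v.im * v.im ≤ 1 := by
      have h := Complex.normSq_eq_norm_sq v
      rw [Complex.normSq_apply] at h
      rw [h]
      nlinarith [norm_nonneg v]
    simp
    nlinarith
  have : (cay x δ η v).im = δ + η * ((1 + v) / (1 - v)).re := by
    unfold cay
    simp
  rw [this]
  have := mul_nonneg hη.le h2
  linarith

lemma cay_exp (x δ η s : ℝ) :
    cay x δ η (circleMap 0 1 (Real.pi + 2 * Real.arctan s)) = ((x + η * s : ℝ) : ℂ) + Complex.I * δ := by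
  have hs : (0:ℝ) < 1 + s ^ 2 := by positivity
  have e : circleMap 0 1 (Real.pi + 2 * Real.arctan s) = -((1 + Complex.I * s) ^ 2 / (1 + (s:ℂ) ^ 2)) := by
    have e1 : (((Real.pi + 2 * Real.arctan s : ℝ) : ℂ) * Complex.I)
        = (Real.pi * Complex.I) + ((Real.arctan s : ℂ) * Complex.I + (Real.arctan s : ℂ) * Complex.I) := by
      push_cast; ring
    rw [circleMap, e1, Complex.exp_add, Complex.exp_add, Complex.exp_pi_mul_I, Complex.exp_mul_I,
      ← Complex.ofReal_cos, ← Complex.ofReal_sin, Real.cos_arctan, Real.sin_arctan]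
    have hq : ((Real.sqrt (1 + s ^ 2) : ℝ) : ℂ) ^ 2 = 1 + (s : ℂ) ^ 2 := by
      rw [← Complex.ofReal_pow, Real.sq_sqrt hs.le]; push_cast; ring
    have hq0 : ((Real.sqrt (1 + s ^ 2) : ℝ) : ℂ) ≠ 0 := by
      exact_mod_cast (Real.sqrt_pos.2 hs).ne'
    rw [← hq]
    push_cast
    field_simp
    ring
  have hs0 : (1 : ℂ) + (s : ℂ) ^ 2 ≠ 0 := by exact_mod_cast hs.ne'
  have hf : (1 : ℂ) + (s : ℂ) ^ 2 = (1 + Complex.I * s) * (1 - Complex.I * s) := by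
    ring_nf; simp
  have ha : (1 + Complex.I * s) ≠ 0 := fun h => hs0 (by rw [hf, h, zero_mul])
  have hb : (1 - Complex.I * s) ≠ 0 := fun h => hs0 (by rw [hf, h, mul_zero])
  have e2 : circleMap 0 1 (Real.pi + 2 * Real.arctan s) = -((1 + Complex.I * s) / (1 - Complex.I * s)) := by
    rw [e, hf]; field_simp
  unfold cay
  have e3 : (1 + circleMap 0 1 (Real.pi + 2 * Real.arctan s)) / (1 - circleMap 0 1 (Real.pi + 2 * Real.arctan s))
      = - Complex.I * s := by
    rw [e2, div_eq_iff]
    · field_simp; ring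
    · have : (1 : ℂ) - -((1 + Complex.I * s) / (1 - Complex.I * s)) = 2 / (1 - Complex.I * s) := by
        field_simp; ring
      rw [this]; exact div_ne_zero two_ne_zero hb
  rw [e3]
  push_cast
  have : Complex.I * η * (-Complex.I * s) = -(Complex.I ^ 2) * (η * s) := by ring
  rw [this, Complex.I_sq]; ring

lemma poisson (G : ℂ → ℂ) (hG : ∀ z : ℂ, 0 < z.im → DifferentiableAt ℂ G z)
    (hb : ∀ z : ℂ, 0 < z.im → ‖G z‖ ≤ 1) (x δ η : ℝ) (hδ : 0 < δ) (hη : 0 < η) :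
    G ((x : ℂ) + Complex.I * ((δ + η : ℝ) : ℂ)) = (1 / Real.pi : ℝ) •
      ∫ s : ℝ, (1 / (1 + s ^ 2) : ℝ) • G (((x + η * s : ℝ) : ℂ) + Complex.I * δ) := by
  set g : ℂ → ℂ := fun v => G (cay x δ η v) with hg
  have him : ∀ v : ℂ, ‖v‖ ≤ 1 → v ≠ 1 → 0 < (cay x δ η v).im := fun v h1 h2 =>
    hδ.trans_le (cay_im x δ η hη v h1 h2)
  have hgd : ∀ v : ℂ, ‖v‖ ≤ 1 → v ≠ 1 → DifferentiableAt ℂ g v := by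
    intro v h1 h2
    have h3 : (1 : ℂ) - v ≠ 0 := sub_ne_zero.2 (Ne.symm h2)
    apply DifferentiableAt.comp v (hG _ (him v h1 h2))
    unfold cay
    fun_prop (disch := assumption)
  have hr : ∀ r : ℝ, 0 < r → r < 1 → Real.circleAverage g 0 r = g 0 := by
    intro r h0 h1
    apply DiffContOnCl.circleAverage
    apply DifferentiableOn.diffContOnCl
    intro v hv
    rw [closure_ball _ (by simpa using h0.ne'), abs_of_pos h0, mem_closedBall_zero_iff] at hv
    refine (hgd v (by linarith) ?_).differentiableWithinAt
    rintro rfl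
    simp at hv; linarith
  have hne : ∀ θ ∈ Ioo (0:ℝ) (2 * Real.pi), circleMap 0 1 θ ≠ 1 := by
    intro θ hθ h
    rw [circleMap] at h
    simp only [Complex.ofReal_one, one_mul, zero_add] at h
    rw [Complex.exp_eq_one_iff] at h
    obtain ⟨n, hn⟩ := h
    have hn2 : (θ : ℂ) = n * (2 * Real.pi) := by
      have := Complex.I_ne_zero
      have h3 : (θ : ℂ) * Complex.I = (n * (2 * Real.pi)) * Complex.I := by rw [hn]; ring
      exact mul_right_cancel₀ this h3
    have hn3 : θ = n * (2 * Real.pi) := by exact_mod_cast hn2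
    have hp := Real.pi_pos
    have a1 : (0:ℝ) < n := by
      by_contra hcon
      push Not at hcon
      have := hθ.1
      nlinarith
    have a2 : (n:ℝ) < 1 := by
      have := hθ.2
      by_contra hcon
      push Not at hcon
      nlinarith
    have a1' : (0:ℤ) < n := by exact_mod_cast a1
    have a2' : n < (1:ℤ) := by exact_mod_cast a2
    omega
  have hlim : Tendsto (fun r : ℝ => ∫ θ in Ioo (0:ℝ) (2 * Real.pi), g (circleMap 0 r θ)) (𝓝[<] 1)
      (𝓝 (∫ θ in Ioo (0:ℝ) (2 * Real.pi), g (circleMap 0 1 θ))) := by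
    have hev : ∀ᶠ r : ℝ in 𝓝[<] 1, 0 < r ∧ r < 1 := by
      filter_upwards [Ioo_mem_nhdsLT (show (0:ℝ) < 1 by norm_num)] with r hr using hr
    have hnr : ∀ r : ℝ, 0 < r → ∀ θ, ‖circleMap 0 r θ‖ = r := fun r h0 θ => by simp [abs_of_pos h0]
    have hne' : ∀ r : ℝ, 0 < r → r < 1 → ∀ θ, circleMap 0 r θ ≠ 1 := by
      intro r h0 h1 θ h
      have := hnr r h0 θ
      rw [h] at this; simp at this; linarith
    apply tendsto_integral_filter_of_dominated_convergence (fun _ => (1:ℝ))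
    · filter_upwards [hev] with r ⟨h0, h1⟩
      apply Continuous.aestronglyMeasurable
      rw [continuous_iff_continuousAt]
      intro θ
      have := (hgd (circleMap 0 r θ) (by rw [hnr r h0]; exact h1.le) (hne' r h0 h1 θ)).continuousAt
      exact ContinuousAt.comp (g := g) this (continuous_circleMap 0 r).continuousAt
    · filter_upwards [hev] with r ⟨h0, h1⟩
      refine Eventually.of_forall fun θ => ?_
      exact hb _ (him _ (by rw [hnr r h0]; exact h1.le) (hne' r h0 h1 θ))
    · exact integrableOn_const measure_Ioo_lt_top.ne
    · refine (ae_restrict_iff' measurableSet_Ioo).2 (Eventually.of_forall fun θ hθ => ?_)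
      have := (hgd (circleMap 0 1 θ) (by rw [hnr 1 one_pos]) (hne θ hθ)).continuousAt
      refine Tendsto.comp (g := g) this (tendsto_nhdsWithin_of_tendsto_nhds ?_)
      have : Continuous fun r : ℝ => circleMap 0 r θ := by unfold circleMap; fun_prop
      exact this.tendsto 1
  have hval : ∀ᶠ r : ℝ in 𝓝[<] 1, ∫ θ in Ioo (0:ℝ) (2 * Real.pi), g (circleMap 0 r θ) = (2 * Real.pi) • g 0 := by
    filter_upwards [Ioo_mem_nhdsLT (show (0:ℝ) < 1 by norm_num)] with r hr'
    rw [← hr r hr'.1 hr'.2, Real.circleAverage_def, intervalIntegral.integral_of_le (by positivity),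
      smul_smul, mul_inv_cancel₀ (by positivity), one_smul, integral_Ioc_eq_integral_Ioo]
  have hmean : ∫ θ in Ioo (0:ℝ) (2 * Real.pi), g (circleMap 0 1 θ) = (2 * Real.pi) • g 0 :=
    tendsto_nhds_unique (hlim.congr' hval) tendsto_const_nhds
  have himg : (fun s : ℝ => Real.pi + 2 * Real.arctan s) '' univ = Ioo 0 (2 * Real.pi) := by
    ext θ
    simp only [image_univ, mem_range, mem_Ioo]
    constructor
    · rintro ⟨s, rfl⟩
      have h1 := Real.neg_pi_div_two_lt_arctan s
      have h2 := Real.arctan_lt_pi_div_two s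
      constructor <;> linarith
    · rintro ⟨h1, h2⟩
      refine ⟨Real.tan ((θ - Real.pi) / 2), ?_⟩
      rw [Real.arctan_tan (by linarith) (by linarith)]; ring
  rw [← himg, integral_image_eq_integral_abs_deriv_smul (f' := fun s => 2 * (1 / (1 + s ^ 2))) MeasurableSet.univ
    (fun s _ => (((Real.hasDerivAt_arctan s).const_mul 2).const_add Real.pi).hasDerivWithinAt)
    (fun a _ b _ hab => Real.arctan_injective (by simpa using hab))] at hmean
  simp only [hg, cay_exp, Measure.restrict_univ] at hmean
  have h0 : cay x δ η 0 = (x : ℂ) + Complex.I * ((δ + η : ℝ) : ℂ) := by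
    unfold cay; push_cast; simp; ring
  rw [h0] at hmean
  have e : ∀ s : ℝ, |2 * (1 / (1 + s ^ 2))| • G (((x + η * s : ℝ) : ℂ) + Complex.I * δ)
      = (2:ℝ) • ((1 / (1 + s ^ 2) : ℝ) • G (((x + η * s : ℝ) : ℂ) + Complex.I * δ)) := by
    intro s
    rw [abs_of_nonneg (by positivity), smul_smul]
  simp only [e] at hmean
  rw [integral_smul] at hmean
  have hp := Real.pi_pos
  have h3 : ∫ s : ℝ, (1 / (1 + s ^ 2) : ℝ) • G (((x + η * s : ℝ) : ℂ) + Complex.I * δ)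
     = Real.pi • G ((x : ℂ) + Complex.I * ((δ + η : ℝ) : ℂ)) := by
    have h4 := congrArg (fun z : ℂ => (1/2 : ℝ) • z) hmean
    simp only [smul_smul] at h4
    rw [show (1 / 2 * 2 : ℝ) = 1 by norm_num, one_smul,
      show (1 / 2 * (2 * Real.pi) : ℝ) = Real.pi by ring] at h4
    exact h4
  rw [h3, smul_smul]
  rw [show 1 / Real.pi * Real.pi = 1 by field_simp, one_smul]


/-- Cauchy type integral -/
def Fc (p : ℝ → ℝ) (z : ℂ) : ℂ := ∫ y : ℝ, (p y : ℂ) * (Complex.I / (z - y))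

lemma zy_norm (z : ℂ) (y : ℝ) : z.im ≤ ‖z - y‖ := by
  have := Complex.abs_im_le_norm (z - y)
  simp at this
  exact (le_abs_self _).trans this

lemma zy_ne (z : ℂ) (hz : 0 < z.im) (y : ℝ) : z - y ≠ 0 := by
  have := zy_norm z y
  exact norm_pos_iff.1 (hz.trans_le this)

lemma zy_meas (z : ℂ) (hz : 0 < z.im) : Continuous fun y : ℝ => Complex.I / (z - y) := by
  have := zy_ne z hz
  fun_prop (disch := assumption)

lemma zy_bd (z : ℂ) (hz : 0 < z.im) (y : ℝ) : ‖Complex.I / (z - y)‖ ≤ 1 / z.im := by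
  rw [norm_div, Complex.norm_I]
  exact one_div_le_one_div_of_le hz (zy_norm z y)

lemma Fc_int (p : ℝ → ℝ) (hp : Integrable p) (z : ℂ) (hz : 0 < z.im) :
    Integrable fun y : ℝ => (p y : ℂ) * (Complex.I / (z - y)) := by
  refine hp.ofReal.mul_bdd (c := 1 / z.im) (zy_meas z hz).aestronglyMeasurable ?_
  exact Eventually.of_forall fun y => zy_bd z hz y

lemma Fc_diff (p : ℝ → ℝ) (hp : Integrable p) (z : ℂ) (hz : 0 < z.im) :
    DifferentiableAt ℂ (Fc p) z := by
  have hs : {w : ℂ | z.im / 2 < w.im} ∈ 𝓝 z :=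
    (isOpen_lt continuous_const Complex.continuous_im).mem_nhds (by simp; linarith)
  have hpos : ∀ w ∈ {w : ℂ | z.im / 2 < w.im}, 0 < w.im := fun w hw => by
    simp at hw; linarith
  have := hasDerivAt_integral_of_dominated_loc_of_deriv_le (μ := volume)
    (F := fun (w : ℂ) (y : ℝ) => (p y : ℂ) * (Complex.I / (w - y)))
    (F' := fun (w : ℂ) (y : ℝ) => (p y : ℂ) * (-Complex.I / (w - y) ^ 2)) (x₀ := z)
    (bound := fun y => |p y| * (1 / (z.im / 2) ^ 2)) hs
    (by
      filter_upwards [hs] with w hw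
      exact (Fc_int p hp w (hpos w hw)).aestronglyMeasurable)
    (Fc_int p hp z hz)
    (by
      apply hp.ofReal.aestronglyMeasurable.mul
      apply Continuous.aestronglyMeasurable
      have : ∀ y : ℝ, (z - y) ^ 2 ≠ 0 := fun y => pow_ne_zero 2 (zy_ne z hz y)
      fun_prop (disch := assumption))
    (by
      refine Eventually.of_forall fun y w hw => ?_
      rw [norm_mul, norm_div, norm_neg, Complex.norm_I, norm_pow, Complex.norm_real, Real.norm_eq_abs]
      have h1 : z.im / 2 ≤ ‖w - y‖ := (le_of_lt hw).trans (zy_norm w y)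
      gcongr)
    (hp.abs.mul_const _)
    (by
      refine Eventually.of_forall fun y w hw => ?_
      have hne := zy_ne w (hpos w hw) y
      have h1 : HasDerivAt (fun w : ℂ => w - y) 1 w := (hasDerivAt_id w).sub_const _
      have h2 := ((hasDerivAt_const w Complex.I).div h1 hne).const_mul (p y : ℂ)
      have e : (p y : ℂ) * ((0 * (w - ↑y) - Complex.I * 1) / (w - ↑y) ^ 2) =
          (p y : ℂ) * (-Complex.I / (w - y) ^ 2) := by ring
      rw [e] at h2
      exact h2)
  exact this.2.differentiableAt

lemma Fc_re (p : ℝ → ℝ) (hp : Integrable p) (hp0 : ∀ y, 0 ≤ p y) (z : ℂ) (hz : 0 < z.im) :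
    0 ≤ (Fc p z).re := by
  have := Complex.reCLM.integral_comp_comm (Fc_int p hp z hz)
  simp only [Complex.reCLM_apply] at this
  rw [Fc, ← this]
  apply integral_nonneg
  intro y
  simp only [Pi.zero_apply]
  rw [Complex.re_ofReal_mul, Complex.div_re]
  apply mul_nonneg (hp0 y)
  simp
  have := Complex.normSq_nonneg (z - y)
  positivity

lemma Fc_im (p : ℝ → ℝ) (hp : Integrable p) (x η : ℝ) (hη : 0 < η) :
    (Fc p (x + Complex.I * η)).im = - ∫ t, p (x + t) * (t / (t ^ 2 + η ^ 2)) := by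
  have hz : 0 < ((x : ℂ) + Complex.I * η).im := by simpa using hη
  have := Complex.imCLM.integral_comp_comm (Fc_int p hp _ hz)
  simp only [Complex.imCLM_apply] at this
  rw [Fc, ← this, ← integral_neg]
  rw [← integral_add_left_eq_self _ x]
  congr 1
  ext t
  rw [Complex.im_ofReal_mul, Complex.div_im]
  simp [Complex.normSq_apply]
  rw [show t * t + η * η = t ^ 2 + η ^ 2 by ring]
  ring

lemma Fc_norm (p : ℝ → ℝ) (hp : Integrable p) (hp0 : ∀ y, 0 ≤ p y) (z : ℂ) (hz : 0 < z.im) :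
    ‖Fc p z‖ ≤ (∫ y, p y) / z.im := by
  rw [Fc]
  refine (norm_integral_le_of_norm_le (hp.mul_const (1 / z.im)) (Eventually.of_forall fun y => ?_)).trans ?_
  · rw [norm_mul, Complex.norm_real, Real.norm_eq_abs, abs_of_nonneg (hp0 y)]
    exact mul_le_mul_of_nonneg_left (zy_bd z hz y) (hp0 y)
  · rw [integral_mul_const]; apply le_of_eq; ring

lemma Gc_facts (lam : ℝ) (hl : 0 < lam) (w : ℂ) (hw : 0 ≤ w.re) :
    (lam : ℂ) + w ≠ 0 ∧ ‖w / (lam + w)‖ ≤ 1 ∧ ‖w / (lam + w)‖ ≤ ‖w‖ / lam ∧ 0 ≤ (w / (lam + w)).re ∧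
      (lam ≤ ‖w‖ → 1 / 4 ≤ (w / (lam + w)).re) := by
  have hre : lam ≤ ‖(lam : ℂ) + w‖ := by
    have := Complex.re_le_norm ((lam : ℂ) + w)
    simp at this
    linarith
  have hne : (lam : ℂ) + w ≠ 0 := norm_pos_iff.1 (hl.trans_le hre)
  have hsq : ‖(lam : ℂ) + w‖ ^ 2 = lam ^ 2 + 2 * lam * w.re + ‖w‖ ^ 2 := by
    rw [← Complex.normSq_eq_norm_sq, ← Complex.normSq_eq_norm_sq, Complex.normSq_apply, Complex.normSq_apply]
    simp; ring
  have hww : ‖w‖ ≤ ‖(lam : ℂ) + w‖ := by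
    refine (sq_le_sq₀ (norm_nonneg _) (norm_nonneg _)).1 ?_
    rw [hsq]
    have := mul_nonneg hl.le hw
    nlinarith
  have hre2 : (w / (lam + w)).re = (lam * w.re + ‖w‖ ^ 2) / ‖(lam : ℂ) + w‖ ^ 2 := by
    rw [Complex.div_re, ← Complex.normSq_eq_norm_sq w, ← Complex.normSq_eq_norm_sq, Complex.normSq_apply w]
    simp; ring
  have hpos : 0 < ‖(lam : ℂ) + w‖ := norm_pos_iff.2 hne
  refine ⟨hne, ?_, ?_, ?_, ?_⟩
  · rw [norm_div]; exact div_le_one_of_le₀ hww hpos.le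
  · rw [norm_div]; gcongr
  · rw [hre2]; positivity
  · intro h
    rw [hre2, le_div_iff₀ (by positivity), hsq]
    have := mul_nonneg hl.le hw
    nlinarith

lemma poisson_re (G : ℂ → ℂ) (hG : ∀ z : ℂ, 0 < z.im → DifferentiableAt ℂ G z)
    (hb : ∀ z : ℂ, 0 < z.im → ‖G z‖ ≤ 1) (x δ η : ℝ) (hδ : 0 < δ) (hη : 0 < η) :
    Integrable (fun y : ℝ => (G ((y : ℂ) + Complex.I * δ)).re * (η / ((y - x) ^ 2 + η ^ 2))) ∧
    ∫ y : ℝ, (G ((y : ℂ) + Complex.I * δ)).re * (η / ((y - x) ^ 2 + η ^ 2)) =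
      Real.pi * (G ((x : ℂ) + Complex.I * ((δ + η : ℝ) : ℂ))).re := by
  have hP := poisson G hG hb x δ η hδ hη
  have him : ∀ y : ℝ, 0 < ((y : ℂ) + Complex.I * δ).im := fun y => by simpa using hδ
  have hc : Continuous fun y : ℝ => G ((y : ℂ) + Complex.I * δ) := by
    rw [continuous_iff_continuousAt]
    intro y
    refine ContinuousAt.comp (g := G) (hG _ (him y)).continuousAt ?_
    fun_prop
  have hc2 : Continuous fun s : ℝ => G (((x + η * s : ℝ) : ℂ) + Complex.I * δ) :=
    hc.comp (f := fun s : ℝ => x + η * s) (by fun_prop)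
  have hi : Integrable fun s : ℝ => (1 / (1 + s ^ 2) : ℝ) • G (((x + η * s : ℝ) : ℂ) + Complex.I * δ) := by
    have h1 : Integrable fun s : ℝ => (1 / (1 + s ^ 2) : ℝ) := by
      simpa using integrable_inv_one_add_sq
    refine Integrable.smul_bdd h1 1 hc2.aestronglyMeasurable ?_
    exact Eventually.of_forall fun s => hb _ (him _)
  set k : ℝ → ℝ := fun y => (G ((y : ℂ) + Complex.I * δ)).re * (η / ((y - x) ^ 2 + η ^ 2)) with hk
  have hke : ∀ s : ℝ, k (x + η * s) = η⁻¹ * Complex.reCLM ((1 / (1 + s ^ 2) : ℝ) • G (((x + η * s : ℝ) : ℂ) + Complex.I * δ)) := by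
    intro s
    simp only [hk, Complex.reCLM_apply, Complex.smul_re, smul_eq_mul]
    have : (x + η * s - x) ^ 2 + η ^ 2 = η ^ 2 * (1 + s ^ 2) := by ring
    rw [this]
    have : (0:ℝ) < 1 + s ^ 2 := by positivity
    field_simp
  have hki : Integrable fun s : ℝ => k (x + η * s) := by
    simp only [hke]
    exact (Complex.reCLM.integrable_comp hi).const_mul _
  have hki2 : Integrable fun u : ℝ => k (x + u) :=
    (integrable_comp_mul_left_iff (fun u => k (x + u)) hη.ne').1 hki
  have hki3 : Integrable k := by
    simpa using hki2.comp_add_left (-x)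
  refine ⟨hki3, ?_⟩
  have e1 : ∫ s : ℝ, k (x + η * s) = η⁻¹ * ∫ y, k y := by
    rw [Measure.integral_comp_mul_left (fun u => k (x + u)) η, integral_add_left_eq_self k x,
      abs_of_pos (inv_pos.2 hη), smul_eq_mul]
  simp only [hke] at e1
  rw [integral_const_mul, Complex.reCLM.integral_comp_comm hi] at e1
  have e2 := mul_left_cancel₀ (inv_pos.2 hη).ne' e1
  rw [← e2, Complex.reCLM_apply, hP, Complex.smul_re, smul_eq_mul]
  rw [← mul_assoc, mul_one_div_cancel Real.pi_pos.ne', one_mul]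


lemma hilbert_delta (p : ℝ → ℝ) (hp : Integrable p) (hp0 : ∀ y, 0 ≤ p y) (lam δ : ℝ)
    (hl : 0 < lam) (hδ : 0 < δ) :
    volume {x : ℝ | ∃ η, 0 < η ∧ lam ≤ ‖Fc p ((x : ℂ) + Complex.I * ((δ + η : ℝ) : ℂ))‖} ≤
      ENNReal.ofReal (200 * (Real.pi * ((∫ y, p y) / lam))) := by
  set M := ∫ y, p y with hM
  have hM0 : 0 ≤ M := integral_nonneg hp0
  have hpi := Real.pi_pos
  set G : ℂ → ℂ := fun z => Fc p z / (lam + Fc p z) with hGdef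
  have hF := fun z hz => Gc_facts lam hl (Fc p z) (Fc_re p hp hp0 z hz)
  have hG : ∀ z : ℂ, 0 < z.im → DifferentiableAt ℂ G z := by
    intro z hz
    have h1 := Fc_diff p hp z hz
    exact h1.div (h1.const_add _) (hF z hz).1
  have hb : ∀ z : ℂ, 0 < z.im → ‖G z‖ ≤ 1 := fun z hz => (hF z hz).2.1
  have him : ∀ (a : ℝ), 0 < a → ∀ y : ℝ, 0 < ((y : ℂ) + Complex.I * a).im := fun a ha y => by simpa using ha
  set h : ℝ → ℝ := fun y => (G ((y : ℂ) + Complex.I * δ)).re with hh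
  have hh0 : ∀ y, 0 ≤ h y := fun y => (hF _ (him δ hδ y)).2.2.2.1
  have hhc : Continuous h := by
    refine Complex.continuous_re.comp ?_
    rw [continuous_iff_continuousAt]
    intro y
    refine ContinuousAt.comp (g := G) (hG _ (him δ hδ y)).continuousAt ?_
    fun_prop
  have hhm : Measurable h := hhc.measurable
  have key : ∀ x η : ℝ, 0 < η →
      ∫⁻ y, ENNReal.ofReal (h y) * ENNReal.ofReal (η / ((y - x) ^ 2 + η ^ 2)) =
        ENNReal.ofReal (Real.pi * (G ((x : ℂ) + Complex.I * ((δ + η : ℝ) : ℂ))).re) := by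
    intro x η hη
    obtain ⟨h1, h2⟩ := poisson_re G hG hb x δ η hδ hη
    rw [← h2, ofReal_integral_eq_lintegral_ofReal h1]
    · refine lintegral_congr fun y => ?_
      rw [← ENNReal.ofReal_mul (hh0 y)]
    · refine Eventually.of_forall fun y => ?_
      exact mul_nonneg (hh0 y) (by positivity)
  -- the L1 bound
  have hL1 : ∫⁻ y, ENNReal.ofReal (h y) ≤ ENNReal.ofReal (Real.pi * (M / lam)) := by
    have ht := lintegral_tendsto_of_tendsto_of_monotone (μ := volume)
      (f := fun (n : ℕ) (y : ℝ) => ENNReal.ofReal (h y * (1 - y ^ 2 / (y ^ 2 + ((n : ℝ) + 1) ^ 2))))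
      (F := fun y => ENNReal.ofReal (h y))
      (fun n => by
        apply Measurable.aemeasurable
        fun_prop)
      (Eventually.of_forall fun y => by
        intro m n hmn
        apply ENNReal.ofReal_le_ofReal
        apply mul_le_mul_of_nonneg_left _ (hh0 y)
        have : (m : ℝ) ≤ n := by exact_mod_cast hmn
        gcongr)
      (Eventually.of_forall fun y => by
        apply (ENNReal.continuous_ofReal.tendsto _).comp
        have t1 : Tendsto (fun n : ℕ => y ^ 2 + ((n : ℝ) + 1) ^ 2) atTop atTop := by
          apply tendsto_atTop_add_const_left
          exact (tendsto_pow_atTop two_ne_zero).comp (tendsto_atTop_add_const_right _ _ tendsto_natCast_atTop_atTop)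
        have t2 := (((tendsto_const_nhds (x := y ^ 2)).div_atTop t1).const_sub 1).const_mul (h y)
        simpa using t2)
    refine le_of_tendsto ht (Eventually.of_forall fun n => ?_)
    have hη : (0:ℝ) < (n : ℝ) + 1 := by positivity
    have k1 := key 0 ((n : ℝ) + 1) hη
    set η : ℝ := (n : ℝ) + 1 with hηd
    have e1 : ∫⁻ y, ENNReal.ofReal (h y * (1 - y ^ 2 / (y ^ 2 + η ^ 2))) =
        ENNReal.ofReal η * ∫⁻ y, ENNReal.ofReal (h y) * ENNReal.ofReal (η / ((y - 0) ^ 2 + η ^ 2)) := by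
      rw [← lintegral_const_mul _ (by fun_prop)]
      refine lintegral_congr fun y => ?_
      rw [← ENNReal.ofReal_mul (hh0 y), ← ENNReal.ofReal_mul hη.le]
      congr 1
      have : 0 < y ^ 2 + η ^ 2 := by positivity
      rw [sub_zero]
      field_simp
      ring
    rw [e1, k1, ← ENNReal.ofReal_mul hη.le]
    apply ENNReal.ofReal_le_ofReal
    have hz : 0 < (((0:ℝ) : ℂ) + Complex.I * ((δ + η : ℝ) : ℂ)).im := him (δ + η) (by linarith) 0
    have b1 := (Complex.re_le_norm _).trans (hF _ hz).2.2.1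
    have b2 := Fc_norm p hp hp0 _ hz
    have b3 : (((0:ℝ) : ℂ) + Complex.I * ((δ + η : ℝ) : ℂ)).im = δ + η := by simp
    rw [b3, ← hM] at b2
    have b4 : M / (δ + η) ≤ M / η := by gcongr; linarith
    calc η * (Real.pi * (G (((0:ℝ) : ℂ) + Complex.I * ((δ + η : ℝ) : ℂ))).re)
        ≤ η * (Real.pi * ((M / η) / lam)) := by
          gcongr
          refine b1.trans ?_
          gcongr
          exact b2.trans b4
      _ = _ := by field_simp
  have hfin : ∫⁻ y, ENNReal.ofReal (h y) ≠ ∞ := ne_top_of_le_ne_top ENNReal.ofReal_ne_top hL1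
  have hHL := aux_HL (fun y => ENNReal.ofReal (h y)) hfin (1/20) (by norm_num)
  refine (measure_mono ?_).trans (hHL.trans ?_)
  · rintro x ⟨η, hη, hx⟩
    by_contra hcon
    simp only [mem_setOf_eq, not_exists, not_and, not_lt] at hcon
    have ht := aux_tail (fun y => ENNReal.ofReal (h y)) (by fun_prop) x (1/20) 0 η (by norm_num) le_rfl hη
      (by simpa using hcon)
    have k1 := key x η hη
    have k2 : ENNReal.ofReal (Real.pi * (G ((x : ℂ) + Complex.I * ((δ + η : ℝ) : ℂ))).re) ≤
        ENNReal.ofReal (η * (8 * (1/20) * (η + 0) / η ^ 2)) := by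
      rw [← k1, ENNReal.ofReal_mul hη.le]
      refine le_trans ?_ (mul_le_mul_right ht _)
      rw [← lintegral_const_mul _ (by have := kmin_meas; fun_prop)]
      refine lintegral_mono fun y => ?_
      rw [mul_left_comm, ← ENNReal.ofReal_mul hη.le]
      gcongr
      unfold kmin
      rw [mul_one_div]
      have hm : 0 < max η |y - x| := lt_max_of_lt_left hη
      apply div_le_div_of_nonneg_left hη.le (by positivity)
      rcases max_choice η |y - x| with h | h <;> rw [h]
      · nlinarith [sq_nonneg (y - x)]
      · rw [sq_abs]; nlinarith [sq_nonneg η]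
    have hz : 0 < ((x : ℂ) + Complex.I * ((δ + η : ℝ) : ℂ)).im := him (δ + η) (by linarith) x
    have k3 := (hF _ hz).2.2.2.2 hx
    rw [ENNReal.ofReal_le_ofReal_iff (by positivity)] at k2
    have k4 : η * (8 * (1/20) * (η + 0) / η ^ 2) = 2 / 5 := by field_simp; ring
    rw [k4] at k2
    have k5 : Real.pi * (1/4) ≤ Real.pi * (G ((x : ℂ) + Complex.I * ((δ + η : ℝ) : ℂ))).re := by
      gcongr
    have := Real.pi_gt_three
    linarith
  · refine (mul_le_mul_right hL1 _).trans ?_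
    rw [← ENNReal.ofReal_mul (by norm_num)]
    apply ENNReal.ofReal_le_ofReal
    apply le_of_eq; ring

lemma hilbert_weak (p : ℝ → ℝ) (hp : Integrable p) (hp0 : ∀ y, 0 ≤ p y) (lam : ℝ) (hl : 0 < lam) :
    volume {x : ℝ | ∃ η, 0 < η ∧ lam ≤ |∫ t, p (x + t) * (t / (t ^ 2 + η ^ 2))|} ≤
      ENNReal.ofReal (200 * (Real.pi * ((∫ y, p y) / lam))) := by
  set A : ℕ → Set ℝ := fun n => {x : ℝ | ∃ η, 1 / ((n : ℝ) + 1) < η ∧ lam ≤ |∫ t, p (x + t) * (t / (t ^ 2 + η ^ 2))|}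
    with hA
  have hsub : {x : ℝ | ∃ η, 0 < η ∧ lam ≤ |∫ t, p (x + t) * (t / (t ^ 2 + η ^ 2))|} ⊆ ⋃ n, A n := by
    rintro x ⟨η, hη, hx⟩
    obtain ⟨n, hn⟩ := exists_nat_one_div_lt hη
    exact mem_iUnion.2 ⟨n, η, hn, hx⟩
  have hmono : Monotone A := by
    rintro m n hmn x ⟨η, hη, hx⟩
    refine ⟨η, lt_of_le_of_lt ?_ hη, hx⟩
    have : (m : ℝ) ≤ n := by exact_mod_cast hmn
    gcongr
  refine (measure_mono hsub).trans ?_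
  rw [hmono.measure_iUnion]
  refine iSup_le fun n => ?_
  refine le_trans (measure_mono ?_) (hilbert_delta p hp hp0 lam (1 / ((n : ℝ) + 1)) hl (by positivity))
  rintro x ⟨η, hη, hx⟩
  have hη0 : 0 < η := lt_trans (by positivity) hη
  refine ⟨η - 1 / ((n : ℝ) + 1), by linarith, ?_⟩
  rw [add_sub_cancel]
  refine hx.trans ?_
  rw [← abs_neg, ← Fc_im p hp x η hη0]
  exact Complex.abs_im_le_norm _


lemma trans_ball (w : ℝ → ℝ≥0∞) (x a r : ℝ) :
    ∫⁻ s in Metric.closedBall a r, w (x + s) = ∫⁻ u in Metric.closedBall (x + a) r, w u := by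
  rw [← (measurePreserving_add_left volume x).setLIntegral_comp_preimage_emb
    (measurableEmbedding_addLeft x) w]
  congr 2
  ext s
  simp [Real.dist_eq]

lemma trans_Ico (w : ℝ → ℝ≥0∞) (x a b : ℝ) :
    ∫⁻ s in Ico a b, w (x + s) = ∫⁻ u in Ico (x + a) (x + b), w u := by
  rw [← (measurePreserving_add_left volume x).setLIntegral_comp_preimage_emb
    (measurableEmbedding_addLeft x) w]
  congr 2
  ext s
  simp

/-- truncation to three periods -/
def trunc (f : ℝ → ℝ) : ℝ → ℝ := indicator (Ico (-(3 * Real.pi)) (3 * Real.pi)) f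

lemma trunc_lint (f : ℝ → ℝ) (hper : ∀ x : ℝ, f (x + 2 * Real.pi) = f x)
    (hfi : IntegrableOn f T1) :
    ∫⁻ y, ‖trunc f y‖ₑ ≤ ENNReal.ofReal (3 * ∫ x in T1, |f x|) := by
  have hpi := Real.pi_pos
  have h1 : ∫⁻ y in Ico (-Real.pi) Real.pi, ‖f y‖ₑ = ENNReal.ofReal (∫ x in T1, |f x|) := by
    have := ofReal_integral_norm_eq_lintegral_enorm hfi
    simp only [Real.norm_eq_abs] at this
    rw [this]; rfl
  have h2 : ∫⁻ y in Ico Real.pi (3 * Real.pi), ‖f y‖ₑ = ∫⁻ y in Ico (-Real.pi) Real.pi, ‖f y‖ₑ := by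
    have := trans_Ico (fun y => ‖f y‖ₑ) (2 * Real.pi) (-Real.pi) Real.pi
    simp only [add_comm (2 * Real.pi), hper] at this
    rw [this]; congr 3 <;> ring
  have h3 : ∫⁻ y in Ico (-(3 * Real.pi)) (-Real.pi), ‖f y‖ₑ = ∫⁻ y in Ico (-Real.pi) Real.pi, ‖f y‖ₑ := by
    have := trans_Ico (fun y => ‖f y‖ₑ) (2 * Real.pi) (-(3 * Real.pi)) (-Real.pi)
    simp only [add_comm (2 * Real.pi), hper] at this
    rw [this]; congr 3 <;> ring
  have e : ∀ y, ‖trunc f y‖ₑ = (Ico (-(3 * Real.pi)) (3 * Real.pi)).indicator (fun y => ‖f y‖ₑ) y := by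
    intro y
    rw [trunc, enorm_indicator_eq_indicator_enorm]
  simp only [e]
  rw [lintegral_indicator measurableSet_Ico,
    ← Ico_union_Ico_eq_Ico (show -(3 * Real.pi) ≤ Real.pi by linarith) (show Real.pi ≤ 3 * Real.pi by linarith),
    ← Ico_union_Ico_eq_Ico (show -(3 * Real.pi) ≤ -Real.pi by linarith) (show -Real.pi ≤ Real.pi by linarith)]
  refine (lintegral_union_le _ _ _).trans ?_
  refine (add_le_add_left (lintegral_union_le _ _ _) _).trans ?_
  rw [h2, h3, h1]
  have hI : 0 ≤ ∫ x in T1, |f x| := integral_nonneg fun _ => abs_nonneg _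
  rw [← ENNReal.ofReal_add hI hI, ← ENNReal.ofReal_add (by linarith) hI]
  apply ENNReal.ofReal_le_ofReal
  linarith

lemma kern_bd (η t : ℝ) (hη : 0 < η) : ‖t / (t ^ 2 + η ^ 2)‖ ≤ 1 / η := by
  have : 0 < t ^ 2 + η ^ 2 := by positivity
  rw [Real.norm_eq_abs, abs_div, abs_of_pos this, div_le_div_iff₀ this hη]
  rw [← sq_abs t]
  nlinarith [sq_nonneg (|t| - η), abs_nonneg t]

lemma good_of (φ d : ℝ → ℝ) (Gs : Set ℝ) (hφm : Measurable φ) (hφi : Integrable φ)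
    (hsupp : ∀ y, y ∉ Ico (-(3 * Real.pi)) (3 * Real.pi) → φ y = 0)
    (Λ : ℝ) (hΛ : 0 < Λ)
    (hGs : ∀ z ∈ Gs, ∀ r, 0 < r → ∫⁻ y in Metric.closedBall z r, ‖φ y‖ₑ ≤ ENNReal.ofReal (Λ * r))
    (hd : d = fun y => Metric.infDist y Gs)
    (x : ℝ) (hxT : x ∈ T1) (hx : x ∈ Gs)
    (hx2 : ∫⁻ y, ‖φ y‖ₑ * ENNReal.ofReal (d y * kmin (d y) (y - x)) ≤ ENNReal.ofReal Λ)
    (hx3 : ∀ η, 0 < η → |∫ t, (max (φ (x + t)) 0) * (t / (t ^ 2 + η ^ 2))| ≤ Λ)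
    (hx4 : ∀ η, 0 < η → |∫ t, (max (-φ (x + t)) 0) * (t / (t ^ 2 + η ^ 2))| ≤ Λ) :
    Good (fun t => φ (x + t)) (fun t => d (x + t)) Λ := by
  have hψi : Integrable fun t => φ (x + t) := hφi.comp_add_left x
  have hdm : Measurable d := by rw [hd]; exact (Metric.continuous_infDist_pt Gs).measurable
  have hb := trans_ball (fun y => ‖φ y‖ₑ) x
  have hxT' : -Real.pi ≤ x ∧ x < Real.pi := hxT
  have hpi := Real.pi_pos
  refine ⟨by fun_prop, hψi, by fun_prop, hΛ, ?_, ?_, ?_, ?_, ?_, ?_, ?_⟩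
  · intro y; simp only [hd]; exact Metric.infDist_nonneg
  · intro y
    simp only [hd]
    refine (Metric.infDist_le_dist_of_mem hx).trans ?_
    simp [Real.dist_eq]
  · intro r hr
    have := hb 0 r
    rw [this, add_zero]
    exact hGs x hx r hr
  · intro y r hr
    have := hb y r
    rw [this]
    have hlim : Tendsto (fun e : ℝ => ENNReal.ofReal (Λ * (r + (d (x + y) + e)))) (𝓝[>] 0)
        (𝓝 (ENNReal.ofReal (Λ * (r + (d (x + y) + 0))))) := by
      apply tendsto_nhdsWithin_of_tendsto_nhds
      have : Continuous fun e : ℝ => ENNReal.ofReal (Λ * (r + (d (x + y) + e))) :=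
        ENNReal.continuous_ofReal.comp (by fun_prop)
      exact this.tendsto 0
    rw [add_zero] at hlim
    refine ge_of_tendsto hlim ?_
    filter_upwards [self_mem_nhdsWithin] with e he
    have he : 0 < e := he
    have hlt : Metric.infDist (x + y) Gs < d (x + y) + e := by simp only [hd]; linarith
    obtain ⟨z, hz, hzd⟩ := (Metric.infDist_lt_iff ⟨x, hx⟩).1 hlt
    have hd0 : 0 ≤ d (x + y) := by simp only [hd]; exact Metric.infDist_nonneg
    refine le_trans (lintegral_mono_set ?_) (hGs z hz (r + (d (x + y) + e)) (by linarith))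
    exact Metric.closedBall_subset_closedBall' (by linarith)
  · have := lintegral_add_left_eq_self (μ := volume)
      (fun y => ‖φ y‖ₑ * ENNReal.ofReal (d y * kmin (d y) (y - x))) x
    simp only [add_sub_cancel_left] at this
    rw [this]; exact hx2
  · intro η hη
    have hK : Measurable fun t : ℝ => t / (t ^ 2 + η ^ 2) := by fun_prop
    have i1 : Integrable fun t => (max (φ (x + t)) 0) * (t / (t ^ 2 + η ^ 2)) :=
      (hψi.pos_part).mul_bdd (c := 1 / η) hK.aestronglyMeasurable
        (Eventually.of_forall fun t => kern_bd η t hη)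
    have i2 : Integrable fun t => (max (-φ (x + t)) 0) * (t / (t ^ 2 + η ^ 2)) :=
      (hψi.neg_part).mul_bdd (c := 1 / η) hK.aestronglyMeasurable
        (Eventually.of_forall fun t => kern_bd η t hη)
    have e : ∫ t, φ (x + t) * (t / (t ^ 2 + η ^ 2)) =
        (∫ t, (max (φ (x + t)) 0) * (t / (t ^ 2 + η ^ 2))) -
          ∫ t, (max (-φ (x + t)) 0) * (t / (t ^ 2 + η ^ 2)) := by
      rw [← integral_sub i1 i2]
      congr 1
      ext t
      rw [← sub_mul]
      congr 1
      rcases le_total 0 (φ (x + t)) with h | h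
      · rw [max_eq_left h, max_eq_right (by linarith)]; ring
      · rw [max_eq_right h, max_eq_left (by linarith)]; ring
    rw [e]
    refine (abs_sub _ _).trans ?_
    linarith [hx3 η hη, hx4 η hη]
  · have h4 := hGs x hx (4 * Real.pi) (by linarith)
    have e : ∫⁻ y in Metric.closedBall x (4 * Real.pi), ‖φ y‖ₑ = ∫⁻ y, ‖φ y‖ₑ := by
      apply setLIntegral_eq_of_support_subset
      intro y hy
      by_contra hcon
      apply hy
      have : y ∉ Ico (-(3 * Real.pi)) (3 * Real.pi) := by
        intro hy2
        apply hcon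
        rw [Metric.mem_closedBall, Real.dist_eq, abs_le]
        constructor <;> linarith [hy2.1, hy2.2, hxT'.1, hxT'.2]
      simp [hsupp y this]
    rw [e] at h4
    have := lintegral_add_left_eq_self (μ := volume) (fun y => ‖φ y‖ₑ) x
    rw [this]
    refine h4.trans (le_of_eq ?_)
    congr 1; ring

theorem main_bound (f : ℝ → ℝ) (hfm : Measurable f) (hper : ∀ x : ℝ, f (x + 2 * Real.pi) = f x)
    (hfi : IntegrableOn f T1) (U : ℕ → ℝ → ℝ)
    (hU : ∀ n : ℕ, ∀ᵐ x : ℝ,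
          pvT1 (fun t => (1 / Real.pi) * (Real.cos ((n : ℝ) * t) / (2 * Real.tan (t / 2))) *
            f (x + t)) (U n x)) (lam : ℝ) (hlam : 0 < lam) :
    volume {x : ℝ | x ∈ T1 ∧ lam < bmoSeq (fun n => U n x)} ≤
            ENNReal.ofReal (((150 * 3 * (26 + 400 * Real.pi)) / lam) * ∫ x in T1, |f x|) := by
  have hpi := Real.pi_pos
  set I := ∫ x in T1, |f x| with hI
  have hI0 : 0 ≤ I := integral_nonneg fun _ => abs_nonneg _
  set φ := trunc f with hφ
  have hφm : Measurable φ := hfm.indicator measurableSet_Ico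
  have hW : ∫⁻ y, ‖φ y‖ₑ ≤ ENNReal.ofReal (3 * I) := trunc_lint f hper hfi
  have hWf : ∫⁻ y, ‖φ y‖ₑ ≠ ∞ := ne_top_of_le_ne_top ENNReal.ofReal_ne_top hW
  have hφi : Integrable φ := ⟨hφm.aestronglyMeasurable, hWf.lt_top⟩
  have hsupp : ∀ y, y ∉ Ico (-(3 * Real.pi)) (3 * Real.pi) → φ y = 0 :=
    fun y hy => indicator_of_notMem hy _
  set Λ := lam / 150 with hΛd
  have hΛ : 0 < Λ := by positivity
  set E1 := {x : ℝ | ∃ r, 0 < r ∧ ENNReal.ofReal (Λ * r) < ∫⁻ y in Metric.closedBall x r, ‖φ y‖ₑ} with hE1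
  have b1 : volume E1 ≤ ENNReal.ofReal (10 / Λ * (3 * I)) := by
    refine (aux_HL (fun y => ‖φ y‖ₑ) hWf Λ hΛ).trans ?_
    rw [ENNReal.ofReal_mul (by positivity)]
    gcongr
  have hGs : ∀ z ∈ E1ᶜ, ∀ r, 0 < r → ∫⁻ y in Metric.closedBall z r, ‖φ y‖ₑ ≤ ENNReal.ofReal (Λ * r) := by
    intro z hz r hr
    by_contra hcon
    exact hz ⟨r, hr, not_le.1 hcon⟩
  set d : ℝ → ℝ := fun y => Metric.infDist y E1ᶜ with hd
  have hdm : Measurable d := (Metric.continuous_infDist_pt _).measurable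
  have hd0 : ∀ y, 0 ≤ d y := fun y => Metric.infDist_nonneg
  have hwm : Measurable fun y => ‖φ y‖ₑ := hφm.enorm
  set g : ℝ → ℝ≥0∞ := fun x => ∫⁻ y, ‖φ y‖ₑ * ENNReal.ofReal (d y * kmin (d y) (y - x)) with hg
  have hgm : Measurable g := by
    have : Measurable (fun q : ℝ × ℝ => ‖φ q.2‖ₑ * ENNReal.ofReal (d q.2 * kmin (d q.2) (q.2 - q.1))) := by
      unfold kmin
      fun_prop
    exact this.lintegral_prod_right'
  set E2 := {x : ℝ | ENNReal.ofReal Λ ≤ g x} with hE2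
  have b2 : volume E2 ≤ ENNReal.ofReal (16 / Λ * (3 * I)) := by
    have h0 : ENNReal.ofReal Λ ≠ 0 := by simpa using hΛ
    refine (meas_ge_le_lintegral_div hgm.aemeasurable h0 ENNReal.ofReal_ne_top).trans ?_
    have hJ := aux_J (fun y => ‖φ y‖ₑ) hwm d hdm hd0
    calc (∫⁻ a, g a) / ENNReal.ofReal Λ ≤ (16 * ENNReal.ofReal (3 * I)) / ENNReal.ofReal Λ := by
          gcongr
          refine hJ.trans ?_
          gcongr
      _ = _ := by
          rw [show (16 : ℝ≥0∞) = ENNReal.ofReal 16 by simp, ← ENNReal.ofReal_mul (by norm_num),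
            ← ENNReal.ofReal_div_of_pos hΛ]
          congr 1; ring
  have hInt0 : ∀ q : ℝ → ℝ, (∀ y, q y ≤ ‖φ y‖) → Integrable q → ∫ y, q y ≤ 3 * I := by
    intro q hq hqi
    refine (integral_mono hqi hφi.norm hq).trans ?_
    rw [integral_norm_eq_lintegral_enorm hφm.aestronglyMeasurable]
    exact ENNReal.toReal_le_of_le_ofReal (by positivity) hW
  set E3 := {x : ℝ | ∃ η, 0 < η ∧ Λ ≤ |∫ t, (max (φ (x + t)) 0) * (t / (t ^ 2 + η ^ 2))|} with hE3
  have b3 : volume E3 ≤ ENNReal.ofReal (200 * (Real.pi * ((3 * I) / Λ))) := by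
    refine (hilbert_weak (fun y => max (φ y) 0) hφi.pos_part (fun y => le_max_right _ _) Λ hΛ).trans ?_
    apply ENNReal.ofReal_le_ofReal
    gcongr
    exact hInt0 _ (fun y => max_le (le_abs_self _) (norm_nonneg _)) hφi.pos_part
  set E4 := {x : ℝ | ∃ η, 0 < η ∧ Λ ≤ |∫ t, (max (-φ (x + t)) 0) * (t / (t ^ 2 + η ^ 2))|} with hE4
  have b4 : volume E4 ≤ ENNReal.ofReal (200 * (Real.pi * ((3 * I) / Λ))) := by
    refine (hilbert_weak (fun y => max (-φ y) 0) hφi.neg_part (fun y => le_max_right _ _) Λ hΛ).trans ?_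
    apply ENNReal.ofReal_le_ofReal
    gcongr
    exact hInt0 _ (fun y => max_le (neg_le_abs _) (norm_nonneg _)) hφi.neg_part
  set E5 := {x : ℝ | ¬ ∀ n : ℕ, pvT1 (fun t => (1 / Real.pi) *
    (Real.cos ((n : ℝ) * t) / (2 * Real.tan (t / 2))) * f (x + t)) (U n x)} with hE5
  have b5 : volume E5 = 0 := ae_iff.1 (ae_all_iff.2 hU)
  have hsub : {x : ℝ | x ∈ T1 ∧ lam < bmoSeq (fun n => U n x)} ⊆ E1 ∪ E2 ∪ E3 ∪ E4 ∪ E5 := by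
    rintro x ⟨hxT, hx⟩
    by_contra hcon
    simp only [mem_union, not_or] at hcon
    obtain ⟨⟨⟨⟨n1, n2⟩, n3⟩, n4⟩, n5⟩ := hcon
    have hpv := not_not.1 n5
    have n3' : ∀ η, 0 < η → |∫ t, (max (φ (x + t)) 0) * (t / (t ^ 2 + η ^ 2))| ≤ Λ := by
      intro η hη
      by_contra hc
      exact n3 ⟨η, hη, (not_le.1 hc).le⟩
    have n4' : ∀ η, 0 < η → |∫ t, (max (-φ (x + t)) 0) * (t / (t ^ 2 + η ^ 2))| ≤ Λ := by
      intro η hη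
      by_contra hc
      exact n4 ⟨η, hη, (not_le.1 hc).le⟩
    have n2' : g x ≤ ENNReal.ofReal Λ := (not_le.1 n2).le
    have H := good_of φ d E1ᶜ hφm hφi hsupp Λ hΛ hGs hd x hxT n1 n2' n3' n4'
    have hxT' : -Real.pi ≤ x ∧ x < Real.pi := hxT
    have hU' : ∀ n : ℕ, pvT1 (Gk (fun t => φ (x + t)) (n : ℝ)) (U n x) := by
      intro n
      refine (hpv n).congr fun ε => ?_
      refine setIntegral_congr_fun ?_ ?_
      · exact (measurableSet_lt measurable_const measurable_norm).inter
          (measurableSet_lt measurable_norm measurable_const)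
      · intro t ht
        have ht2 := abs_lt.1 ht.2
        have : φ (x + t) = f (x + t) := indicator_of_mem
          (by constructor <;> linarith [ht2.1, ht2.2, hxT'.1, hxT'.2]) _
        simp only [Gk, this]
    have hb := bmo_bound (fun n => U n x) (15 * Λ) (by positivity)
      (fun a N hN => pointwise H (fun n => U n x) hU' a N hN)
    have : 10 * (15 * Λ) = lam := by rw [hΛd]; ring
    linarith
  refine (measure_mono hsub).trans ?_
  refine (measure_union_le _ _).trans ?_
  rw [b5, add_zero]
  refine (measure_union_le _ _).trans ?_
  refine (add_le_add ((measure_union_le _ _).trans (add_le_add (measure_union_le _ _) le_rfl)) le_rfl).trans ?_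
  refine (add_le_add (add_le_add (add_le_add b1 b2) b3) b4).trans ?_
  rw [← ENNReal.ofReal_add (by positivity) (by positivity), ← ENNReal.ofReal_add (by positivity) (by positivity),
    ← ENNReal.ofReal_add (by positivity) (by positivity)]
  apply ENNReal.ofReal_le_ofReal
  apply le_of_eq
  rw [hΛd]
  field_simp
  ring

/-- Lemma 1: there is an absolute constant `c > 0` such that for every
`f ∈ L¹(𝕋)` and every `λ > 0`, `|{x ∈ 𝕋 : bmo[U_n(x,f)] > λ}| ≤ (c/λ) ∫_𝕋 |f|`, where
`U_n(x,f) = p.v. (1/π) ∫_𝕋 cos(nt)/(2 tan(t/2)) f(x+t) dt` (defined for a.e. `x`). -/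
theorem bmo_weak_type_Un :
    ∃ c : ℝ, 0 < c ∧ ∀ f : ℝ → ℝ, Measurable f → (∀ x : ℝ, f (x + 2 * Real.pi) = f x) →
      IntegrableOn f T1 →
      ∀ U : ℕ → ℝ → ℝ,
        (∀ n : ℕ, ∀ᵐ x : ℝ,
          pvT1 (fun t => (1 / Real.pi) * (Real.cos ((n : ℝ) * t) / (2 * Real.tan (t / 2))) *
            f (x + t)) (U n x)) →
        ∀ lam : ℝ, 0 < lam →
          volume {x : ℝ | x ∈ T1 ∧ lam < bmoSeq (fun n => U n x)} ≤
            ENNReal.ofReal ((c / lam) * ∫ x in T1, |f x|) := by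
  refine ⟨150 * 3 * (26 + 400 * Real.pi), by have := Real.pi_pos; positivity, ?_⟩
  intro f hfm hper hfi U hU lam hlam
  exact main_bound f hfm hper hfi U hU lam hlam
end
end

section
/- There exists an absolute constant c > 0 such that for every f ∈ L log L(𝕋²), ∬_{𝕋²} sup_{n≥1} |S_{nn}(x,y,f) − S*_{nn}(x,y,f)| dx dy ≤ c·(1 + ∬_{𝕋²} |f| log⁺|f|). -/
open MeasureTheory Filter Set

noncomputable section

/-- The quadratic partial sums written via the Dirichlet kernels:
`S_{nn}(x,y,f) = (1/π²) ∬_{𝕋²} [sin((n+1/2)t) sin((n+1/2)s) / (4 sin(t/2) sin(s/2))]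
  f(x+t, y+s) dt ds`. -/
def SnnKer (f : ℝ × ℝ → ℝ) (n : ℕ) (x y : ℝ) : ℝ :=
  (1 / Real.pi ^ 2) *
    ∫ q in T2,
      (Real.sin (((n : ℝ) + 1 / 2) * q.1) * Real.sin (((n : ℝ) + 1 / 2) * q.2) /
          (4 * Real.sin (q.1 / 2) * Real.sin (q.2 / 2))) * f (x + q.1, y + q.2)

lemma abs_im_le_aux (F : ℂ) (hF : 0 < F.re) :
    |F.im| ≤ 2 * (F.im * F.arg) + F.re := by
  have hn : 0 < ‖F‖ := by
    rw [norm_pos_iff]; rintro rfl; simp at hF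
  have h1 := Complex.norm_mul_cos_arg F
  have h2 := Complex.norm_mul_sin_arg F
  have ha : |F.arg| ≤ Real.pi / 2 := Complex.abs_arg_le_pi_div_two_iff.2 hF.le
  have hsgn : F.im * F.arg = |F.im| * |F.arg| := by
    rw [← abs_mul, abs_of_nonneg]
    rcases le_total 0 F.im with h | h
    · exact mul_nonneg h (Complex.arg_nonneg_iff.2 h)
    · rcases h.eq_or_lt with h | h
      · rw [h]; simp
      · exact mul_nonneg_of_nonpos_of_nonpos h.le (Complex.arg_neg_iff.2 h).le
  rw [hsgn]
  by_cases hc : |F.arg| ≤ 1 / 2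
  · have h3 : |Real.sin F.arg| ≤ 1 / 2 := Real.abs_sin_le_abs.trans hc
    have h4 : 1 - F.arg ^ 2 / 2 ≤ Real.cos F.arg := Real.one_sub_sq_div_two_le_cos
    have h5 : F.arg ^ 2 ≤ 1 / 4 := by
      rw [← sq_abs]; nlinarith [abs_nonneg F.arg]
    have h6 : |F.im| ≤ F.re := by
      rw [← h2, ← h1, abs_mul, abs_of_pos hn]
      apply mul_le_mul_of_nonneg_left _ hn.le
      linarith
    have := mul_nonneg (abs_nonneg F.im) (abs_nonneg F.arg)
    linarith
  · push Not at hc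
    nlinarith [abs_nonneg F.im]

/-- Young inequality. -/
lemma young_aux {a b : ℝ} (ha : 0 < a) (hb : 0 < b) :
    a * Real.log b ≤ a * Real.log a + b := by
  have := Real.log_le_sub_one_of_pos (div_pos hb ha)
  rw [Real.log_div hb.ne' ha.ne'] at this
  have h2 := mul_le_mul_of_nonneg_left this ha.le
  have h3 : a * (b / a - 1) = b - a := by field_simp
  nlinarith

def Herg (g : ℂ → ℝ) (w : ℂ) : ℂ :=
  Real.circleAverage (fun ζ ↦ herglotzRieszKernel 0 w ζ • (g ζ : ℂ)) 0 1

lemma Herg_zero {g : ℂ → ℝ} (hg : CircleIntegrable g 0 1) :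
    Herg g 0 = (Real.circleAverage g 0 1 : ℝ) := by
  have h := Complex.ofRealCLM.circleAverage_comp_comm (f := g) (c := 0) (R := 1) hg
  unfold Herg
  simp only [Complex.ofRealCLM_apply] at h
  rw [← h]
  apply Real.circleAverage_congr_sphere
  intro z hz
  have : z ≠ 0 := by
    rintro rfl; simp at hz
  simp [herglotzRieszKernel_def, this]

lemma circleIntegrable_ofReal {g : ℂ → ℝ} {R : ℝ} (hg : CircleIntegrable g 0 R) :
    CircleIntegrable (fun ζ ↦ (g ζ : ℂ)) 0 R := by
  simp only [CircleIntegrable, intervalIntegrable_iff] at hg ⊢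
  exact Complex.ofRealCLM.integrable_comp hg

lemma Herg_diff {g : ℂ → ℝ} (hg : CircleIntegrable g 0 1) :
    DifferentiableOn ℂ (Herg g) (Metric.ball 0 1) :=
  differentiableOn_circleAverage_herglotzRieszKernel_smul (circleIntegrable_ofReal hg)

lemma poisson_cont {w : ℂ} (hw : w ∈ Metric.ball (0:ℂ) 1) :
    ContinuousOn (poissonKernel 0 w) (Metric.sphere 0 |1|) := by
  rw [poissonKernel_eq_re_herglotzRieszKernel]
  exact Complex.continuous_re.comp_continuousOn (continuousOn_herglotzRieszKernel_sphere hw)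

lemma poisson_integrable {g : ℂ → ℝ} (hg : CircleIntegrable g 0 1) {w : ℂ}
    (hw : w ∈ Metric.ball (0:ℂ) 1) :
    CircleIntegrable (fun ζ ↦ poissonKernel 0 w ζ * g ζ) 0 1 := by
  unfold CircleIntegrable at *
  apply IntervalIntegrable.continuousOn_mul hg
  apply Continuous.continuousOn
  apply (poisson_cont hw).comp_continuous (by fun_prop)
  intro x; simp

lemma Herg_re {g : ℂ → ℝ} (hg : CircleIntegrable g 0 1) {w : ℂ} (hw : w ∈ Metric.ball (0:ℂ) 1) :
    (Herg g w).re = Real.circleAverage (fun ζ ↦ poissonKernel 0 w ζ * g ζ) 0 1 := by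
  unfold Herg
  rw [re_circleAverage_herglotzRieszKernel_smul hg hw, poissonKernel_eq_re_herglotzRieszKernel]
  rfl

lemma poisson_avg {w : ℂ} (hw : w ∈ Metric.ball (0:ℂ) 1) :
    Real.circleAverage (poissonKernel 0 w) 0 1 = 1 := by
  have h := DiffContOnCl.circleAverage_poissonKernel_smul (E := ℂ) (f := fun _ => 1) (c := 0) (R := 1)
    (w := w) diffContOnCl_const hw
  have hI : CircleIntegrable (poissonKernel 0 w) 0 1 := by
    have := poisson_integrable (g := fun _ => 1) (by simp [circleIntegrable_const]) hw
    simpa using this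
  have h2 := Complex.ofRealCLM.circleAverage_comp_comm (f := poissonKernel 0 w) (c := 0) (R := 1) hI
  have h3 : (poissonKernel 0 w • fun _ => (1:ℂ)) = fun ζ => Complex.ofRealCLM (poissonKernel 0 w ζ) := by
    ext z; simp
  rw [h3] at h
  change Real.circleAverage (fun ζ => Complex.ofRealCLM (poissonKernel 0 w ζ)) 0 1 = _ at h2
  rw [h2, Complex.ofRealCLM_apply] at h
  exact_mod_cast h

lemma poisson_pos {w z : ℂ} (hw : w ∈ Metric.ball (0:ℂ) 1) (hz : z ∈ Metric.sphere (0:ℂ) |1|) :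
    0 < poissonKernel 0 w z := by
  rw [poissonKernel_def]
  simp at hz hw
  have : z ≠ w := by rintro rfl; linarith
  simp only [sub_zero]
  apply div_pos
  · rw [hz]; nlinarith [norm_nonneg w]
  · have := norm_pos_iff.2 (sub_ne_zero.2 this)
    positivity

lemma herg_core {g : ℂ → ℝ} (hg : CircleIntegrable g 0 1) (h1 : ∀ z, 1 ≤ g z)
    (hgl : CircleIntegrable (fun z => g z * Real.log (g z)) 0 1) {r : ℝ} (hr0 : 0 < r) (hr : r < 1) :
    Real.circleAverage (fun z => |(Herg g z).im|) 0 r ≤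
      30 + 15 * Real.circleAverage (fun z => g z * Real.log (g z)) 0 1 := by
  set A := Real.circleAverage (fun z => g z * Real.log (g z)) 0 1 with hA
  set m := Real.circleAverage g 0 1 with hm
  set W := Herg (fun z => g z * Real.log (g z)) with hW
  set F := Herg g with hF
  have hm1 : 1 ≤ m := by
    have := Real.circleAverage_mono (circleIntegrable_const (1:ℝ) 0 1) hg (fun z _ => h1 z)
    simpa [Real.circleAverage_const] using this
  have hmA : m ≤ 3 + A := by
    have h3 : Real.circleAverage (fun _ => (3:ℝ)) 0 1 = 3 := Real.circleAverage_const _ _ _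
    rw [← h3, hA, hm, ← Real.circleAverage_fun_add (circleIntegrable_const _ _ _) hgl]
    apply Real.circleAverage_mono hg
    · exact (circleIntegrable_const _ _ _).add hgl
    · intro z _
      have := h1 z
      by_cases hz : g z ≤ 3
      · have := mul_nonneg (by linarith : 0 ≤ g z) (Real.log_nonneg this)
        linarith
      · push Not at hz
        have h1l : 1 ≤ Real.log (g z) := by
          rw [Real.le_log_iff_exp_le (by linarith)]
          have := Real.exp_one_lt_d9
          linarith
        nlinarith
  have hFpos : ∀ w ∈ Metric.ball (0:ℂ) 1, 1 ≤ (F w).re := by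
    intro w hw
    rw [hF, Herg_re hg hw]
    refine (poisson_avg hw).symm.le.trans ?_
    have hI : CircleIntegrable (poissonKernel 0 w) 0 1 := by
      have := poisson_integrable (g := fun _ => 1) (by simp [circleIntegrable_const]) hw
      simpa using this
    apply Real.circleAverage_mono hI (poisson_integrable hg hw)
    intro z hz
    nlinarith [poisson_pos hw hz, h1 z]
  have hlog4 : Real.log 4 ≤ 1.4 := by
    have : (4:ℝ) = 2 ^ 2 := by norm_num
    rw [this, Real.log_pow]
    have := Real.log_two_lt_d9
    push_cast; linarith
  have hlog40 : 0 ≤ Real.log 4 := Real.log_nonneg (by norm_num)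
  -- key pointwise bound
  have hyoung : ∀ w ∈ Metric.ball (0:ℂ) 1,
      (F w).re * Real.log (‖F w‖ / 4) ≤ (W w).re + ‖F w‖ / 4 := by
    intro w hw
    have hn : 0 < ‖F w‖ / 4 := by
      have := (hFpos w hw).trans (Complex.re_le_norm _)
      linarith
    set B := ‖F w‖ / 4
    have hI : CircleIntegrable (poissonKernel 0 w) 0 1 := by
      have := poisson_integrable (g := fun _ => 1) (by simp [circleIntegrable_const]) hw
      simpa using this
    have e1 : (F w).re * Real.log B =
        Real.circleAverage (fun ζ ↦ (Real.log B) • (poissonKernel 0 w ζ * g ζ)) 0 1 := by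
      rw [Real.circleAverage_fun_smul, hF, Herg_re hg hw]; simp [mul_comm]
    have e2 : (W w).re + B = Real.circleAverage (fun ζ ↦
        (poissonKernel 0 w ζ * (g ζ * Real.log (g ζ))) + B • poissonKernel 0 w ζ) 0 1 := by
      have h0 := Real.circleAverage_fun_add (poisson_integrable hgl hw) (hI.const_smul (a := B))
      simp only [Pi.smul_apply] at h0
      rw [h0, Real.circleAverage_smul, poisson_avg hw, hW, Herg_re hgl hw]
      simp only [smul_eq_mul, mul_one]
    rw [e1, e2]
    apply Real.circleAverage_mono
    · exact (poisson_integrable hg hw).const_smul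
    · exact (poisson_integrable hgl hw).add (hI.const_smul (a := B))
    · intro z hz
      have := mul_le_mul_of_nonneg_left (young_aux (by linarith [h1 z] : 0 < g z) hn)
        (poisson_pos hw hz).le
      simp only [smul_eq_mul]
      nlinarith
  set G : ℂ → ℂ := fun z => 2 * ((Real.log 4 : ℝ) * F z + W z + F z / 4)
    - 2 * (F z * Complex.log (F z)) + F z with hG
  have hkey : ∀ w ∈ Metric.ball (0:ℂ) 1, |(F w).im| / 2 ≤ (G w).re := by
    intro w hw
    have hp := hFpos w hw
    have a1 := abs_im_le_aux (F w) (by linarith)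
    have a2 := hyoung w hw
    have a3 : ‖F w‖ ≤ (F w).re + |(F w).im| := by
      have := Complex.norm_le_abs_re_add_abs_im (F w)
      rwa [abs_of_pos (by linarith : 0 < (F w).re)] at this
    have hn : 0 < ‖F w‖ := by
      have := (hFpos w hw).trans (Complex.re_le_norm _)
      linarith
    rw [Real.log_div hn.ne' (by norm_num)] at a2
    have e : (G w).re = 2 * (Real.log 4 * (F w).re + (W w).re + (F w).re / 4)
        - 2 * ((F w).re * Real.log ‖F w‖ - (F w).im * (F w).arg) + (F w).re := by
      simp [hG, Complex.log_re, Complex.log_im]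
    rw [e]
    nlinarith
  have hFd : DifferentiableOn ℂ F (Metric.ball 0 1) := Herg_diff hg
  have hWd : DifferentiableOn ℂ W (Metric.ball 0 1) := Herg_diff hgl
  have hGd : DifferentiableOn ℂ G (Metric.ball 0 1) := by
    have : DifferentiableOn ℂ (fun z => Complex.log (F z)) (Metric.ball 0 1) := by
      apply hFd.clog
      intro z hz
      left
      linarith [hFpos z hz]
    simp only [hG]
    fun_prop
  have hsub : Metric.closedBall (0:ℂ) |r| ⊆ Metric.ball 0 1 := by
    rw [abs_of_pos hr0]
    exact Metric.closedBall_subset_ball hr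
  have hsub2 : Metric.sphere (0:ℂ) |r| ⊆ Metric.ball 0 1 :=
    Metric.sphere_subset_closedBall.trans hsub
  have hGavg : Real.circleAverage G 0 r = G 0 := by
    apply circleAverage_of_differentiable_on_off_countable countable_empty
    · exact hGd.continuousOn.mono hsub
    · intro z hz
      exact hGd.differentiableAt (Metric.isOpen_ball.mem_nhds (hsub (Metric.ball_subset_closedBall hz.1)))
  have hGci : CircleIntegrable G 0 r := (hGd.continuousOn.mono hsub2).circleIntegrable'
  have hGre := Complex.reCLM.circleAverage_comp_comm hGci
  rw [hGavg] at hGre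
  have hmain : Real.circleAverage (fun z => |(F z).im| / 2) 0 r ≤ (G 0).re := by
    rw [show (G 0).re = Complex.reCLM (G 0) from rfl, ← hGre]
    apply Real.circleAverage_mono
    · apply ContinuousOn.circleIntegrable'
      have := hFd.continuousOn.mono hsub2
      exact (Complex.continuous_im.comp_continuousOn this).abs.div_const 2
    · apply ContinuousOn.circleIntegrable'
      exact Complex.continuous_re.comp_continuousOn (hGd.continuousOn.mono hsub2)
    · intro z hz
      exact hkey z (hsub2 hz)
  have hF0 : F 0 = (m : ℝ) := Herg_zero hg
  have hW0 : W 0 = (A : ℝ) := Herg_zero hgl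
  have hG0 : (G 0).re = 2 * (Real.log 4 * m + A + m / 4) - 2 * (m * Real.log m) + m := by
    simp [hG, hF0, hW0, Complex.log_re]
  have hml : 0 ≤ m * Real.log m := mul_nonneg (by linarith) (Real.log_nonneg hm1)
  have h2 : Real.circleAverage (fun z => |(F z).im| / 2) 0 r =
      (1/2) * Real.circleAverage (fun z => |(F z).im|) 0 r := by
    rw [← smul_eq_mul, ← Real.circleAverage_fun_smul]
    congr 1; ext z; simp; ring
  rw [h2, hG0] at hmain
  have hA0 : 0 ≤ A := Real.circleAverage_nonneg_of_nonneg (fun z _ =>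
    mul_nonneg (by linarith [h1 z]) (Real.log_nonneg (h1 z)))
  nlinarith

lemma T1_meas : MeasurableSet T1 := measurableSet_Ico

lemma T1_ae : (volume.restrict T1 : Measure ℝ) = volume.restrict (Ioc (-Real.pi) (-Real.pi + 2 * Real.pi)) := by
  unfold T1
  rw [show -Real.pi + 2 * Real.pi = Real.pi by ring]
  exact restrict_Ico_eq_restrict_Ioc

lemma lint_shift {φ : ℝ → ENNReal} (hφ : Function.Periodic φ (2 * Real.pi)) (a : ℝ) :
    ∫⁻ x in T1, φ (x + a) = ∫⁻ x in T1, φ x := by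
  rw [T1_ae]
  have hT : 0 < 2 * Real.pi := Real.two_pi_pos
  have h1 : ∫⁻ x in Ioc (-Real.pi) (-Real.pi + 2 * Real.pi), φ (x + a) =
      ∫⁻ x in Ioc (-Real.pi + a) (-Real.pi + a + 2 * Real.pi), φ x := by
    have h := (measurePreserving_add_right (volume : Measure ℝ) a).setLIntegral_comp_preimage_emb
      (MeasurableEquiv.addRight a).measurableEmbedding φ
      (Ioc (-Real.pi + a) (-Real.pi + a + 2 * Real.pi))
    rw [← h]
    congr 2
    ext x; simp only [mem_Ioc, mem_preimage]
    constructor <;> rintro ⟨h1, h2⟩ <;> constructor <;> linarith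
  rw [h1]
  have : VAddInvariantMeasure (AddSubgroup.zmultiples (2 * Real.pi)) ℝ volume :=
    ⟨fun c s _ => measure_preimage_add _ _ _⟩
  apply IsAddFundamentalDomain.setLIntegral_eq (G := AddSubgroup.zmultiples (2 * Real.pi))
  exacts [isAddFundamentalDomain_Ioc hT _, isAddFundamentalDomain_Ioc hT _, hφ.map_vadd_zmultiples]

lemma int_T1 (φ : ℝ → ℝ) : ∫ x in T1, φ x = ∫ x in (-Real.pi)..(-Real.pi + 2 * Real.pi), φ x := by
  rw [T1_ae, intervalIntegral.integral_of_le (by linarith [Real.pi_pos])]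

lemma int_shift {φ : ℝ → ℝ} (hφ : Function.Periodic φ (2 * Real.pi)) (a : ℝ) :
    ∫ x in T1, φ (x + a) = ∫ x in T1, φ x := by
  rw [int_T1, int_T1, intervalIntegral.integral_comp_add_right,
    show -Real.pi + 2 * Real.pi + a = (-Real.pi + a) + 2 * Real.pi by ring,
    hφ.intervalIntegral_add_eq]

lemma int_zero_two_pi {φ : ℝ → ℝ} (hφ : Function.Periodic φ (2 * Real.pi)) :
    ∫ x in (0:ℝ)..(2 * Real.pi), φ x = ∫ x in T1, φ x := by
  have h := hφ.intervalIntegral_add_eq 0 (-Real.pi)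
  rw [zero_add] at h
  rw [int_T1, h]

lemma intble_iff {φ : ℝ → ℝ} (hφ : Function.Periodic φ (2 * Real.pi)) :
    IntervalIntegrable φ volume 0 (2 * Real.pi) ↔ IntegrableOn φ T1 := by
  have h := hφ.intervalIntegrable_iff (t₁ := 0) (t₂ := -Real.pi)
  rw [zero_add] at h
  rw [h, intervalIntegrable_iff_integrableOn_Ioc_of_le (by linarith [Real.pi_pos]), IntegrableOn,
    IntegrableOn, T1_ae]

lemma intble_shift {φ : ℝ → ℝ} (hφ : Function.Periodic φ (2 * Real.pi)) (h : IntegrableOn φ T1) (a : ℝ) :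
    IntegrableOn (fun x => φ (x + a)) T1 := by
  have hp : Function.Periodic (fun x => φ (x + a)) (2 * Real.pi) := by
    intro x
    have := hφ (x + a)
    simp only
    rw [← this]; ring_nf
  rw [← intble_iff hp]
  rw [← intble_iff hφ] at h
  have h2 := hφ.intervalIntegrable₀ Real.two_pi_pos.ne' h a (2 * Real.pi + a)
  have := h2.comp_add_right a
  simpa using this

def Qk (r t : ℝ) : ℝ := 2 * r * Real.sin t / (1 - 2 * r * Real.cos t + r ^ 2)

lemma Qk_den {r : ℝ} (hr0 : 0 < r) (hr : r < 1) (t : ℝ) : 0 < 1 - 2 * r * Real.cos t + r ^ 2 := by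
  nlinarith [Real.cos_le_one t]

lemma Qk_cont {r : ℝ} (hr0 : 0 < r) (hr : r < 1) : Continuous (Qk r) := by
  unfold Qk
  apply Continuous.div (by fun_prop) (by fun_prop)
  intro t; exact (Qk_den hr0 hr t).ne'

lemma Qk_bdd {r : ℝ} (hr0 : 0 < r) (hr : r < 1) (t : ℝ) : |Qk r t| ≤ 2 / (1 - r) ^ 2 := by
  unfold Qk
  rw [abs_div, abs_of_pos (Qk_den hr0 hr t)]
  have h1 : (0:ℝ) < (1 - r) ^ 2 := by nlinarith
  apply div_le_div₀ (by norm_num) _ h1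
  · nlinarith [Real.cos_le_one t]
  · rw [abs_mul, abs_of_pos (by linarith : 0 < 2 * r)]
    nlinarith [Real.abs_sin_le_one t, abs_nonneg (Real.sin t)]

lemma Qk_per (r : ℝ) : Function.Periodic (Qk r) (2 * Real.pi) := by
  intro t; simp [Qk]

lemma Qk_intble {r : ℝ} (hr0 : 0 < r) (hr : r < 1) {g : ℝ → ℝ} (hg : Function.Periodic g (2 * Real.pi))
    (hi : IntegrableOn g T1) (θ : ℝ) : IntegrableOn (fun t => Qk r t * g (θ + t)) T1 := by
  have h := intble_shift hg hi θ
  simp_rw [add_comm θ]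
  exact Integrable.bdd_mul h (Qk_cont hr0 hr).aestronglyMeasurable
    (ae_of_all _ (Qk_bdd hr0 hr))

lemma herg_im_kernel {r : ℝ} (θ s : ℝ) :
    (herglotzRieszKernel 0 (circleMap 0 r θ) (circleMap 0 1 s)).im = Qk r (θ - s) := by
  have e1 : circleMap 0 r θ = ⟨r * Real.cos θ, r * Real.sin θ⟩ := by
    apply Complex.ext <;> simp [circleMap, Complex.exp_ofReal_mul_I_re, Complex.exp_ofReal_mul_I_im]
  have e2 : circleMap 0 1 s = ⟨Real.cos s, Real.sin s⟩ := by
    apply Complex.ext <;> simp [circleMap, Complex.exp_ofReal_mul_I_re, Complex.exp_ofReal_mul_I_im]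
  rw [herglotzRieszKernel_def, e1, e2, Complex.div_im, Qk, Real.sin_sub, Real.cos_sub]
  simp only [Complex.normSq_apply, Complex.add_re, Complex.sub_re, Complex.add_im, Complex.sub_im,
    Complex.zero_re, Complex.zero_im, sub_zero]
  have hs := Real.sin_sq_add_cos_sq s
  have ht := Real.sin_sq_add_cos_sq θ
  have hd : (Real.cos s - r * Real.cos θ) * (Real.cos s - r * Real.cos θ) +
      (Real.sin s - r * Real.sin θ) * (Real.sin s - r * Real.sin θ) =
      1 - 2 * r * (Real.cos θ * Real.cos s + Real.sin θ * Real.sin s) + r ^ 2 := by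
    linear_combination hs + r ^ 2 * ht
  rw [hd, ← sub_div]
  congr 1
  ring

lemma conj_core {h : ℝ → ℝ} (hp : Function.Periodic h (2 * Real.pi)) (h1 : ∀ x, 1 ≤ h x)
    (hi : IntegrableOn h T1) (hl : IntegrableOn (fun x => h x * Real.log (h x)) T1)
    {r : ℝ} (hr0 : 0 < r) (hr : r < 1) :
    ∫⁻ θ in T1, ENNReal.ofReal |∫ t in T1, Qk r t * h (θ + t)| ≤
      ENNReal.ofReal (120 * Real.pi ^ 2 + 30 * Real.pi * ∫ x in T1, h x * Real.log (h x)) := by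
  set g : ℂ → ℝ := fun z => h z.arg with hg
  have hgc : ∀ s : ℝ, g (circleMap 0 1 s) = h s := by
    intro s
    simp only [hg, circleMap, zero_add, Complex.ofReal_one, one_mul, Complex.arg_exp_mul_I]
    rw [toIocMod]
    exact hp.sub_zsmul_eq _
  have hpl : Function.Periodic (fun x => h x * Real.log (h x)) (2 * Real.pi) := by
    intro x; simp only [hp x]
  have hgi : CircleIntegrable g 0 1 := by
    unfold CircleIntegrable; simp_rw [hgc]; exact (intble_iff hp).2 hi
  have hgl : CircleIntegrable (fun z => g z * Real.log (g z)) 0 1 := by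
    unfold CircleIntegrable; simp_rw [hgc]; exact (intble_iff hpl).2 hl
  have core := herg_core hgi (fun z => h1 _) hgl hr0 hr
  have hA : Real.circleAverage (fun z => g z * Real.log (g z)) 0 1 =
      (2 * Real.pi)⁻¹ * ∫ x in T1, h x * Real.log (h x) := by
    rw [Real.circleAverage_def]
    simp_rw [hgc]
    rw [int_zero_two_pi hpl, smul_eq_mul]
  have hball : ∀ θ, circleMap 0 r θ ∈ Metric.ball (0:ℂ) 1 := by
    intro θ; simp [abs_of_pos hr0, hr]
  have him : ∀ θ, (Herg g (circleMap 0 r θ)).im = - ((2 * Real.pi)⁻¹ * ∫ t in T1, Qk r t * h (θ + t)) := by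
    intro θ
    have hci : CircleIntegrable (fun ζ ↦ herglotzRieszKernel 0 (circleMap 0 r θ) ζ • (g ζ : ℂ)) 0 1 := by
      have h0 := circleIntegrable_ofReal hgi
      unfold CircleIntegrable at *
      apply IntervalIntegrable.continuousOn_mul h0
      apply Continuous.continuousOn
      apply (continuousOn_herglotzRieszKernel_sphere (hball θ)).comp_continuous (by fun_prop)
      intro x; simp
    have hc := Complex.imCLM.circleAverage_comp_comm hci
    change _ = (Herg g (circleMap 0 r θ)).im at hc
    rw [← hc, Real.circleAverage_def]
    have e : ∀ s, (⇑Complex.imCLM ∘ fun ζ ↦ herglotzRieszKernel 0 (circleMap 0 r θ) ζ • (g ζ : ℂ))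
        (circleMap 0 1 s) = Qk r (θ - s) * h s := by
      intro s
      simp only [Function.comp, Complex.imCLM_apply, smul_eq_mul, Complex.im_mul_ofReal,
        herg_im_kernel, hgc]
    simp_rw [e]
    have hpp : Function.Periodic (fun s => Qk r (θ - s) * h s) (2 * Real.pi) := by
      intro s
      simp only [hp s]
      rw [show θ - (s + 2 * Real.pi) = θ - s - 2 * Real.pi by ring, (Qk_per r).sub_eq]
    rw [int_zero_two_pi hpp, ← int_shift hpp θ, smul_eq_mul, ← mul_neg, ← integral_neg]
    congr 2
    ext t
    rw [show θ - (t + θ) = -t by ring, add_comm t θ]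
    simp [Qk]; ring
  have hcont : Continuous (fun θ => |∫ t in T1, Qk r t * h (θ + t)|) := by
    have e : (fun θ => |∫ t in T1, Qk r t * h (θ + t)|) =
        fun θ => 2 * Real.pi * |(Herg g (circleMap 0 r θ)).im| := by
      ext θ
      rw [him, abs_neg, abs_mul, abs_of_pos (by positivity : 0 < (2 * Real.pi)⁻¹)]
      field_simp
    rw [e]
    have : Continuous fun θ => Herg g (circleMap 0 r θ) :=
      (Herg_diff hgi).continuousOn.comp_continuous (by fun_prop) hball
    fun_prop
  have hper : Function.Periodic (fun θ => |∫ t in T1, Qk r t * h (θ + t)|) (2 * Real.pi) := by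
    intro θ
    simp only
    congr 3
    ext t
    rw [show θ + 2 * Real.pi + t = θ + t + 2 * Real.pi by ring, hp]
  rw [← ofReal_integral_eq_lintegral_ofReal]
  · apply ENNReal.ofReal_le_ofReal
    rw [Real.circleAverage_def] at core
    simp_rw [him, abs_neg, abs_mul] at core
    rw [intervalIntegral.integral_const_mul, int_zero_two_pi hper, hA, smul_eq_mul,
      abs_of_pos (by positivity : 0 < (2 * Real.pi)⁻¹)] at core
    set X := ∫ x in T1, |∫ t in T1, Qk r t * h (x + t)|
    set Y := ∫ x in T1, h x * Real.log (h x)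
    have hpi := Real.pi_pos
    have := mul_le_mul_of_nonneg_left core (by positivity : 0 ≤ (2 * Real.pi) ^ 2)
    have e1 : (2 * Real.pi) ^ 2 * ((2 * Real.pi)⁻¹ * ((2 * Real.pi)⁻¹ * X)) = X := by field_simp
    have e2 : (2 * Real.pi) ^ 2 * (30 + 15 * ((2 * Real.pi)⁻¹ * Y)) = 120 * Real.pi ^ 2 + 30 * Real.pi * Y := by
      field_simp; ring
    linarith
  · exact (hcont.integrableOn_Icc (a := -Real.pi) (b := Real.pi)).mono_set Ico_subset_Icc_self
  · exact ae_of_all _ fun _ => abs_nonneg _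

lemma logPlus_nonneg (u : ℝ) : 0 ≤ logPlus u := by
  unfold logPlus; split_ifs with h
  · exact Real.log_nonneg h.le
  · exact le_rfl

lemma logPlus_meas : Measurable logPlus := by
  unfold logPlus
  exact Measurable.ite measurableSet_Ioi Real.measurable_log measurable_const

lemma le_logPlus {u : ℝ} (hu : 0 ≤ u) : u ≤ 3 + u * logPlus u := by
  by_cases hz : u ≤ 3
  · have := mul_nonneg hu (logPlus_nonneg u)
    linarith
  · push Not at hz
    have h1l : 1 ≤ logPlus u := by
      rw [logPlus, if_pos (by linarith), Real.le_log_iff_exp_le (by linarith)]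
      have := Real.exp_one_lt_d9
      linarith
    nlinarith

lemma log_aux {u h : ℝ} (h1 : 1 ≤ h) (h2 : h ≤ u + 1) :
    h * Real.log h ≤ 5 + 4 * (u * logPlus u) := by
  have hu : 0 ≤ u := by linarith
  have l2 := Real.log_two_lt_d9
  have l20 : 0 < Real.log 2 := Real.log_pos (by norm_num)
  have hlh : 0 ≤ Real.log h := Real.log_nonneg h1
  by_cases hc : u ≤ 1
  · have a : Real.log h ≤ Real.log 2 := Real.log_le_log (by linarith) (by linarith)
    have := mul_nonneg hu (logPlus_nonneg u)
    nlinarith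
  · push Not at hc
    have a : Real.log h ≤ Real.log 2 + Real.log u := by
      rw [← Real.log_mul (by norm_num) (by linarith)]
      exact Real.log_le_log (by linarith) (by linarith)
    have b := le_logPlus hu
    have e : logPlus u = Real.log u := by rw [logPlus, if_pos hc]
    rw [e] at b ⊢
    have lu : 0 < Real.log u := Real.log_pos hc
    have : h * Real.log h ≤ (2 * u) * (Real.log 2 + Real.log u) := by
      apply mul_le_mul (by linarith) a hlh (by linarith)
    nlinarith

lemma T1_vol : (volume T1 : ENNReal) = ENNReal.ofReal (2 * Real.pi) := by
  unfold T1; rw [Real.volume_Ico]; congr 1; ring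

instance T1_fin : IsFiniteMeasure (volume.restrict T1 : Measure ℝ) :=
  ⟨by rw [Measure.restrict_apply_univ, T1_vol]; exact ENNReal.ofReal_lt_top⟩

lemma conj_LlogL : ∃ C : ℝ, 0 < C ∧ ∀ r : ℝ, 0 < r → r < 1 → ∀ g : ℝ → ℝ, Measurable g →
    Function.Periodic g (2 * Real.pi) →
    ∫⁻ θ in T1, ENNReal.ofReal |∫ t in T1, Qk r t * g (θ + t)| ≤
      ENNReal.ofReal C * (1 + ∫⁻ x in T1, ENNReal.ofReal (|g x| * logPlus |g x|)) := by
  refine ⟨840 * Real.pi ^ 2 + 240 * Real.pi, by positivity, ?_⟩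
  intro r hr0 hr g hgm hgp
  by_cases htop : ∫⁻ x in T1, ENNReal.ofReal (|g x| * logPlus |g x|) = ⊤
  · rw [htop]
    have : ENNReal.ofReal (840 * Real.pi ^ 2 + 240 * Real.pi) ≠ 0 := by
      rw [Ne, ENNReal.ofReal_eq_zero, not_le]; positivity
    simp [ENNReal.mul_top this]
  set Φ : ℝ → ℝ := fun x => |g x| * logPlus |g x| with hΦ
  have hΦ0 : ∀ x, 0 ≤ Φ x := fun x => mul_nonneg (abs_nonneg _) (logPlus_nonneg _)
  have hΦm : Measurable Φ := by
    have := logPlus_meas.comp hgm.abs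
    exact hgm.abs.mul this
  have hΦi : IntegrableOn Φ T1 := by
    refine ⟨hΦm.aestronglyMeasurable, ?_⟩
    rw [hasFiniteIntegral_iff_ofReal (ae_of_all _ hΦ0)]
    exact lt_top_iff_ne_top.2 htop
  have hconst : ∀ c : ℝ, IntegrableOn (fun _ => c) T1 := fun c => integrable_const c
  -- bound for one piece
  have piece : ∀ h : ℝ → ℝ, Measurable h → Function.Periodic h (2 * Real.pi) → (∀ x, 1 ≤ h x) →
      (∀ x, h x ≤ |g x| + 1) → IntegrableOn h T1 ∧
      ∫⁻ θ in T1, ENNReal.ofReal |∫ t in T1, Qk r t * h (θ + t)| ≤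
      ENNReal.ofReal (420 * Real.pi ^ 2 + 120 * Real.pi * ∫ x in T1, Φ x) := by
    intro h hm hp h1 h2
    have hi : IntegrableOn h T1 := by
      apply Integrable.mono' ((hconst 4).add hΦi) hm.aestronglyMeasurable
      apply ae_of_all
      intro x
      have := le_logPlus (abs_nonneg (g x))
      rw [Real.norm_of_nonneg (by linarith [h1 x])]
      simp only [Pi.add_apply, hΦ]
      linarith [h2 x]
    have hb : IntegrableOn (fun x => 5 + 4 * Φ x) T1 := (hconst 5).add (hΦi.const_mul 4)
    have hl : IntegrableOn (fun x => h x * Real.log (h x)) T1 := by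
      apply Integrable.mono' hb (hm.mul hm.log).aestronglyMeasurable
      apply ae_of_all
      intro x
      simp only [Pi.mul_apply]
      rw [Real.norm_of_nonneg (mul_nonneg (by linarith [h1 x]) (Real.log_nonneg (h1 x)))]
      exact log_aux (h1 x) (h2 x)
    refine ⟨hi, (conj_core hp h1 hi hl hr0 hr).trans ?_⟩
    apply ENNReal.ofReal_le_ofReal
    have : ∫ x in T1, h x * Real.log (h x) ≤ ∫ x in T1, (5 + 4 * Φ x) :=
      integral_mono hl hb (fun x => log_aux (h1 x) (h2 x))
    rw [integral_add (hconst 5) (hΦi.const_mul 4), integral_const_mul] at this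
    have e : ∫ x in T1, (5:ℝ) = 10 * Real.pi := by
      rw [integral_const, smul_eq_mul, Measure.real, Measure.restrict_apply_univ, T1_vol,
        ENNReal.toReal_ofReal (by positivity)]; ring
    rw [e] at this
    nlinarith [Real.pi_pos]
  set h1 : ℝ → ℝ := fun x => max (g x) 0 + 1
  set h2 : ℝ → ℝ := fun x => max (-g x) 0 + 1
  obtain ⟨i1, b1⟩ := piece h1 ((hgm.max measurable_const).add_const 1)
    (by intro x; simp only [h1, hgp x]) (fun x => by simp [h1])
    (fun x => by simp [h1, le_abs_self])
  obtain ⟨i2, b2⟩ := piece h2 ((hgm.neg.max measurable_const).add_const 1)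
    (by intro x; simp only [h2, hgp x]) (fun x => by simp [h2])
    (fun x => by simp [h2, neg_le_abs])
  have p1 : Function.Periodic h1 (2 * Real.pi) := by intro x; simp only [h1, hgp x]
  have p2 : Function.Periodic h2 (2 * Real.pi) := by intro x; simp only [h2, hgp x]
  have hle : ∀ θ, |∫ t in T1, Qk r t * g (θ + t)| ≤
      |∫ t in T1, Qk r t * h1 (θ + t)| + |∫ t in T1, Qk r t * h2 (θ + t)| := by
    intro θ
    have : ∫ t in T1, Qk r t * g (θ + t) =
        (∫ t in T1, Qk r t * h1 (θ + t)) - ∫ t in T1, Qk r t * h2 (θ + t) := by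
      rw [← integral_sub (Qk_intble hr0 hr p1 i1 θ) (Qk_intble hr0 hr p2 i2 θ)]
      congr 1; ext t
      rw [← mul_sub]; congr 1
      simp only [h1, h2]
      rcases le_total 0 (g (θ + t)) with h | h
      · rw [max_eq_left h, max_eq_right (by linarith)]; ring
      · rw [max_eq_right h, max_eq_left (by linarith)]; ring
    rw [this]
    exact abs_sub _ _
  have hmeas : Measurable (fun θ => ENNReal.ofReal |∫ t in T1, Qk r t * h1 (θ + t)|) := by
    apply ENNReal.measurable_ofReal.comp
    apply Measurable.abs
    apply StronglyMeasurable.measurable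
    apply StronglyMeasurable.integral_prod_right (f := fun θ t => Qk r t * h1 (θ + t))
    apply Measurable.stronglyMeasurable
    have : Measurable h1 := (hgm.max measurable_const).add_const 1
    have := (Qk_cont hr0 hr).measurable
    simp only [Function.uncurry_def]
    fun_prop
  calc ∫⁻ θ in T1, ENNReal.ofReal |∫ t in T1, Qk r t * g (θ + t)|
      ≤ ∫⁻ θ in T1, (ENNReal.ofReal |∫ t in T1, Qk r t * h1 (θ + t)| +
          ENNReal.ofReal |∫ t in T1, Qk r t * h2 (θ + t)|) := by
        apply lintegral_mono
        intro θ
        simp only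
        rw [← ENNReal.ofReal_add (abs_nonneg _) (abs_nonneg _)]
        exact ENNReal.ofReal_le_ofReal (hle θ)
    _ = _ := lintegral_add_left hmeas _
    _ ≤ _ := add_le_add b1 b2
    _ ≤ _ := by
        have hI0 : 0 ≤ ∫ x in T1, Φ x := integral_nonneg hΦ0
        rw [← ofReal_integral_eq_lintegral_ofReal hΦi (ae_of_all _ hΦ0), ← ENNReal.ofReal_one,
          ← ENNReal.ofReal_add (by norm_num) hI0, ← ENNReal.ofReal_mul (by positivity),
          ← ENNReal.ofReal_add (by positivity) (by positivity)]
        apply ENNReal.ofReal_le_ofReal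
        nlinarith [Real.pi_pos, mul_nonneg (sq_nonneg Real.pi) hI0]

/-- Directional conjugate Poisson integral. -/
def Hd (r σ : ℝ) (f : ℝ × ℝ → ℝ) (x y : ℝ) : ℝ := ∫ t in T1, Qk r t * f (x + t, y + σ * t)

lemma Hd_meas {r : ℝ} (hr0 : 0 < r) (hr : r < 1) (σ : ℝ) {f : ℝ × ℝ → ℝ} (hf : Measurable f) :
    Measurable (Function.uncurry (Hd r σ f)) := by
  apply StronglyMeasurable.measurable
  unfold Hd
  simp only [Function.uncurry_def]
  apply StronglyMeasurable.integral_prod_right (f := fun (p : ℝ × ℝ) t => Qk r t * f (p.1 + t, p.2 + σ * t))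
  apply Measurable.stronglyMeasurable
  have := (Qk_cont hr0 hr).measurable
  simp only [Function.uncurry_def]
  fun_prop

lemma Hd_per (r σ : ℝ) {f : ℝ × ℝ → ℝ} (hp : Biperiodic f) (x : ℝ) :
    Function.Periodic (Hd r σ f x) (2 * Real.pi) := by
  intro y
  unfold Hd
  congr 1; ext t
  rw [show y + 2 * Real.pi + σ * t = y + σ * t + 2 * Real.pi by ring, (hp _ _).2]

lemma diag_per {σ : ℝ} (hσ : σ = 1 ∨ σ = -1) {f : ℝ × ℝ → ℝ} (hp : Biperiodic f) (y : ℝ) :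
    Function.Periodic (fun w => f (w, y + σ * w)) (2 * Real.pi) := by
  intro w
  simp only
  rw [(hp _ _).1]
  rcases hσ with rfl | rfl
  · rw [show y + 1 * (w + 2 * Real.pi) = y + 1 * w + 2 * Real.pi by ring, (hp _ _).2]
  · rw [← (hp w (y + -1 * (w + 2 * Real.pi))).2]; congr 2; ring

lemma Hd_bound : ∃ C : ℝ, 0 < C ∧ ∀ r : ℝ, 0 < r → r < 1 → ∀ σ : ℝ, (σ = 1 ∨ σ = -1) →
    ∀ f : ℝ × ℝ → ℝ, Measurable f → Biperiodic f →
    ∫⁻ x in T1, ∫⁻ y in T1, ENNReal.ofReal |Hd r σ f x y| ≤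
      ENNReal.ofReal C * (ENNReal.ofReal (2 * Real.pi) +
        ∫⁻ x in T1, ∫⁻ y in T1, ENNReal.ofReal (|f (x, y)| * logPlus |f (x, y)|)) := by
  obtain ⟨C, hC, h⟩ := conj_LlogL
  refine ⟨C, hC, ?_⟩
  intro r hr0 hr σ hσ f hf hp
  have hm1 : Measurable (fun p : ℝ × ℝ => ENNReal.ofReal |Hd r σ f p.1 p.2|) :=
    ENNReal.measurable_ofReal.comp (Hd_meas hr0 hr σ hf).abs
  have hΦm : Measurable (fun p : ℝ × ℝ => ENNReal.ofReal (|f p| * logPlus |f p|)) :=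
    ENNReal.measurable_ofReal.comp (hf.abs.mul (logPlus_meas.comp hf.abs))
  calc ∫⁻ x in T1, ∫⁻ y in T1, ENNReal.ofReal |Hd r σ f x y|
      = ∫⁻ x in T1, ∫⁻ y in T1, ENNReal.ofReal |Hd r σ f x (y + σ * x)| := by
        congr 1; ext x
        rw [lint_shift (φ := fun y => ENNReal.ofReal |Hd r σ f x y|)]
        intro y; simp only [Hd_per r σ hp x y]
    _ = ∫⁻ y in T1, ∫⁻ x in T1, ENNReal.ofReal |Hd r σ f x (y + σ * x)| := by
        apply lintegral_lintegral_swap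
        apply Measurable.aemeasurable
        exact hm1.comp (by fun_prop : Measurable fun p : ℝ × ℝ => (p.1, p.2 + σ * p.1))
    _ ≤ ∫⁻ y in T1, ENNReal.ofReal C * (1 + ∫⁻ x in T1,
          ENNReal.ofReal (|f (x, y + σ * x)| * logPlus |f (x, y + σ * x)|)) := by
        apply lintegral_mono
        intro y
        refine le_trans (le_of_eq ?_) (h r hr0 hr (fun w => f (w, y + σ * w)) (by fun_prop)
          (diag_per hσ hp y))
        apply lintegral_congr
        intro x
        unfold Hd
        congr 3; ext t
        congr 3; ring
    _ = ENNReal.ofReal C * (ENNReal.ofReal (2 * Real.pi) + ∫⁻ y in T1, ∫⁻ x in T1,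
          ENNReal.ofReal (|f (x, y + σ * x)| * logPlus |f (x, y + σ * x)|)) := by
        rw [lintegral_const_mul' _ _ ENNReal.ofReal_ne_top, lintegral_add_left measurable_const,
          lintegral_const, Measure.restrict_apply_univ, T1_vol, one_mul]
    _ = ENNReal.ofReal C * (ENNReal.ofReal (2 * Real.pi) + ∫⁻ x in T1, ∫⁻ y in T1,
          ENNReal.ofReal (|f (x, y + σ * x)| * logPlus |f (x, y + σ * x)|)) := by
        congr 2
        apply lintegral_lintegral_swap
        apply Measurable.aemeasurable
        exact hΦm.comp (by fun_prop : Measurable fun p : ℝ × ℝ => (p.2, p.1 + σ * p.2))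
    _ = _ := by
        congr 2
        congr 1; ext x
        rw [lint_shift (φ := fun y => ENNReal.ofReal (|f (x, y)| * logPlus |f (x, y)|))]
        intro y; simp only [(hp x y).2]

lemma T2_restrict : (volume.restrict T2 : Measure (ℝ × ℝ)) =
    (volume.restrict T1).prod (volume.restrict T1) := by
  unfold T2; rw [Measure.volume_eq_prod, Measure.prod_restrict]

lemma lint_sheared {φ : ℝ × ℝ → ENNReal} (hm : Measurable φ)
    (hp : ∀ x y, φ (x + 2 * Real.pi, y) = φ (x, y) ∧ φ (x, y + 2 * Real.pi) = φ (x, y)) (σ x y : ℝ) :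
    ∫⁻ q in T2, φ (x + q.1, y + q.2 + σ * q.1) = ∫⁻ q in T2, φ q := by
  rw [T2_restrict, lintegral_prod _ (by fun_prop), lintegral_prod _ (by fun_prop)]
  simp only
  have e1 : ∀ t, ∫⁻ s in T1, φ (x + t, y + s + σ * t) = ∫⁻ s in T1, φ (x + t, s) := by
    intro t
    have := lint_shift (φ := fun s => φ (x + t, s)) (fun s => (hp _ _).2) (y + σ * t)
    rw [← this]
    congr 1; ext s
    congr 2; ring
  simp_rw [e1]
  have := lint_shift (φ := fun t => ∫⁻ s in T1, φ (t, s)) (fun t => by simp only [(hp _ _).1]) x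
  rw [← this]
  simp_rw [add_comm x]

lemma f_sheared {f : ℝ × ℝ → ℝ} (hf : Measurable f) (hp : Biperiodic f) (hi : IntegrableOn f T2)
    (σ x y : ℝ) : IntegrableOn (fun q : ℝ × ℝ => f (x + q.1, y + q.2 + σ * q.1)) T2 := by
  refine ⟨(hf.comp (by fun_prop)).aestronglyMeasurable, ?_⟩
  have h := hi.2
  rw [hasFiniteIntegral_iff_enorm] at h ⊢
  rw [lint_sheared (φ := fun q => ‖f q‖ₑ) hf.enorm
    (fun a b => by simp only [(hp a b).1, (hp a b).2, and_self]) σ x y]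
  exact h

lemma f_shift {f : ℝ × ℝ → ℝ} (hf : Measurable f) (hp : Biperiodic f) (hi : IntegrableOn f T2)
    (x y : ℝ) : IntegrableOn (fun q : ℝ × ℝ => f (x + q.1, y + q.2)) T2 := by
  simpa using f_sheared hf hp hi 0 x y

lemma diag_swap {r : ℝ} (hr0 : 0 < r) (hr : r < 1) {σ : ℝ} {f : ℝ × ℝ → ℝ}
    (hf : Measurable f) (hp : Biperiodic f) (hi : IntegrableOn f T2) (n : ℕ) (x y : ℝ) :
    IntegrableOn (fun q : ℝ × ℝ =>
      (Qk r q.1 * Real.sin (n * (q.2 - σ * q.1))) * f (x + q.1, y + q.2)) T2 ∧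
    ∫ q in T2, (Qk r q.1 * Real.sin (n * (q.2 - σ * q.1))) * f (x + q.1, y + q.2) =
      ∫ v in T1, Real.sin (n * v) * Hd r σ f x (y + v) := by
  have hQ := Qk_cont hr0 hr
  have hb : ∀ t u : ℝ, ‖Qk r t * Real.sin u‖ ≤ 2 / (1 - r) ^ 2 := by
    intro t u
    rw [Real.norm_eq_abs, abs_mul]
    exact (mul_le_of_le_one_right (abs_nonneg _) (Real.abs_sin_le_one _)).trans (Qk_bdd hr0 hr t)
  have I1 : IntegrableOn (fun q : ℝ × ℝ =>
      (Qk r q.1 * Real.sin (n * (q.2 - σ * q.1))) * f (x + q.1, y + q.2)) T2 := by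
    refine Integrable.bdd_mul (f_shift hf hp hi x y) (Continuous.aestronglyMeasurable (by fun_prop))
      (ae_of_all _ fun q => hb _ _)
  have I2 : IntegrableOn (fun q : ℝ × ℝ =>
      (Qk r q.1 * Real.sin (n * q.2)) * f (x + q.1, y + q.2 + σ * q.1)) T2 := by
    refine Integrable.bdd_mul (f_sheared hf hp hi σ x y) (Continuous.aestronglyMeasurable (by fun_prop))
      (ae_of_all _ fun q => hb _ _)
  refine ⟨I1, ?_⟩
  unfold IntegrableOn at I1 I2
  rw [T2_restrict] at I1 I2 ⊢
  rw [integral_prod _ I1]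
  have e1 : ∀ t, ∫ s in T1, (Qk r t * Real.sin (n * (s - σ * t))) * f (x + t, y + s) =
      ∫ v in T1, (Qk r t * Real.sin (n * v)) * f (x + t, y + v + σ * t) := by
    intro t
    rw [← int_shift (φ := fun s => (Qk r t * Real.sin (n * (s - σ * t))) * f (x + t, y + s)) _ (σ * t)]
    · congr 1; ext s
      congr 3
      · ring
      · ring_nf
    · intro s
      simp only
      rw [← add_assoc, (hp _ _).2]
      congr 2
      rw [show (n:ℝ) * (s + 2 * Real.pi - σ * t) = n * (s - σ * t) + n * (2 * Real.pi) by ring,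
        Real.sin_add_nat_mul_two_pi]
  simp only
  simp_rw [e1]
  rw [integral_integral_swap (f := fun t v => (Qk r t * Real.sin (n * v)) * f (x + t, y + v + σ * t)) I2]
  congr 1; ext v
  unfold Hd
  rw [← integral_const_mul]
  congr 1; ext t
  ring

/-- The majorant. -/
def Mr (r : ℝ) (f : ℝ × ℝ → ℝ) (x : ℝ) : ENNReal :=
  (∫⁻ v in T1, ENNReal.ofReal |Hd r (-1) f x v|) + ∫⁻ v in T1, ENNReal.ofReal |Hd r 1 f x v|

lemma ofReal_abs_int_le {α : Type*} [MeasurableSpace α] (μ : Measure α) (g : α → ℝ) :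
    ENNReal.ofReal |∫ x, g x ∂μ| ≤ ∫⁻ x, ENNReal.ofReal |g x| ∂μ := by
  have := enorm_integral_le_lintegral_enorm (μ := μ) g
  simpa [← ofReal_norm, Real.norm_eq_abs] using this

lemma diag_le {r : ℝ} {σ : ℝ} {f : ℝ × ℝ → ℝ} (hp : Biperiodic f) (n : ℕ) (x y : ℝ) :
    ENNReal.ofReal |∫ v in T1, Real.sin (n * v) * Hd r σ f x (y + v)| ≤
      ∫⁻ v in T1, ENNReal.ofReal |Hd r σ f x v| := by
  refine (ofReal_abs_int_le _ _).trans ?_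
  rw [← lint_shift (φ := fun v => ENNReal.ofReal |Hd r σ f x v|)
    (fun v => by simp only [Hd_per r σ hp x v]) y]
  apply lintegral_mono
  intro v
  simp only
  apply ENNReal.ofReal_le_ofReal
  rw [abs_mul, add_comm v y]
  exact mul_le_of_le_one_left (abs_nonneg _) (Real.abs_sin_le_one _)

lemma J_bound {r : ℝ} (hr0 : 0 < r) (hr : r < 1) {f : ℝ × ℝ → ℝ}
    (hf : Measurable f) (hp : Biperiodic f) (hi : IntegrableOn f T2) (n : ℕ) (x y : ℝ) :
    ENNReal.ofReal |∫ q in T2, (Real.sin (n * q.1) * Qk r q.1) * Real.cos (n * q.2) *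
      f (x + q.1, y + q.2)| ≤ Mr r f x := by
  obtain ⟨i1, e1⟩ := diag_swap hr0 hr (σ := -1) hf hp hi n x y
  obtain ⟨i2, e2⟩ := diag_swap hr0 hr (σ := 1) hf hp hi n x y
  have e : ∫ q in T2, (Real.sin (n * q.1) * Qk r q.1) * Real.cos (n * q.2) *
      f (x + q.1, y + q.2) = (1/2) * ((∫ v in T1, Real.sin (n * v) * Hd r (-1) f x (y + v)) -
        ∫ v in T1, Real.sin (n * v) * Hd r 1 f x (y + v)) := by
    rw [← e1, ← e2, ← integral_sub i1 i2, ← integral_const_mul]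
    congr 1; ext q
    rw [show (n:ℝ) * (q.2 - -1 * q.1) = n * q.2 + n * q.1 by ring,
      show (n:ℝ) * (q.2 - 1 * q.1) = n * q.2 - n * q.1 by ring, Real.sin_add, Real.sin_sub]
    ring
  rw [e]
  unfold Mr
  refine le_trans ?_ (add_le_add (diag_le hp n x y) (diag_le hp n x y))
  rw [← ENNReal.ofReal_add (abs_nonneg _) (abs_nonneg _)]
  apply ENNReal.ofReal_le_ofReal
  rw [abs_mul, abs_of_pos (by norm_num : (0:ℝ) < 1/2)]
  have := abs_sub (∫ v in T1, Real.sin (n * v) * Hd r (-1) f x (y + v))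
    (∫ v in T1, Real.sin (n * v) * Hd r 1 f x (y + v))
  have := abs_nonneg ((∫ v in T1, Real.sin (n * v) * Hd r (-1) f x (y + v)) -
    (∫ v in T1, Real.sin (n * v) * Hd r 1 f x (y + v)))
  linarith

def kn (n : ℕ) (t : ℝ) : ℝ := Real.sin (n * t) / Real.tan (t / 2)

lemma abs_sin_nat (n : ℕ) (t : ℝ) : |Real.sin (n * t)| ≤ n * |Real.sin t| := by
  induction n with
  | zero => simp
  | succ k ih =>
    push_cast
    rw [add_mul, one_mul, Real.sin_add]
    refine (abs_add_le _ _).trans ?_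
    rw [abs_mul, abs_mul]
    have h1 := mul_le_of_le_one_right (abs_nonneg (Real.sin (k * t))) (Real.abs_cos_le_one t)
    have h2 := mul_le_of_le_one_left (abs_nonneg (Real.sin t)) (Real.abs_cos_le_one (k * t))
    linarith

lemma sin_half (t : ℝ) : Real.sin t = 2 * Real.sin (t / 2) * Real.cos (t / 2) := by
  rw [← Real.sin_two_mul]; congr 1; ring

lemma cos_half (t : ℝ) : Real.cos t = 1 - 2 * Real.sin (t / 2) ^ 2 := by
  have := Real.cos_two_mul (t / 2)
  rw [show 2 * (t / 2) = t by ring] at this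
  rw [this]; nlinarith [Real.sin_sq_add_cos_sq (t / 2)]

lemma sinQ_bdd {r : ℝ} (hr0 : 0 < r) (hr : r < 1) (n : ℕ) (t : ℝ) :
    |Real.sin (n * t) * Qk r t| ≤ 2 * n := by
  have h1 : |Real.sin t * Qk r t| ≤ 2 := by
    have hd := Qk_den hr0 hr t
    have e : Real.sin t * Qk r t = 2 * r * Real.sin t ^ 2 / (1 - 2 * r * Real.cos t + r ^ 2) := by
      unfold Qk; ring
    rw [e, abs_of_nonneg (by positivity), div_le_iff₀ hd]
    have hs : Real.sin t ^ 2 = (1 - Real.cos t) * (1 + Real.cos t) := by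
      nlinarith [Real.sin_sq_add_cos_sq t]
    rw [hs]
    have a := Real.cos_le_one t
    have b := Real.neg_one_le_cos t
    have c : (1 - Real.cos t) * (1 + Real.cos t) ≤ (1 - Real.cos t) * 2 :=
      mul_le_mul_of_nonneg_left (by linarith) (by linarith)
    nlinarith
  rw [abs_mul] at h1 ⊢
  calc _ ≤ (n * |Real.sin t|) * |Qk r t| := by gcongr; exact abs_sin_nat n t
    _ = n * (|Real.sin t| * |Qk r t|) := by ring
    _ ≤ n * 2 := by gcongr
    _ = _ := by ring

lemma Qk_lim (t : ℝ) {ρ : ℕ → ℝ} (hρ : Tendsto ρ atTop (nhds 1)) :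
    Tendsto (fun k => Qk (ρ k) t) atTop (nhds (Real.tan (t / 2))⁻¹) := by
  by_cases hs : Real.sin (t / 2) = 0
  · have : Real.sin t = 0 := by rw [sin_half, hs]; simp
    simp [Qk, this, Real.tan_eq_sin_div_cos, hs]
  · have e : (Real.tan (t / 2))⁻¹ = 2 * 1 * Real.sin t / (1 - 2 * 1 * Real.cos t + 1 ^ 2) := by
      rw [Real.tan_eq_sin_div_cos, inv_div, sin_half t, cos_half t]
      have hd : 1 - 2 * 1 * (1 - 2 * Real.sin (t / 2) ^ 2) + 1 ^ 2 = 4 * Real.sin (t / 2) ^ 2 := by ring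
      rw [hd, div_eq_div_iff hs (by positivity)]
      ring
    rw [e]
    unfold Qk
    apply Tendsto.div
    · exact (hρ.const_mul 2).mul_const _
    · exact (((hρ.const_mul 2).mul_const _).const_sub 1).add (hρ.pow 2)
    · rw [cos_half t]
      have : 0 < Real.sin (t / 2) ^ 2 := by positivity
      nlinarith

lemma kn_bdd (n : ℕ) (t : ℝ) : |kn n t| ≤ 2 * n := by
  have hρ : Tendsto (fun k : ℕ => 1 - 1 / ((k:ℝ) + 1 + 1)) atTop (nhds 1) := by
    have h := (tendsto_one_div_add_atTop_nhds_zero_nat (𝕜 := ℝ)).comp (tendsto_add_atTop_nat 1)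
    have := h.const_sub 1
    simpa [Function.comp_def] using this
  have h := ((Qk_lim t hρ).const_mul (Real.sin (n * t))).abs
  apply le_of_tendsto' h
  intro k
  have : (0:ℝ) < 1 / ((k:ℝ) + 1 + 1) := by positivity
  apply sinQ_bdd
  · have : 1 / ((k:ℝ) + 1 + 1) < 1 := by
      rw [div_lt_one (by positivity)]; linarith [Nat.cast_nonneg (α := ℝ) k]
    linarith
  · linarith

def rk (k : ℕ) : ℝ := 1 - 1 / ((k:ℝ) + 1 + 1)

lemma rk_lim : Tendsto rk atTop (nhds 1) := by
  have h := (tendsto_one_div_add_atTop_nhds_zero_nat (𝕜 := ℝ)).comp (tendsto_add_atTop_nat 1)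
  have := h.const_sub 1
  unfold rk
  simpa [Function.comp_def] using this

lemma rk_pos (k : ℕ) : 0 < rk k := by
  unfold rk
  have : 1 / ((k:ℝ) + 1 + 1) < 1 := by
    rw [div_lt_one (by positivity)]; linarith [Nat.cast_nonneg (α := ℝ) k]
  linarith

lemma rk_lt (k : ℕ) : rk k < 1 := by
  unfold rk
  have : (0:ℝ) < 1 / ((k:ℝ) + 1 + 1) := by positivity
  linarith

/-- The mixed term. -/
def An (n : ℕ) (f : ℝ × ℝ → ℝ) (x y : ℝ) : ℝ :=
  ∫ q in T2, kn n q.1 * Real.cos (n * q.2) * f (x + q.1, y + q.2)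

def Bf (f : ℝ × ℝ → ℝ) (x : ℝ) : ENNReal := liminf (fun k => Mr (rk k) f x) atTop

lemma An_bound {f : ℝ × ℝ → ℝ}
    (hf : Measurable f) (hp : Biperiodic f) (hi : IntegrableOn f T2) (n : ℕ) (x y : ℝ) :
    ENNReal.ofReal |An n f x y| ≤ Bf f x := by
  have hsh := f_shift hf hp hi x y
  have ht : Tendsto (fun k => ∫ q in T2, (Real.sin (n * q.1) * Qk (rk k) q.1) * Real.cos (n * q.2) *
      f (x + q.1, y + q.2)) atTop (nhds (An n f x y)) := by
    unfold An
    apply tendsto_integral_of_dominated_convergence (fun q => 2 * n * |f (x + q.1, y + q.2)|)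
    · intro k
      have := (Qk_cont (rk_pos k) (rk_lt k)).measurable
      apply Measurable.aestronglyMeasurable
      fun_prop
    · exact hsh.abs.const_mul _
    · intro k
      apply ae_of_all
      intro q
      rw [Real.norm_eq_abs, abs_mul, abs_mul]
      apply mul_le_mul_of_nonneg_right _ (abs_nonneg _)
      exact (mul_le_of_le_one_right (abs_nonneg _) (Real.abs_cos_le_one _)).trans
        (sinQ_bdd (rk_pos k) (rk_lt k) n q.1)
    · apply ae_of_all
      intro q
      apply Tendsto.mul_const
      apply Tendsto.mul_const
      unfold kn
      rw [div_eq_mul_inv]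
      exact (Qk_lim q.1 rk_lim).const_mul _
  have ht2 := ENNReal.tendsto_ofReal ht.abs
  unfold Bf
  rw [← ht2.liminf_eq]
  refine liminf_le_liminf ?_
  exact Eventually.of_forall fun k => J_bound (rk_pos k) (rk_lt k) hf hp hi n x y

lemma Mr_meas {r : ℝ} (hr0 : 0 < r) (hr : r < 1) {f : ℝ × ℝ → ℝ} (hf : Measurable f) :
    Measurable (Mr r f) := by
  have h : ∀ σ, Measurable fun x => ∫⁻ v in T1, ENNReal.ofReal |Hd r σ f x v| := by
    intro σ
    apply Measurable.lintegral_prod_right (f := fun x v : ℝ => ENNReal.ofReal |Hd r σ f x v|)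
    exact ENNReal.measurable_ofReal.comp (Hd_meas hr0 hr σ hf).abs
  exact (h _).add (h _)

lemma Bf_meas {f : ℝ × ℝ → ℝ} (hf : Measurable f) : Measurable (Bf f) :=
  Measurable.liminf fun k => Mr_meas (rk_pos k) (rk_lt k) hf

lemma Bf_bound : ∃ C : ℝ, 0 < C ∧ ∀ f : ℝ × ℝ → ℝ, Measurable f → Biperiodic f →
    ∫⁻ x in T1, Bf f x ≤ ENNReal.ofReal C * (1 +
        ∫⁻ p in T2, ENNReal.ofReal (|f p| * logPlus |f p|)) := by
  obtain ⟨C, hC, h⟩ := Hd_bound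
  refine ⟨2 * C * (2 * Real.pi), by positivity, ?_⟩
  intro f hf hp
  have hΦm : Measurable (fun p : ℝ × ℝ => ENNReal.ofReal (|f p| * logPlus |f p|)) :=
    ENNReal.measurable_ofReal.comp (hf.abs.mul (logPlus_meas.comp hf.abs))
  rw [T2_restrict, lintegral_prod _ hΦm.aemeasurable]
  set L := ∫⁻ x in T1, ∫⁻ y in T1, ENNReal.ofReal (|f (x, y)| * logPlus |f (x, y)|)
  unfold Bf
  refine (lintegral_liminf_le fun k => Mr_meas (rk_pos k) (rk_lt k) hf).trans ?_
  apply liminf_le_of_le (by isBoundedDefault)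
  intro b hb
  obtain ⟨k, hk⟩ := hb.exists
  refine hk.trans ?_
  unfold Mr
  rw [lintegral_add_left]
  · refine (add_le_add (h _ (rk_pos k) (rk_lt k) (-1) (Or.inr rfl) f hf hp)
      (h _ (rk_pos k) (rk_lt k) 1 (Or.inl rfl) f hf hp)).trans ?_
    rw [← two_mul, ENNReal.ofReal_mul (p := 2 * C) (by positivity),
      ENNReal.ofReal_mul (p := 2) (q := C) (by norm_num), mul_assoc, mul_assoc]
    rw [show ENNReal.ofReal 2 = 2 by simp]
    gcongr
    rw [mul_add, mul_one]
    gcongr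
    apply le_mul_of_one_le_left (zero_le)
    rw [ENNReal.one_le_ofReal]
    linarith [Real.pi_gt_three]
  · apply Measurable.lintegral_prod_right (f := fun x v : ℝ => ENNReal.ofReal |Hd (rk k) (-1) f x v|)
    exact ENNReal.measurable_ofReal.comp (Hd_meas (rk_pos k) (rk_lt k) (-1) hf).abs

lemma T2_vol : (volume T2 : ENNReal) = ENNReal.ofReal (4 * Real.pi ^ 2) := by
  unfold T2
  rw [Measure.volume_eq_prod, Measure.prod_prod, T1_vol, ← ENNReal.ofReal_mul (by positivity)]
  congr 1; ring

lemma T2_meas : MeasurableSet T2 := T1_meas.prod T1_meas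

lemma ae_ne_T2 (a : ℝ) : ∀ᵐ q ∂(volume.restrict T2 : Measure (ℝ × ℝ)), q.1 ≠ a ∧ q.2 ≠ a := by
  have h : ∀ᵐ x ∂(volume.restrict T1 : Measure ℝ), x ≠ a := ae_restrict_of_ae (Measure.ae_ne volume a)
  rw [T2_restrict]
  exact (Measure.quasiMeasurePreserving_fst.ae h).and (Measure.quasiMeasurePreserving_snd.ae h)

lemma pv_eq {g : ℝ × ℝ → ℝ} (hg : IntegrableOn g T2) {L : ℝ} (h : pvT2 g L) :
    L = ∫ q in T2, g q := by
  unfold pvT2 at h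
  refine tendsto_nhds_unique h ?_
  have hSm : ∀ ε : ℝ, MeasurableSet
      {q : ℝ × ℝ | (ε < |q.1| ∧ |q.1| < Real.pi) ∧ ε < |q.2| ∧ |q.2| < Real.pi} := by
    intro ε
    have h1 : Measurable fun q : ℝ × ℝ => |q.1| := measurable_fst.abs
    have h2 : Measurable fun q : ℝ × ℝ => |q.2| := measurable_snd.abs
    exact ((measurableSet_lt measurable_const h1).inter (measurableSet_lt h1 measurable_const)).inter
      ((measurableSet_lt measurable_const h2).inter (measurableSet_lt h2 measurable_const))
  have e : ∀ ε : ℝ, ∫ q in {q : ℝ × ℝ | (ε < |q.1| ∧ |q.1| < Real.pi) ∧ ε < |q.2| ∧ |q.2| < Real.pi}, g q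
      = ∫ q in T2, indicator {q : ℝ × ℝ | (ε < |q.1| ∧ |q.1| < Real.pi) ∧ ε < |q.2| ∧ |q.2| < Real.pi} g q := by
    intro ε
    rw [setIntegral_indicator (hSm ε)]
    congr 2
    symm
    apply inter_eq_right.2
    rintro q ⟨⟨-, h1⟩, -, h2⟩
    rw [abs_lt] at h1 h2
    exact ⟨⟨h1.1.le, h1.2⟩, ⟨h2.1.le, h2.2⟩⟩
  simp_rw [e]
  apply tendsto_integral_filter_of_dominated_convergence (fun q => ‖g q‖)
  · exact Eventually.of_forall fun ε => hg.1.indicator (hSm ε)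
  · exact Eventually.of_forall fun ε => ae_of_all _ fun q => norm_indicator_le_norm_self _ _
  · exact hg.norm
  · filter_upwards [ae_ne_T2 0, ae_ne_T2 (-Real.pi), ae_restrict_mem T2_meas] with q h0 h1 hq
    apply tendsto_const_nhds.congr'
    have hm : 0 < min |q.1| |q.2| := lt_min (abs_pos.2 h0.1) (abs_pos.2 h0.2)
    have : ∀ᶠ ε : ℝ in nhdsWithin 0 (Ioi 0), ε < min |q.1| |q.2| :=
      nhdsWithin_le_nhds (eventually_lt_nhds hm)
    filter_upwards [this] with ε hε
    rw [lt_min_iff] at hε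
    rw [indicator_of_mem]
    refine ⟨⟨hε.1, ?_⟩, hε.2, ?_⟩
    · exact abs_lt.2 ⟨lt_of_le_of_ne hq.1.1 h1.1.symm, hq.1.2⟩
    · exact abs_lt.2 ⟨lt_of_le_of_ne hq.2.1 h1.2.symm, hq.2.2⟩

lemma kn_meas (n : ℕ) : Measurable (kn n) := by
  have : Measurable Real.tan := by
    have e : Real.tan = fun x => Real.sin x / Real.cos x := by
      ext x; exact Real.tan_eq_sin_div_cos x
    rw [e]; fun_prop
  unfold kn
  fun_prop

lemma dirichlet_id (n : ℕ) {t : ℝ} (hs : Real.sin (t / 2) ≠ 0) :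
    Real.sin (((n : ℝ) + 1 / 2) * t) / Real.sin (t / 2) = kn n t + Real.cos (n * t) := by
  unfold kn
  rw [Real.tan_eq_sin_div_cos, div_div_eq_mul_div, div_add' _ _ _ hs]
  congr 1
  rw [show ((n : ℝ) + 1 / 2) * t = n * t + t / 2 by ring, Real.sin_add]

lemma sin_half_ne {t : ℝ} (ht : t ∈ T1) (h0 : t ≠ 0) : Real.sin (t / 2) ≠ 0 := by
  obtain ⟨h1, h2⟩ := ht
  intro h
  rw [Real.sin_eq_zero_iff_of_lt_of_lt (by linarith [Real.pi_pos]) (by linarith [Real.pi_pos])] at h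
  apply h0; linarith

lemma diff_bound {f : ℝ × ℝ → ℝ} (hf : Measurable f) (hp : Biperiodic f) (hi : IntegrableOn f T2)
    (n : ℕ) (p : ℝ × ℝ) {L : ℝ}
    (hL : pvT2 (fun q => (1 / Real.pi ^ 2) *
              (Real.sin ((n : ℝ) * q.1) * Real.sin ((n : ℝ) * q.2) /
                (4 * Real.tan (q.1 / 2) * Real.tan (q.2 / 2))) * f (p.1 + q.1, p.2 + q.2)) L) :
    ENNReal.ofReal |SnnKer f n p.1 p.2 - L| ≤
      Bf f p.1 + Bf (fun p => f p.swap) p.2 + ∫⁻ p in T2, ENNReal.ofReal |f p| := by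
  obtain ⟨x, y⟩ := p
  simp only at *
  have hsh := f_shift hf hp hi x y
  have hk := kn_meas n
  have hc : ∀ u : ℝ, |Real.cos u| ≤ 1 := Real.abs_cos_le_one
  -- the integrability facts
  have bdd : ∀ {a : ℝ → ℝ} {b : ℝ → ℝ} {M : ℝ}, Measurable a → Measurable b →
      (∀ t s, |a t * b s| ≤ M) →
      IntegrableOn (fun q : ℝ × ℝ => a q.1 * b q.2 * f (x + q.1, y + q.2)) T2 := by
    intro a b M ha hb hM
    exact Integrable.bdd_mul hsh (Measurable.aestronglyMeasurable (by fun_prop))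
      (ae_of_all _ fun q => hM _ _)
  have kb := kn_bdd n
  have ikk : IntegrableOn (fun q : ℝ × ℝ => kn n q.1 * kn n q.2 * f (x + q.1, y + q.2)) T2 := by
    apply bdd hk hk (M := (2 * n) * (2 * n))
    intro t s
    rw [abs_mul]
    exact mul_le_mul (kb t) (kb s) (abs_nonneg _) (by positivity)
  have ikc : IntegrableOn (fun q : ℝ × ℝ => kn n q.1 * Real.cos (n * q.2) * f (x + q.1, y + q.2)) T2 := by
    apply bdd (b := fun s => Real.cos (n * s)) hk (by fun_prop) (M := (2 * n) * 1)
    intro t s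
    rw [abs_mul]
    exact mul_le_mul (kb t) (hc _) (abs_nonneg _) (by positivity)
  have ick : IntegrableOn (fun q : ℝ × ℝ => Real.cos (n * q.1) * kn n q.2 * f (x + q.1, y + q.2)) T2 := by
    apply bdd (a := fun s => Real.cos (n * s)) (by fun_prop) hk (M := 1 * (2 * n))
    intro t s
    rw [abs_mul]
    exact mul_le_mul (hc _) (kb s) (abs_nonneg _) (by positivity)
  have icc : IntegrableOn (fun q : ℝ × ℝ => Real.cos (n * q.1) * Real.cos (n * q.2) *
      f (x + q.1, y + q.2)) T2 := by
    apply bdd (a := fun s => Real.cos (n * s)) (b := fun s => Real.cos (n * s)) (by fun_prop)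
      (by fun_prop) (M := 1 * 1)
    intro t s
    rw [abs_mul]
    exact mul_le_mul (hc _) (hc _) (abs_nonneg _) (by positivity)
  have eL : L = (1 / (4 * Real.pi ^ 2)) * ∫ q in T2, kn n q.1 * kn n q.2 * f (x + q.1, y + q.2) := by
    have e : ∀ q : ℝ × ℝ, (1 / Real.pi ^ 2) *
              (Real.sin ((n : ℝ) * q.1) * Real.sin ((n : ℝ) * q.2) /
                (4 * Real.tan (q.1 / 2) * Real.tan (q.2 / 2))) * f (x + q.1, y + q.2) =
        (1 / (4 * Real.pi ^ 2)) * (kn n q.1 * kn n q.2 * f (x + q.1, y + q.2)) := by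
      intro q
      unfold kn
      simp only [div_eq_mul_inv, mul_inv]
      ring
    simp_rw [e] at hL
    rw [pv_eq (ikk.const_mul _) hL, integral_const_mul]
  have eS : SnnKer f n x y = (1 / (4 * Real.pi ^ 2)) *
      ((∫ q in T2, kn n q.1 * kn n q.2 * f (x + q.1, y + q.2)) + (An n f x y +
       ((∫ q in T2, Real.cos (n * q.1) * kn n q.2 * f (x + q.1, y + q.2)) +
        ∫ q in T2, Real.cos (n * q.1) * Real.cos (n * q.2) * f (x + q.1, y + q.2)))) := by
    unfold SnnKer An
    have i3 := ick.add icc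
    have i2 := ikc.add i3
    rw [← integral_add' ick icc, ← integral_add' ikc i3, ← integral_add' ikk i2]
    rw [show (1:ℝ) / (4 * Real.pi ^ 2) = (1 / Real.pi ^ 2) * (1 / 4) by
      rw [one_div_mul_one_div]; ring_nf, mul_assoc]
    congr 1
    rw [← integral_const_mul]
    apply integral_congr_ae
    filter_upwards [ae_ne_T2 0, ae_restrict_mem T2_meas] with q h0 hq
    have d1 := dirichlet_id n (sin_half_ne hq.1 h0.1)
    have d2 := dirichlet_id n (sin_half_ne hq.2 h0.2)
    have : Real.sin (((n : ℝ) + 1 / 2) * q.1) * Real.sin (((n : ℝ) + 1 / 2) * q.2) /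
          (4 * Real.sin (q.1 / 2) * Real.sin (q.2 / 2)) =
        (1 / 4) * ((Real.sin (((n : ℝ) + 1 / 2) * q.1) / Real.sin (q.1 / 2)) *
          (Real.sin (((n : ℝ) + 1 / 2) * q.2) / Real.sin (q.2 / 2))) := by
      simp only [div_eq_mul_inv, mul_inv]
      ring
    rw [this, d1, d2]
    simp only [Pi.add_apply]
    ring
  have eswap : ∫ q in T2, Real.cos (n * q.1) * kn n q.2 * f (x + q.1, y + q.2) =
      An n (fun p => f p.swap) y x := by
    unfold An
    rw [T2_restrict, ← integral_prod_swap]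
    congr 1; ext q
    simp only [Prod.fst_swap, Prod.snd_swap, Prod.swap_prod_mk]
    ring
  have hi' : IntegrableOn (fun p : ℝ × ℝ => f p.swap) T2 := by
    unfold IntegrableOn at hi ⊢
    rw [T2_restrict] at hi ⊢
    exact hi.swap
  have b1 := An_bound hf hp hi n x y
  have b2 := An_bound (f := fun p => f p.swap) (hf.comp measurable_swap)
    (fun x y => ⟨(hp y x).2, (hp y x).1⟩) hi' n y x
  have b3 : ENNReal.ofReal |∫ q in T2, Real.cos (n * q.1) * Real.cos (n * q.2) * f (x + q.1, y + q.2)| ≤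
      ∫⁻ p in T2, ENNReal.ofReal |f p| := by
    refine (ofReal_abs_int_le _ _).trans ?_
    have hs := lint_sheared (φ := fun q => ENNReal.ofReal |f q|)
      (ENNReal.measurable_ofReal.comp hf.abs)
      (fun a b => by simp only [(hp a b).1, (hp a b).2, and_self]) 0 x y
    rw [← hs]
    apply lintegral_mono
    intro q
    simp only [zero_mul, add_zero]
    apply ENNReal.ofReal_le_ofReal
    rw [abs_mul, abs_mul]
    apply mul_le_of_le_one_left (abs_nonneg _)
    exact mul_le_one₀ (hc _) (abs_nonneg _) (hc _)
  refine le_trans ?_ (add_le_add (add_le_add b1 b2) b3)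
  rw [← ENNReal.ofReal_add (abs_nonneg _) (abs_nonneg _),
    ← ENNReal.ofReal_add (by positivity) (abs_nonneg _)]
  apply ENNReal.ofReal_le_ofReal
  rw [eS, eL, eswap, ← mul_sub, add_sub_cancel_left, abs_mul]
  have hc1 : |1 / (4 * Real.pi ^ 2)| ≤ 1 := by
    rw [abs_of_pos (by positivity), div_le_one (by positivity)]
    nlinarith [Real.pi_gt_three]
  refine (mul_le_of_le_one_left (abs_nonneg _) hc1).trans ?_
  rw [← add_assoc]
  exact (abs_add_le _ _).trans (add_le_add (abs_add_le _ _) le_rfl)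

/-- Lemma 2: there is an absolute constant `c > 0` such that for every
`f ∈ L log L(𝕋²)`,
`∬_{𝕋²} sup_{n≥1} |S_{nn}(x,y,f) - S*_{nn}(x,y,f)| dx dy ≤ c (1 + ∬ |f| log⁺|f|)`,
where `S*_{nn}` is the modified quadratic partial sum given by the principal value
`(1/π²) p.v. ∬_{𝕋²} [sin(nt) sin(ns) / (4 tan(t/2) tan(s/2))] f(x+t, y+s) dt ds`. -/
theorem integral_sup_Snn_sub_SnnStar :
    ∃ c : ℝ, 0 < c ∧ ∀ f : ℝ × ℝ → ℝ, Measurable f → Biperiodic f →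
      IntegrableOn f T2 → IntegrableOn (fun p => |f p| * logPlus |f p|) T2 →
      ∀ Sstar : ℕ → ℝ × ℝ → ℝ,
        (∀ n : ℕ, 1 ≤ n → ∀ᵐ p : ℝ × ℝ,
          pvT2 (fun q => (1 / Real.pi ^ 2) *
              (Real.sin ((n : ℝ) * q.1) * Real.sin ((n : ℝ) * q.2) /
                (4 * Real.tan (q.1 / 2) * Real.tan (q.2 / 2))) * f (p.1 + q.1, p.2 + q.2))
            (Sstar n p)) →
        (∫ p in T2, ⨆ n : ℕ, |SnnKer f (n + 1) p.1 p.2 - Sstar (n + 1) p|) ≤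
          c * (1 + ∫ p in T2, |f p| * logPlus |f p|) := by
  obtain ⟨C, hC, hB⟩ := Bf_bound
  refine ⟨4 * Real.pi * C + 48 * Real.pi ^ 4 + 4 * Real.pi ^ 2, by positivity, ?_⟩
  intro f hf hp hi hl Sstar hS
  set Φ : ℝ × ℝ → ℝ := fun p => |f p| * logPlus |f p| with hΦ
  have hΦ0 : ∀ p, 0 ≤ Φ p := fun p => mul_nonneg (abs_nonneg _) (logPlus_nonneg _)
  have hI0 : 0 ≤ ∫ p in T2, Φ p := integral_nonneg hΦ0
  set f' : ℝ × ℝ → ℝ := fun p => f p.swap with hf'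
  have hf'm : Measurable f' := hf.comp measurable_swap
  have hp' : Biperiodic f' := fun x y => ⟨(hp y x).2, (hp y x).1⟩
  have hi' : IntegrableOn f' T2 := by
    unfold IntegrableOn at hi ⊢
    rw [T2_restrict] at hi ⊢
    exact hi.swap
  have hL : ∫⁻ p in T2, ENNReal.ofReal (Φ p) = ENNReal.ofReal (∫ p in T2, Φ p) :=
    (ofReal_integral_eq_lintegral_ofReal hl (ae_of_all _ hΦ0)).symm
  have hL' : ∫⁻ p in T2, ENNReal.ofReal (|f' p| * logPlus |f' p|) = ENNReal.ofReal (∫ p in T2, Φ p) := by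
    rw [← hL, T2_restrict]
    exact lintegral_prod_swap (fun p => ENNReal.ofReal (Φ p))
  set L := ∫ p in T2, Φ p with hLdef
  set N : ENNReal := ∫⁻ p in T2, ENNReal.ofReal |f p| with hN
  have hpt : ∀ᵐ p ∂(volume.restrict T2 : Measure (ℝ × ℝ)), ∀ n : ℕ,
      ENNReal.ofReal |SnnKer f (n + 1) p.1 p.2 - Sstar (n + 1) p| ≤ Bf f p.1 + Bf f' p.2 + N := by
    have : ∀ᵐ p ∂(volume.restrict T2 : Measure (ℝ × ℝ)), ∀ n : ℕ, _ :=
      ae_all_iff.2 fun n => ae_restrict_of_ae (hS (n + 1) (by omega))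
    filter_upwards [this] with p hpv n
    exact diff_bound hf hp hi (n + 1) p (hpv n)
  have hsup : ∀ᵐ p ∂(volume.restrict T2 : Measure (ℝ × ℝ)),
      ENNReal.ofReal (⨆ n : ℕ, |SnnKer f (n + 1) p.1 p.2 - Sstar (n + 1) p|) ≤
        Bf f p.1 + Bf f' p.2 + N := by
    filter_upwards [hpt] with p h
    by_cases htop : Bf f p.1 + Bf f' p.2 + N = ⊤
    · rw [htop]; exact le_top
    · rw [ENNReal.ofReal_le_iff_le_toReal htop]
      exact ciSup_le fun n => (ENNReal.ofReal_le_iff_le_toReal htop).1 (h n)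
  have hNle : N ≤ ENNReal.ofReal (12 * Real.pi ^ 2 + L) := by
    have hc : ∫⁻ p in T2, ENNReal.ofReal 3 = ENNReal.ofReal (12 * Real.pi ^ 2) := by
      rw [lintegral_const, Measure.restrict_apply_univ, T2_vol, ← ENNReal.ofReal_mul (by norm_num)]
      congr 1; ring
    rw [ENNReal.ofReal_add (by positivity) hI0, ← hL, ← hc, ← lintegral_add_left measurable_const]
    apply lintegral_mono
    intro p
    simp only
    rw [← ENNReal.ofReal_add (by norm_num) (hΦ0 p)]
    exact ENNReal.ofReal_le_ofReal (le_logPlus (abs_nonneg _))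
  have hInt1 : ∫⁻ p in T2, (Bf f p.1 + Bf f' p.2 + N) ≤
      ENNReal.ofReal ((4 * Real.pi * C + 48 * Real.pi ^ 4 + 4 * Real.pi ^ 2) * (1 + L)) := by
    have m1 : Measurable fun p : ℝ × ℝ => Bf f p.1 := (Bf_meas hf).comp measurable_fst
    have m2 : Measurable fun p : ℝ × ℝ => Bf f' p.2 := (Bf_meas hf'm).comp measurable_snd
    rw [lintegral_add_right _ measurable_const, lintegral_add_left m1, lintegral_const,
      Measure.restrict_apply_univ, T2_vol]
    have b1 : ∫⁻ p in T2, Bf f p.1 ≤ ENNReal.ofReal (2 * Real.pi * C * (1 + L)) := by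
      rw [T2_restrict, lintegral_prod _ m1.aemeasurable]
      simp only [lintegral_const, Measure.restrict_apply_univ, T1_vol]
      rw [lintegral_mul_const _ (Bf_meas hf)]
      refine (mul_le_mul_left (hB f hf hp) _).trans ?_
      rw [hL, ← ENNReal.ofReal_one, ← ENNReal.ofReal_add (by norm_num) hI0,
        ← ENNReal.ofReal_mul hC.le, ← ENNReal.ofReal_mul (by positivity)]
      apply ENNReal.ofReal_le_ofReal
      apply le_of_eq; ring
    have b2 : ∫⁻ p in T2, Bf f' p.2 ≤ ENNReal.ofReal (2 * Real.pi * C * (1 + L)) := by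
      rw [T2_restrict, lintegral_prod _ m2.aemeasurable]
      simp only [lintegral_const, Measure.restrict_apply_univ, T1_vol]
      refine (mul_le_mul_left (hB f' hf'm hp') _).trans ?_
      rw [hL', ← ENNReal.ofReal_one, ← ENNReal.ofReal_add (by norm_num) hI0,
        ← ENNReal.ofReal_mul hC.le, ← ENNReal.ofReal_mul (by positivity)]
      apply ENNReal.ofReal_le_ofReal
      apply le_of_eq; ring
    refine (add_le_add (add_le_add b1 b2) (mul_le_mul_left hNle _)).trans ?_
    rw [← ENNReal.ofReal_mul (by positivity), ← ENNReal.ofReal_add (by positivity) (by positivity),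
      ← ENNReal.ofReal_add (by positivity) (by positivity)]
    apply ENNReal.ofReal_le_ofReal
    have : 0 ≤ Real.pi ^ 4 * L := by positivity
    nlinarith [sq_nonneg Real.pi]
  by_cases hint2 : Integrable (fun p : ℝ × ℝ => ⨆ n : ℕ, |SnnKer f (n + 1) p.1 p.2 - Sstar (n + 1) p|)
      (volume.restrict T2)
  · have h0 : ∀ p : ℝ × ℝ, 0 ≤ ⨆ n : ℕ, |SnnKer f (n + 1) p.1 p.2 - Sstar (n + 1) p| :=
      fun p => Real.iSup_nonneg fun n => abs_nonneg _
    rw [← ENNReal.ofReal_le_ofReal_iff (by positivity),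
      ofReal_integral_eq_lintegral_ofReal hint2 (ae_of_all _ h0)]
    exact (lintegral_mono_ae hsup).trans hInt1
  · rw [integral_undef hint2]
    positivity
end
end
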